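/- Every ℝ-building (Λ,F) of type (W̄,S) can be embedded in a metrically complete ℝ-building of the same type, with extension of isometries: there exist a metrically complete ℝ-building (Λ',F') of type (W̄,S) and an isometric embedding ι : Λ → Λ' such that ι∘f ∈ F' for every f ∈ F, and there is a group homomorphism g ↦ g' from the group of automorphisms of (Λ,F) to the group of automorphisms of (Λ',F') satisfying g'∘ι = ι∘g for every automorphism g of (Λ,F). -/

import Mathlib

open Set

noncomputable section

/-- The model space `𝔸`: Euclidean `n`-space. -/
abbrev ModelSpace (n : ℕ) : Type := EuclideanSpace ℝ (Fin n)

/-- A linear reflection of the model space: an involutive isometry, different from the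
identity, whose fixed-point set is a linear hyperplane (the kernel of a nonzero linear
functional). -/
def IsLinearReflection {n : ℕ} (s : ModelSpace n ≃ᵢ ModelSpace n) : Prop :=
  s * s = 1 ∧ s ≠ 1 ∧
    ∃ p : ModelSpace n →ₗ[ℝ] ℝ, p ≠ 0 ∧ {x | s x = x} = {x | p x = 0}

/-- A spherical Coxeter system of rank `n`, realized as a finite reflection group acting
on the model space `ℝⁿ`: a finite set `S` of linear reflections generating a finite
group `W̄`. -/
structure SphericalCoxeterSystem (n : ℕ) where
  S : Set (ModelSpace n ≃ᵢ ModelSpace n)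
  finiteS : S.Finite
  refl : ∀ s ∈ S, IsLinearReflection s
  finiteW : Finite ↥(Subgroup.closure S)

namespace SphericalCoxeterSystem

variable {n : ℕ}

/-- The finite reflection group `W̄` generated by `S`. -/
def Wbar (cs : SphericalCoxeterSystem n) : Subgroup (ModelSpace n ≃ᵢ ModelSpace n) :=
  Subgroup.closure cs.S

/-- A translation of the model space. -/
def IsTranslation (t : ModelSpace n ≃ᵢ ModelSpace n) : Prop :=
  ∃ v : ModelSpace n, ∀ x, t x = x + v

/-- The group `W` of affine transformations generated by `W̄` and all translations. -/
def W (cs : SphericalCoxeterSystem n) : Subgroup (ModelSpace n ≃ᵢ ModelSpace n) :=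
  Subgroup.closure (cs.S ∪ {t | IsTranslation t})

/-- An affine reflection: a `W`-conjugate of a generator in `S`. -/
def IsAffineReflection (cs : SphericalCoxeterSystem n)
    (r : ModelSpace n ≃ᵢ ModelSpace n) : Prop :=
  ∃ s ∈ cs.S, ∃ w ∈ cs.W, r = w * s * w⁻¹

/-- A wall of the model space: the fixed-point set of an affine reflection. -/
def IsModelWall (cs : SphericalCoxeterSystem n) (M : Set (ModelSpace n)) : Prop :=
  ∃ r, cs.IsAffineReflection r ∧ M = {x | r x = x}

/-- A half-apartment of the model space: a closed half-space `H` bounded by the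
wall `M` (fixed-point set of the affine reflection `r`). -/
def IsModelHalf (cs : SphericalCoxeterSystem n) (M H : Set (ModelSpace n)) : Prop :=
  ∃ r, cs.IsAffineReflection r ∧ M = {x | r x = x} ∧
    IsClosed H ∧ Convex ℝ H ∧ H ∪ (⇑r '' H) = univ ∧ H ∩ (⇑r '' H) = M

/-- A sector-face of the model space based at `x`: a closed cell of the arrangement of
all walls through `x` (for each wall through `x` one chooses either the wall itself or
one of its two half-apartments, and takes the intersection of the choices). -/
def IsModelSectorFace (cs : SphericalCoxeterSystem n) (x : ModelSpace n)
    (F : Set (ModelSpace n)) : Prop :=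
  F.Nonempty ∧ ∃ σ : Set (ModelSpace n) → Set (ModelSpace n),
    (∀ M, cs.IsModelWall M → x ∈ M → (σ M = M ∨ cs.IsModelHalf M (σ M))) ∧
    F = ⋂ M ∈ {M | cs.IsModelWall M ∧ x ∈ M}, σ M

/-- A sector of the model space based at `x`: a maximal sector-face based at `x`. -/
def IsModelSector (cs : SphericalCoxeterSystem n) (x : ModelSpace n)
    (F : Set (ModelSpace n)) : Prop :=
  cs.IsModelSectorFace x F ∧ ∀ F', cs.IsModelSectorFace x F' → F ⊆ F' → F' = F

/-- A sector-panel of the model space based at `x`: a sector-face of codimension one. -/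
def IsModelSectorPanel (cs : SphericalCoxeterSystem n) (x : ModelSpace n)
    (F : Set (ModelSpace n)) : Prop :=
  cs.IsModelSectorFace x F ∧ Module.finrank ℝ (affineSpan ℝ F).direction = n - 1

/-- The word length on `W̄` with respect to the generating set `S`. -/
def wordLength (cs : SphericalCoxeterSystem n) (w : ModelSpace n ≃ᵢ ModelSpace n) : ℕ :=
  sInf {k | ∃ l : List (ModelSpace n ≃ᵢ ModelSpace n),
    l.length = k ∧ (∀ s ∈ l, s ∈ cs.S) ∧ l.prod = w}

/-- The longest element of `W̄`. -/
def IsLongest (cs : SphericalCoxeterSystem n) (w : ModelSpace n ≃ᵢ ModelSpace n) : Prop :=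
  w ∈ cs.Wbar ∧ ∀ v ∈ cs.Wbar, cs.wordLength v ≤ cs.wordLength w

end SphericalCoxeterSystem

section Building

variable {n : ℕ} {X : Type*} [MetricSpace X]

/-- Two subsets of a metric space are parallel if their Hausdorff distance is finite. -/
def Par (S T : Set X) : Prop := EMetric.hausdorffEdist S T ≠ ⊤

/-- Two sets locally coincide at `α` (have the same germ at `α`) if their intersection
is a neighbourhood of `α` in both of them. -/
def LocCoin (α : X) (F F' : Set X) : Prop :=
  F ∩ F' ∈ nhdsWithin α F ∧ F ∩ F' ∈ nhdsWithin α F'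

variable (cs : SphericalCoxeterSystem n)

/-- An apartment: the image of a chart. -/
def IsApartment (Fc : Set (ModelSpace n → X)) (A : Set X) : Prop :=
  ∃ f ∈ Fc, A = range f

/-- A sector-face based at `α` : the image under a chart of a sector-face of the model
space, with base point mapped to `α`. -/
def IsSectorFaceAt (Fc : Set (ModelSpace n → X)) (α : X) (F : Set X) : Prop :=
  ∃ f ∈ Fc, ∃ x s, cs.IsModelSectorFace x s ∧ f x = α ∧ F = f '' s

/-- A sector based at `α`. -/
def IsSectorAt (Fc : Set (ModelSpace n → X)) (α : X) (F : Set X) : Prop :=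
  ∃ f ∈ Fc, ∃ x s, cs.IsModelSector x s ∧ f x = α ∧ F = f '' s

/-- A sector-panel based at `α`. -/
def IsSectorPanelAt (Fc : Set (ModelSpace n → X)) (α : X) (F : Set X) : Prop :=
  ∃ f ∈ Fc, ∃ x s, cs.IsModelSectorPanel x s ∧ f x = α ∧ F = f '' s

/-- A sector-face. -/
def IsSectorFace (Fc : Set (ModelSpace n → X)) (F : Set X) : Prop :=
  ∃ α, IsSectorFaceAt cs Fc α F

/-- A sector. -/
def IsSector (Fc : Set (ModelSpace n → X)) (F : Set X) : Prop :=
  ∃ α, IsSectorAt cs Fc α F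

/-- A sector-panel. -/
def IsSectorPanel (Fc : Set (ModelSpace n → X)) (F : Set X) : Prop :=
  ∃ α, IsSectorPanelAt cs Fc α F

/-- A wall: the image of a wall of the model space under a chart. -/
def IsWall (Fc : Set (ModelSpace n → X)) (M : Set X) : Prop :=
  ∃ f ∈ Fc, ∃ m, cs.IsModelWall m ∧ M = f '' m

/-- A half-apartment: the image of a half-apartment of the model space under a chart. -/
def IsHalfApartment (Fc : Set (ModelSpace n → X)) (H : Set X) : Prop :=
  ∃ f ∈ Fc, ∃ m h, cs.IsModelHalf m h ∧ H = f '' h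

/-- An ℝ-building of type `(W̄,S)` with set of points `Λ` inside the ambient metric
space `X` (taking `Λ` a subset of an ambient metric space makes it possible to speak of
one ℝ-building being contained in another): a set of isometric charts from the model
space satisfying the axioms (A1)–(A5). -/
structure RBuilding (cs : SphericalCoxeterSystem n) (X : Type*) [MetricSpace X]
    (Λ : Set X) : Type _ where
  charts : Set (ModelSpace n → X)
  isom : ∀ f ∈ charts, Isometry f
  into : ∀ f ∈ charts, range f ⊆ Λ
  A1 : ∀ f ∈ charts, ∀ w ∈ cs.W, (f ∘ ⇑w) ∈ charts
  A2 : ∀ f ∈ charts, ∀ g ∈ charts,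
        IsClosed {x | f x ∈ range g} ∧ Convex ℝ {x | f x ∈ range g} ∧
        ∃ w ∈ cs.W, ∀ x, f x ∈ range g → f x = g (w x)
  A3 : ∀ p ∈ Λ, ∀ q ∈ Λ, ∃ f ∈ charts, p ∈ range f ∧ q ∈ range f
  A4 : ∀ S₁ S₂, IsSector cs charts S₁ → IsSector cs charts S₂ →
        ∃ T₁ T₂ f, f ∈ charts ∧ IsSector cs charts T₁ ∧ IsSector cs charts T₂ ∧
          T₁ ⊆ S₁ ∧ T₂ ⊆ S₂ ∧ T₁ ⊆ range f ∧ T₂ ⊆ range f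
  A5 : ∀ f₁ ∈ charts, ∀ f₂ ∈ charts, ∀ f₃ ∈ charts,
        IsHalfApartment cs charts (range f₁ ∩ range f₂) →
        IsHalfApartment cs charts (range f₂ ∩ range f₃) →
        IsHalfApartment cs charts (range f₁ ∩ range f₃) →
        (range f₁ ∩ range f₂ ∩ range f₃).Nonempty

/-- The Weyl distance, inside the apartment given by the chart `f`, from the sector `S`
to the sector `S'` (both contained in that apartment): the element `w ∈ W̄` mapping the
sector of the model space based at the origin parallel to `f⁻¹(S)` to the one parallel
to `f⁻¹(S')`. -/
def WeylDistIn (f : ModelSpace n → X) (S S' : Set X)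
    (w : ModelSpace n ≃ᵢ ModelSpace n) : Prop :=
  w ∈ cs.Wbar ∧ ∃ s s', cs.IsModelSector 0 s ∧ cs.IsModelSector 0 s' ∧
    Par (f '' s) S ∧ Par (f '' s') S' ∧ ⇑w '' s = s'

/-- `w` is the Weyl distance from the germ at `α` of the sector `S` to the germ at `α`
of the sector `S'` (both based at `α`): computed via sectors based at `α` with the same
germs lying in a common apartment. -/
def GermWeylDist (Fc : Set (ModelSpace n → X)) (α : X) (S S' : Set X)
    (w : ModelSpace n ≃ᵢ ModelSpace n) : Prop :=
  ∃ f ∈ Fc, ∃ T T', IsSectorAt cs Fc α T ∧ IsSectorAt cs Fc α T' ∧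
    T ⊆ range f ∧ T' ⊆ range f ∧ LocCoin α S T ∧ LocCoin α S' T' ∧
    WeylDistIn cs f T T' w

/-- `w` is the Weyl distance between the chambers at infinity represented by the
sectors `S` and `S'`: computed via parallel sectors lying in a common apartment. -/
def ChamberWeylDist (Fc : Set (ModelSpace n → X)) (S S' : Set X)
    (w : ModelSpace n ≃ᵢ ModelSpace n) : Prop :=
  ∃ f ∈ Fc, ∃ T T', IsSector cs Fc T ∧ IsSector cs Fc T' ∧
    T ⊆ range f ∧ T' ⊆ range f ∧ Par T S ∧ Par T' S' ∧ WeylDistIn cs f T T' w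

/-- The germs at `α` of two sectors based at `α` are opposite if their Weyl distance is
the longest element of `W̄`. -/
def OppositeGerms (Fc : Set (ModelSpace n → X)) (α : X) (S S' : Set X) : Prop :=
  ∃ w, GermWeylDist cs Fc α S S' w ∧ cs.IsLongest w

/-- Two chambers at infinity (represented by the sectors `C`, `D`) are adjacent if they
are distinct and their Weyl distance lies in `S`. -/
def AdjacentChambers (Fc : Set (ModelSpace n → X)) (C D : Set X) : Prop :=
  ¬ Par C D ∧ ∃ s ∈ cs.S, ChamberWeylDist cs Fc C D s

/-- Two sector-panels are asymptotic if they contain a common subset which is itself a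
sector-panel. -/
def Asymptotic (Fc : Set (ModelSpace n → X)) (P P' : Set X) : Prop :=
  ∃ Q, IsSectorPanel cs Fc Q ∧ Q ⊆ P ∧ Q ⊆ P'

/-- An automorphism of an ℝ-building: an isometry `g` of `Λ` with `g ∘ f` a chart for
every chart `f`. -/
def RBuilding.IsAuto {Λ : Set X} (B : RBuilding cs X Λ) (g : ↥Λ ≃ᵢ ↥Λ) : Prop :=
  ∀ f (hf : f ∈ B.charts),
    (fun a : ModelSpace n =>
      ((g ⟨f a, B.into f hf (mem_range_self a)⟩ : ↥Λ) : X)) ∈ B.charts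

end Building

section CAT0

/-- `G` is a geodesic segment from `x` to `y`: an isometric image of a closed real
interval with endpoints `x` and `y`. -/
def IsGeodesicSegment {Y : Type*} [MetricSpace Y] (x y : Y) (G : Set Y) : Prop :=
  ∃ (a b : ℝ) (γ : ℝ → Y), a ≤ b ∧ γ a = x ∧ γ b = y ∧
    (∀ s ∈ Set.Icc a b, ∀ t ∈ Set.Icc a b, dist (γ s) (γ t) = |s - t|) ∧
    G = γ '' Set.Icc a b

/-- A CAT(0) space: a geodesic metric space in which every geodesic triangle satisfies
the CAT(0) comparison inequality with respect to comparison triangles in the Euclidean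
plane. -/
def IsCAT0Space (Y : Type*) [MetricSpace Y] : Prop :=
  (∀ x y : Y, ∃ G, IsGeodesicSegment x y G) ∧
  ∀ (x y z : Y) (G : Set Y), IsGeodesicSegment x y G → ∀ a ∈ G,
    ∀ x' y' z' : EuclideanSpace ℝ (Fin 2),
      dist x' y' = dist x y → dist y' z' = dist y z → dist x' z' = dist x z →
      ∀ a' ∈ segment ℝ x' y', dist x' a' = dist x a → dist z a ≤ dist z' a'

end CAT0

universe u

open Filter Topology in
/-- A finite reflection group on a Euclidean space with its unit root system. -/
structure ReflDatum (E : Type*) [NormedAddCommGroup E] [InnerProductSpace ℝ E] where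
  Φ : Set E
  G : Subgroup (E ≃ₗᵢ[ℝ] E)
  finΦ : Φ.Finite
  finG : Finite G
  unit : ∀ a ∈ Φ, ‖a‖ = 1
  neg : ∀ a ∈ Φ, -a ∈ Φ
  map : ∀ w ∈ G, ∀ a ∈ Φ, w a ∈ Φ
  refl : ∀ a ∈ Φ, ∃ s ∈ G, ∀ x, s x = x - (2 * inner ℝ a x) • a

namespace ReflDatum

open Filter Topology
open scoped RealInnerProductSpace

section Geometry

variable {E : Type*} [NormedAddCommGroup E] [InnerProductSpace ℝ E] (R : ReflDatum E)

/-- A vector orthogonal to no root. -/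
def Reg (ξ : E) : Prop := ∀ a ∈ R.Φ, ⟪a, ξ⟫ ≠ 0

/-- The closed Weyl chamber of a regular vector. -/
def Cone (ξ : E) : Set E := {y | ∀ a ∈ R.Φ, 0 < ⟪a, ξ⟫ → 0 ≤ ⟪a, y⟫}

variable {R}

lemma zero_mem_cone (ξ : E) : (0 : E) ∈ R.Cone ξ := fun a _ _ => by simp

lemma self_mem_cone (ξ : E) : ξ ∈ R.Cone ξ := fun _ _ h => h.le

lemma add_mem_cone {ξ x y : E} (hx : x ∈ R.Cone ξ) (hy : y ∈ R.Cone ξ) : x + y ∈ R.Cone ξ :=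
  fun a ha h => by rw [inner_add_right]; exact add_nonneg (hx a ha h) (hy a ha h)

lemma smul_mem_cone {ξ x : E} {t : ℝ} (ht : 0 ≤ t) (hx : x ∈ R.Cone ξ) : t • x ∈ R.Cone ξ :=
  fun a ha h => by rw [real_inner_smul_right]; exact mul_nonneg ht (hx a ha h)

lemma isClosed_cone (ξ : E) : IsClosed (R.Cone ξ) := by
  have : R.Cone ξ = ⋂ a ∈ R.Φ, ⋂ _ : 0 < ⟪a, ξ⟫, {y | 0 ≤ ⟪a, y⟫} := by
    ext; simp [Cone]
  rw [this]
  refine isClosed_iInter fun a => isClosed_iInter fun _ => isClosed_iInter fun _ => ?_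
  exact isClosed_le continuous_const (by fun_prop)

lemma Reg.neg {ξ : E} (h : R.Reg ξ) : R.Reg (-ξ) := fun a ha => by
  rw [inner_neg_right]; exact neg_ne_zero.2 (h a ha)

lemma mem_cone_neg {ξ y : E} : y ∈ R.Cone (-ξ) ↔ -y ∈ R.Cone ξ := by
  constructor
  · intro h a ha hp
    have := h (-a) (R.neg a ha) (by simpa using hp)
    simpa using this
  · intro h a ha hp
    have := h (-a) (R.neg a ha) (by simpa using hp)
    simpa using this

lemma inner_map_symm (w : E ≃ₗᵢ[ℝ] E) (x y : E) : ⟪x, w y⟫ = ⟪w⁻¹ x, y⟫ := by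
  rw [← w.inner_map_map (w⁻¹ x) y]
  congr 1
  exact (w.apply_symm_apply x).symm

lemma map_inv_map (w : E ≃ₗᵢ[ℝ] E) (x : E) : w (w⁻¹ x) = x := w.apply_symm_apply x

lemma inv_map_map (w : E ≃ₗᵢ[ℝ] E) (x : E) : w⁻¹ (w x) = x := w.symm_apply_apply x

lemma Reg.map {ξ : E} (h : R.Reg ξ) {w : E ≃ₗᵢ[ℝ] E} (hw : w ∈ R.G) : R.Reg (w ξ) :=
  fun a ha => by
    rw [inner_map_symm]; exact h _ (R.map _ (R.G.inv_mem hw) a ha)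

lemma map_mem_cone {ξ y : E} {w : E ≃ₗᵢ[ℝ] E} (hw : w ∈ R.G) (hy : y ∈ R.Cone ξ) :
    w y ∈ R.Cone (w ξ) := fun a ha h => by
  rw [inner_map_symm] at h ⊢
  exact hy _ (R.map _ (R.G.inv_mem hw) a ha) h

lemma map_mem_cone_iff {ξ y : E} {w : E ≃ₗᵢ[ℝ] E} (hw : w ∈ R.G) :
    w y ∈ R.Cone (w ξ) ↔ y ∈ R.Cone ξ := by
  refine ⟨fun h => ?_, map_mem_cone hw⟩
  simpa [inv_map_map] using map_mem_cone (R.G.inv_mem hw) h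

lemma Reg.deep {ξ : E} (h : R.Reg ξ) :
    ∃ δ > 0, ∀ t : ℝ, 0 ≤ t → ∀ v : E, ‖v‖ ≤ t * δ → t • ξ + v ∈ R.Cone ξ := by
  have : ∀ S : Set E, S.Finite → S ⊆ R.Φ → ∃ δ > 0, ∀ a ∈ S, δ ≤ |⟪a, ξ⟫| := by
    intro S hS
    induction S, hS using Set.Finite.induction_on with
    | empty => intro _; exact ⟨1, one_pos, by simp⟩
    | insert _ _ ih =>
      rename_i a s _ _
      intro hs
      obtain ⟨δ, hδ, H⟩ := ih (fun x hx => hs (mem_insert_of_mem _ hx))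
      refine ⟨min δ |⟪a, ξ⟫|, lt_min hδ (abs_pos.2 (h a (hs (mem_insert _ _)))), ?_⟩
      rintro b (rfl | hb)
      · exact min_le_right _ _
      · exact (min_le_left _ _).trans (H b hb)
  obtain ⟨δ, hδ, H⟩ := this R.Φ R.finΦ subset_rfl
  refine ⟨δ, hδ, fun t ht v hv a ha hp => ?_⟩
  rw [inner_add_right, real_inner_smul_right]
  have h1 := H a ha
  rw [abs_of_pos hp] at h1
  have h2 : |⟪a, v⟫| ≤ ‖v‖ := by
    simpa [R.unit a ha] using abs_real_inner_le_norm a v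
  have := (abs_le.1 h2).1
  nlinarith

/-- Common deep translates of a cone. -/
lemma Reg.exists_deep {ξ : E} (h : R.Reg ξ) (u : E) :
    ∃ T : ℝ, 0 ≤ T ∧ ∀ t, T ≤ t → t • ξ - u ∈ R.Cone ξ := by
  obtain ⟨δ, hδ, H⟩ := h.deep
  refine ⟨‖u‖ / δ, by positivity, fun t ht => ?_⟩
  rw [sub_eq_add_neg]
  refine H t ((by positivity : (0:ℝ) ≤ ‖u‖ / δ).trans ht) _ ?_
  rw [norm_neg]
  rwa [div_le_iff₀ hδ] at ht

lemma Reg.common {ξ : E} (h : R.Reg ξ) (u v : E) :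
    ∃ x, x - u ∈ R.Cone ξ ∧ x - v ∈ R.Cone ξ := by
  obtain ⟨T, _, H⟩ := h.exists_deep u
  obtain ⟨T', _, H'⟩ := h.exists_deep v
  exact ⟨max T T' • ξ, H _ (le_max_left _ _), H' _ (le_max_right _ _)⟩

lemma Reg.cone_perp {ξ y : E} (h : R.Reg ξ) (hy : ∀ c ∈ R.Cone ξ, ⟪y, c⟫ = 0) : y = 0 := by
  obtain ⟨T, hT, H⟩ := h.exists_deep (-y)
  have h1 := hy _ (H T le_rfl)
  have h2 := hy _ (self_mem_cone ξ)
  rw [inner_sub_right, real_inner_smul_right, h2] at h1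
  simpa using h1

lemma Reg.eq_of_dist_cone {ξ : E} (h : R.Reg ξ) {x y u : E}
    (hd : ∀ c ∈ R.Cone ξ, dist x (u + c) = dist y (u + c)) : x = y := by
  have key : ∀ c ∈ R.Cone ξ, ‖x - u‖ ^ 2 - 2 * ⟪x - u, c⟫ = ‖y - u‖ ^ 2 - 2 * ⟪y - u, c⟫ := by
    intro c hc
    have := hd c hc
    rw [dist_eq_norm, dist_eq_norm, ← sub_sub, ← sub_sub] at this
    have h2 := congrArg (fun r => r ^ 2) this
    simp only [norm_sub_sq_real (x - u) c, norm_sub_sq_real (y - u) c] at h2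
    linarith
  have h0 := key 0 (zero_mem_cone ξ)
  simp only [inner_zero_right] at h0
  have : (x - u) - (y - u) = 0 := h.cone_perp fun c hc => by
    rw [inner_sub_left]; linarith [key c hc]
  simpa [sub_eq_zero] using this

lemma Reg.eventually {ζ : E} (h : R.Reg ζ) (y : E) :
    ∀ᶠ t in 𝓝[>] (0 : ℝ), R.Reg (y + t • ζ) ∧ y ∈ R.Cone (y + t • ζ) := by
  have hlim : ∀ a : E, Tendsto (fun t : ℝ => ⟪a, y + t • ζ⟫) (𝓝[>] 0) (𝓝 ⟪a, y⟫) := by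
    intro a
    have : Continuous fun t : ℝ => ⟪a, y + t • ζ⟫ := by fun_prop
    simpa using (this.tendsto 0).mono_left nhdsWithin_le_nhds
  have : ∀ a ∈ R.Φ, ∀ᶠ t in 𝓝[>] (0 : ℝ),
      ⟪a, y + t • ζ⟫ ≠ 0 ∧ (0 < ⟪a, y + t • ζ⟫ → 0 ≤ ⟪a, y⟫) := by
    intro a ha
    rcases lt_trichotomy ⟪a, y⟫ 0 with h0 | h0 | h0
    · filter_upwards [(hlim a).eventually (gt_mem_nhds h0)] with t ht
      exact ⟨ht.ne, fun hh => absurd hh ht.not_gt⟩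
    · filter_upwards [self_mem_nhdsWithin] with t ht
      rw [inner_add_right, real_inner_smul_right, h0, zero_add]
      exact ⟨mul_ne_zero (ne_of_gt ht) (h a ha), fun _ => le_rfl⟩
    · filter_upwards [(hlim a).eventually (lt_mem_nhds h0)] with t ht
      exact ⟨ht.ne', fun _ => h0.le⟩
  have h2 := (eventually_all_finite R.finΦ).2 this
  filter_upwards [h2] with t ht
  exact ⟨fun a ha => (ht a ha).1, fun a ha hp => (ht a ha).2 hp⟩

lemma exists_avoid (S : Set E) (hS : S.Finite) (h0 : (0 : E) ∉ S) : ∃ ζ, ∀ a ∈ S, ⟪a, ζ⟫ ≠ 0 := by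
  let H : E → Submodule ℝ E := fun a => LinearMap.ker (innerSL ℝ a : E →L[ℝ] ℝ).toLinearMap
  have : (⊤ : Submodule ℝ E) ∉ (hS.toFinset.image H) := by
    intro hh
    simp only [Finset.mem_image, Set.Finite.mem_toFinset] at hh
    obtain ⟨a, ha, he⟩ := hh
    have : a ∈ H a := he ▸ Submodule.mem_top
    simp only [H, LinearMap.mem_ker] at this
    have h1 : ⟪a, a⟫ = 0 := this
    exact h0 (inner_self_eq_zero.1 h1 ▸ ha)
  have h2 := Subspace.biUnion_ne_univ_of_top_notMem this
  obtain ⟨ζ, hζ⟩ := (ne_univ_iff_exists_notMem _).1 h2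
  refine ⟨ζ, fun a ha h1 => hζ ?_⟩
  simp only [mem_iUnion]
  exact ⟨H a, Finset.mem_image_of_mem _ (hS.mem_toFinset.2 ha), h1⟩

lemma exists_avoid_near (S : Set E) (hS : S.Finite) (h0 : (0 : E) ∉ S) (y : E)
    {ε : ℝ} (hε : 0 < ε) :
    ∃ ζ, ‖ζ‖ ≤ ε ∧ ∀ a ∈ S, ⟪a, y + ζ⟫ ≠ 0 := by
  obtain ⟨ζ, hζ⟩ := exists_avoid S hS h0
  have h1 : ∀ᶠ t in 𝓝[>] (0 : ℝ), ∀ a ∈ S, ⟪a, y + t • ζ⟫ ≠ 0 := by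
    refine (eventually_all_finite hS).2 fun a ha => ?_
    have hc : Continuous fun t : ℝ => ⟪a, y + t • ζ⟫ := by fun_prop
    by_cases h : ⟪a, y⟫ = 0
    · filter_upwards [self_mem_nhdsWithin] with t ht
      rw [inner_add_right, real_inner_smul_right, h, zero_add]
      exact mul_ne_zero (ne_of_gt ht) (hζ a ha)
    · refine nhdsWithin_le_nhds ?_
      have := hc.tendsto 0
      simp only [zero_smul, add_zero] at this
      exact this.eventually (isOpen_ne.mem_nhds h)
  have h2 : ∀ᶠ t in 𝓝[>] (0 : ℝ), ‖t • ζ‖ < ε := by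
    refine nhdsWithin_le_nhds ?_
    have hc : Continuous fun t : ℝ => ‖t • ζ‖ := by fun_prop
    exact (hc.tendsto 0).eventually (gt_mem_nhds (by simpa using hε))
  obtain ⟨t, ht1, ht2⟩ := (h1.and h2).exists
  exact ⟨t • ζ, ht2.le, ht1⟩

variable (R) in
lemma zero_notMem : (0 : E) ∉ R.Φ := fun h => by simpa using R.unit 0 h

variable (R) in
lemma exists_reg : ∃ ζ, R.Reg ζ := exists_avoid R.Φ R.finΦ R.zero_notMem

variable (R) in
lemma exists_reg_cone (y : E) : ∃ ξ, R.Reg ξ ∧ y ∈ R.Cone ξ := by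
  obtain ⟨ζ, hζ⟩ := R.exists_reg
  obtain ⟨t, ht⟩ := (hζ.eventually y).exists
  exact ⟨_, ht⟩

lemma exists_reg_cone_pos {a y : E} (ha : a ∈ R.Φ) (hy : 0 ≤ ⟪a, y⟫) :
    ∃ ξ, R.Reg ξ ∧ y ∈ R.Cone ξ ∧ 0 < ⟪a, ξ⟫ := by
  obtain ⟨ζ, hζ, hp⟩ : ∃ ζ, R.Reg ζ ∧ 0 < ⟪a, ζ⟫ := by
    obtain ⟨ζ, hζ⟩ := R.exists_reg
    rcases (hζ a ha).lt_or_gt with h | h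
    · exact ⟨-ζ, hζ.neg, by rw [inner_neg_right]; linarith⟩
    · exact ⟨ζ, hζ, h⟩
  obtain ⟨t, ht, ht0⟩ := ((hζ.eventually y).and self_mem_nhdsWithin).exists
  refine ⟨_, ht.1, ht.2, ?_⟩
  rw [inner_add_right, real_inner_smul_right]
  have : 0 < t * ⟪a, ζ⟫ := mul_pos ht0 hp
  linarith

variable (R) in
lemma finite_cones : {C | ∃ ξ, R.Reg ξ ∧ C = R.Cone ξ}.Finite := by
  refine ((R.finΦ.finite_subsets).image fun P => {y | ∀ a ∈ P, 0 ≤ ⟪a, y⟫}).subset ?_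
  rintro _ ⟨ξ, _, rfl⟩
  refine ⟨{a | a ∈ R.Φ ∧ 0 < ⟪a, ξ⟫}, fun a ha => ha.1, ?_⟩
  ext y; simp [Cone]

end Geometry
end ReflDatum

namespace ReflDatum

open Filter Topology
open scoped RealInnerProductSpace

section Analysis

lemma dist_le_of_finite_closed_cover {E Z : Type*} [NormedAddCommGroup E] [NormedSpace ℝ E]
    [PseudoMetricSpace Z] {S : Set (Set E)} (hS : S.Finite) (hcl : ∀ C ∈ S, IsClosed C)
    (hcov : ∀ x, ∃ C ∈ S, x ∈ C) {f : E → Z}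
    (hf : ∀ C ∈ S, ∀ x ∈ C, ∀ y ∈ C, dist (f x) (f y) ≤ dist x y) (x y : E) :
    dist (f x) (f y) ≤ dist x y := by
  have hloc : ∀ z, ∀ C ∈ S, (∃ᶠ z' in 𝓝 z, z' ∈ C) → z ∈ C := fun z C hC h =>
    (hcl C hC).mem_of_frequently_of_tendsto h tendsto_id
  have hcont : Continuous f := by
    have : Finite S := hS
    refine (locallyFinite_of_finite (fun C : S => (C : Set E))).continuous ?_
      (fun C => hcl _ C.2) ?_
    · ext z; simpa using hcov z
    · intro C
      refine LipschitzOnWith.continuousOn (K := 1) ?_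
      exact LipschitzOnWith.of_dist_le_mul fun a ha b hb => by simpa using hf C C.2 a ha b hb
  let γ : ℝ → E := fun t => x + t • (y - x)
  have hγ : Continuous γ := by fun_prop
  have hd : ∀ s t : ℝ, dist (γ s) (γ t) = |s - t| * dist x y := by
    intro s t
    simp only [γ, dist_add_left]
    rw [dist_eq_norm, ← sub_smul, norm_smul, Real.norm_eq_abs, dist_comm x y, dist_eq_norm]
  have key : Icc (0:ℝ) 1 ⊆ {t | dist (f (γ 0)) (f (γ t)) ≤ t * dist x y} := by
    refine IsClosed.Icc_subset_of_forall_exists_gt ?_ ?_ ?_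
    · exact (isClosed_le (by fun_prop) (by fun_prop)).inter isClosed_Icc
    · simp
    · rintro t ⟨ht, ht0, ht1⟩ b hb
      have h1 : ∀ᶠ s in 𝓝[>] t, ∃ C ∈ S, γ s ∈ C := Eventually.of_forall fun s => hcov _
      obtain ⟨C, hC, hfr⟩ : ∃ C ∈ S, ∃ᶠ s in 𝓝[>] t, γ s ∈ C := by
        by_contra hcon
        push Not at hcon
        have := (eventually_all_finite hS).2 hcon
        obtain ⟨s, hs1, hs2⟩ := (this.and h1).exists
        obtain ⟨C, hC, hsC⟩ := hs2
        exact hs1 C hC hsC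
      have hmem : γ t ∈ C := by
        refine (hcl C hC).mem_of_frequently_of_tendsto hfr ?_
        exact (hγ.tendsto t).mono_left nhdsWithin_le_nhds
      obtain ⟨s, hs1, hs2⟩ := (hfr.and_eventually (Ioc_mem_nhdsGT hb)).exists
      refine ⟨s, ?_, hs2⟩
      have h2 := hf C hC _ hmem _ hs1
      rw [hd, abs_of_nonpos (by linarith [hs2.1])] at h2
      have h3 := dist_triangle (f (γ 0)) (f (γ t)) (f (γ s))
      have ht' : dist (f (γ 0)) (f (γ t)) ≤ t * dist x y := ht
      change dist (f (γ 0)) (f (γ s)) ≤ s * dist x y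
      nlinarith
  have := key (right_mem_Icc.2 zero_le_one)
  simpa [γ] using this

lemma convex_of_local {ψ : ℝ → ℝ} (hψ : Continuous ψ)
    (h : ∀ t, ∃ ε > 0, ∀ s, 0 < s → s ≤ ε → 2 * ψ t ≤ ψ (t + s) + ψ (t - s)) :
    ConvexOn ℝ univ ψ := by
  refine LinearOrder.convexOn_of_lt convex_univ fun x _ y _ hxy a b ha hb hab => ?_
  let l : ℝ → ℝ := fun t => ψ x + (t - x) / (y - x) * (ψ y - ψ x)
  let φ : ℝ → ℝ := fun t => ψ t - l t
  have hl : ∀ t s, l (t + s) + l (t - s) = 2 * l t := fun t s => by simp only [l]; ring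
  have hφc : Continuous φ := by fun_prop
  have hyx : y - x ≠ 0 := by linarith
  have hx0 : φ x = 0 := by simp [φ, l]
  have hy0 : φ y = 0 := by simp [φ, l, div_self hyx]
  have hmain : ∀ t ∈ Icc x y, φ t ≤ 0 := by
    by_contra hcon
    push Not at hcon
    obtain ⟨t₀, ht₀, hpos⟩ := hcon
    obtain ⟨t₁, ht₁, hmax⟩ := isCompact_Icc.exists_isMaxOn ⟨t₀, ht₀⟩ hφc.continuousOn
    have hM : 0 < φ t₁ := hpos.trans_le (hmax ht₀)
    have hK : IsCompact (Icc x y ∩ {t | φ t = φ t₁}) :=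
      isCompact_Icc.inter_right (isClosed_eq hφc continuous_const)
    obtain ⟨t, ⟨⟨ht, hte⟩, hgr⟩⟩ := hK.exists_isGreatest ⟨t₁, ht₁, rfl⟩
    have hte' : φ t = φ t₁ := hte
    have htx : x < t := lt_of_le_of_ne ht.1 fun h => by rw [← h] at hte'; linarith
    have hty : t < y := lt_of_le_of_ne ht.2 fun h => by rw [h] at hte'; linarith
    obtain ⟨ε, hε, H⟩ := h t
    obtain ⟨s, hs0, hs⟩ : ∃ s, 0 < s ∧ s ≤ ε ∧ s ≤ t - x ∧ s ≤ y - t :=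
      ⟨min ε (min (t - x) (y - t)), by simp [hε, htx, hty], min_le_left _ _,
        (min_le_right _ _).trans (min_le_left _ _), (min_le_right _ _).trans (min_le_right _ _)⟩
    have h1 := H s hs0 hs.1
    have h2 := hl t s
    have h3 : φ (t - s) ≤ φ t₁ := hmax (show t - s ∈ Icc x y by constructor <;> linarith)
    have hm : t + s ∈ Icc x y := by constructor <;> linarith
    have h4 : φ (t + s) ≤ φ t₁ := hmax hm
    have h5 : φ (t + s) = φ t₁ := by
      refine le_antisymm h4 ?_
      simp only [φ] at h3 h4 hte' ⊢
      linarith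
    have := hgr ⟨hm, h5⟩
    linarith
  have hz := hmain (a • x + b • y) (by
    simp only [smul_eq_mul]
    have : a = 1 - b := by linarith
    subst this
    constructor <;> nlinarith)
  have hb' : (a • x + b • y - x) / (y - x) = b := by
    have : a = 1 - b := by linarith
    subst this
    simp only [smul_eq_mul]; field_simp; ring
  simp only [φ, l, hb'] at hz
  simp only [smul_eq_mul] at hz ⊢
  have : a = 1 - b := by linarith
  subst this
  linarith

lemma add_mem_of_recession {E : Type*} [NormedAddCommGroup E] [NormedSpace ℝ E] {O : Set E}
    (hcl : IsClosed O) (hconv : Convex ℝ O) {x u c : E} (hx : x ∈ O)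
    (hu : ∀ t : ℝ, 0 ≤ t → u + t • c ∈ O) : x + c ∈ O := by
  have hlim : Tendsto (fun t : ℝ => (1 - t) • x + t • u + c) (𝓝[>] 0) (𝓝 (x + c)) := by
    have : Continuous (fun t : ℝ => (1 - t) • x + t • u + c) := by fun_prop
    simpa using (this.tendsto 0).mono_left nhdsWithin_le_nhds
  refine hcl.mem_of_tendsto hlim ?_
  filter_upwards [Ioc_mem_nhdsGT (zero_lt_one' ℝ)] with t ht
  have h := hconv hx (hu (1 / t) (by have := ht.1; positivity)) (show 0 ≤ 1 - t by linarith [ht.2])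
    ht.1.le (by ring)
  convert h using 1
  rw [smul_add, smul_smul, mul_one_div_cancel ht.1.ne', one_smul, add_assoc]

lemma exists_submodule_of_convex_cover {E : Type*} [AddCommGroup E] [Module ℝ E]
    {Z : Set E} (hZ : Convex ℝ Z) (hne : Z.Nonempty) {S : Set (Submodule ℝ E)} (hS : S.Finite) :
    (∀ z ∈ Z, ∃ p ∈ S, z ∈ p) → ∃ p ∈ S, Z ⊆ (p : Set E) := by
  induction S, hS using Set.Finite.induction_on with
  | empty =>
    intro h
    obtain ⟨z, hz⟩ := hne
    obtain ⟨p, hp, _⟩ := h z hz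
    exact absurd hp (notMem_empty _)
  | insert _ hS ih =>
    rename_i p S _
    intro h
    by_cases hp : Z ⊆ (p : Set E)
    · exact ⟨p, mem_insert _ _, hp⟩
    obtain ⟨z₀, hz₀, hz₀p⟩ := not_subset.1 hp
    obtain ⟨q, hq, hqZ⟩ := ih fun z hz => by
      obtain ⟨q, hq, hzq⟩ := h z hz
      rcases hq with rfl | hq
      · let t : ℕ → ℝ := fun n => 1 / ((n : ℝ) + 1)
        have ht0 : ∀ n, 0 < t n := fun n => by positivity
        have ht1 : ∀ n, t n ≤ 1 := fun n => by
          simp only [t]; rw [div_le_one (by positivity)]; linarith [n.cast_nonneg (α := ℝ)]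
        have hmem : ∀ n, ∃ r : S, (1 - t n) • z + t n • z₀ ∈ (r : Submodule ℝ E) := by
          intro n
          obtain ⟨r, hr, hr'⟩ := h _ (hZ hz hz₀ (sub_nonneg.2 (ht1 n)) (ht0 n).le (by ring))
          rcases hr with rfl | hr
          · exfalso
            have h1 : t n • z₀ ∈ r := by
              have := r.sub_mem hr' (r.smul_mem (1 - t n) hzq)
              simpa using this
            exact hz₀p ((r.smul_mem_iff (ht0 n).ne').1 h1)
          · exact ⟨⟨r, hr⟩, hr'⟩
        choose r hr using hmem
        have : Finite S := hS
        obtain ⟨m, n, hmn, hrr⟩ := Finite.exists_ne_map_eq_of_infinite r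
        have h1 := hr m
        have h2 := hr n
        rw [hrr] at h1
        refine ⟨r n, (r n).2, ?_⟩
        have hne : t n - t m ≠ 0 := fun h0 => hmn (by
          have h3 : t n = t m := by linarith
          simp only [t, one_div, inv_inj, add_left_inj, Nat.cast_inj] at h3
          exact h3.symm)
        have h4 := (r n : Submodule ℝ E).sub_mem ((r n : Submodule ℝ E).smul_mem (t n) h1)
          ((r n : Submodule ℝ E).smul_mem (t m) h2)
        have h5 : t n • ((1 - t m) • z + t m • z₀) - t m • ((1 - t n) • z + t n • z₀)
            = (t n - t m) • z := by module
        rw [h5] at h4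
        exact ((r n : Submodule ℝ E).smul_mem_iff hne).1 h4
      · exact ⟨q, hq, hzq⟩
    exact ⟨q, mem_insert_of_mem _ hq, hqZ⟩

end Analysis

section Adjacency

variable {E : Type*} [NormedAddCommGroup E] [InnerProductSpace ℝ E] {R : ReflDatum E}

/-- `η` lies in the interior of the panel of the chamber of `ξ` cut out by the root `a`. -/
structure Adj (R : ReflDatum E) (ξ a η : E) : Prop where
  mem : a ∈ R.Φ
  pos : 0 < ⟪a, ξ⟫
  zero : ⟪a, η⟫ = 0
  sep : ∀ b ∈ R.Φ, 0 < ⟪b, ξ⟫ → b = a ∨ 0 < ⟪b, η⟫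

lemma Adj.mem_cone {ξ a η : E} (h : R.Adj ξ a η) : η ∈ R.Cone ξ := fun b hb hp => by
  rcases h.sep b hb hp with rfl | h'
  · exact h.zero.ge
  · exact h'.le

lemma Adj.panel_nhds {ξ a η : E} (h : R.Adj ξ a η) {v : E} (hv : ⟪a, v⟫ = 0) :
    ∃ t : ℝ, 0 < t ∧ η + t • v ∈ R.Cone ξ := by
  have : ∀ᶠ t in 𝓝[>] (0 : ℝ), ∀ b ∈ R.Φ, 0 < ⟪b, ξ⟫ → 0 ≤ ⟪b, η + t • v⟫ := by
    refine (eventually_all_finite R.finΦ).2 fun b hb => ?_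
    by_cases hp : 0 < ⟪b, ξ⟫
    · rcases h.sep b hb hp with rfl | h'
      · refine Eventually.of_forall fun t _ => ?_
        rw [inner_add_right, real_inner_smul_right, h.zero, hv]; simp
      · have hc : Continuous fun t : ℝ => ⟪b, η + t • v⟫ := by fun_prop
        have := (hc.tendsto 0).mono_left (nhdsWithin_le_nhds (s := Ioi 0))
        simp only [zero_smul, add_zero] at this
        filter_upwards [this.eventually (lt_mem_nhds h')] with t ht _ using ht.le
    · exact Eventually.of_forall fun t h0 => absurd h0 hp
  obtain ⟨t, ht, ht0⟩ := (this.and self_mem_nhdsWithin).exists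
  exact ⟨t, ht0, ht⟩

/-- An isometry fixing a panel pointwise is trivial or the reflection in the panel. -/
lemma Adj.fix_panel {ξ a η : E} (h : R.Adj ξ a η) (w : E ≃ₗᵢ[ℝ] E)
    (hw : ∀ c ∈ R.Cone ξ, ⟪a, c⟫ = 0 → w c = c) :
    (∀ x, w x = x) ∨ ∀ x, w x = x - (2 * ⟪a, x⟫) • a := by
  have hperp : ∀ v, ⟪a, v⟫ = 0 → w v = v := by
    intro v hv
    obtain ⟨t, ht, hm⟩ := h.panel_nhds hv
    have h1 := hw _ hm (by rw [inner_add_right, real_inner_smul_right, h.zero, hv]; simp)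
    have h2 := hw _ h.mem_cone h.zero
    rw [map_add, h2, map_smul] at h1
    exact smul_right_injective E ht.ne' (add_left_cancel h1)
  have haa : ⟪a, a⟫ = 1 := by rw [real_inner_self_eq_norm_sq, R.unit a h.mem]; norm_num
  have hdec : ∀ x, w x = x - ⟪a, x⟫ • a + ⟪a, x⟫ • w a := by
    intro x
    have h1 := hperp (x - ⟪a, x⟫ • a) (by
      rw [inner_sub_right, real_inner_smul_right, haa]; ring)
    rw [map_sub, map_smul] at h1
    rw [← h1]; simp
  have hwa : w a = ⟪a, w a⟫ • a := by
    have hp : ⟪a, w a - ⟪a, w a⟫ • a⟫ = 0 := by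
      rw [inner_sub_right, real_inner_smul_right, haa]; ring
    have h2 : ⟪w a, w a - ⟪a, w a⟫ • a⟫ = 0 := by
      conv_lhs => rw [← hperp _ hp]
      rw [w.inner_map_map]; exact hp
    have h3 : ⟪w a - ⟪a, w a⟫ • a, w a - ⟪a, w a⟫ • a⟫ = 0 := by
      conv_lhs => rw [inner_sub_left, real_inner_smul_left]
      rw [h2, hp]; ring
    exact sub_eq_zero.1 (inner_self_eq_zero.1 h3)
  have hn : |⟪a, w a⟫| = 1 := by
    have := w.norm_map a
    rw [hwa, norm_smul, R.unit a h.mem, mul_one, Real.norm_eq_abs] at this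
    exact this
  rcases (abs_eq zero_le_one).1 hn with h1 | h1
  · left; intro x; rw [hdec x, hwa, h1]; simp
  · right; intro x; rw [hdec x, hwa, h1]; module

lemma refl_self {a : E} (ha : a ∈ R.Φ) {s : E ≃ₗᵢ[ℝ] E} (hs : ∀ x, s x = x - (2 * ⟪a, x⟫) • a) :
    s a = -a := by
  rw [hs, real_inner_self_eq_norm_sq, R.unit a ha]; module

lemma refl_refl {a : E} (ha : a ∈ R.Φ) {s : E ≃ₗᵢ[ℝ] E} (hs : ∀ x, s x = x - (2 * ⟪a, x⟫) • a)
    (x : E) : s (s x) = x := by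
  rw [hs x, map_sub, map_smul, refl_self ha hs, hs x]; module

lemma refl_inv {a : E} (ha : a ∈ R.Φ) {s : E ≃ₗᵢ[ℝ] E} (hs : ∀ x, s x = x - (2 * ⟪a, x⟫) • a)
    (x : E) : s⁻¹ x = s x := by
  rw [← refl_refl ha hs x, inv_map_map, refl_refl ha hs]

lemma refl_inner {a : E} (ha : a ∈ R.Φ) {s : E ≃ₗᵢ[ℝ] E} (hs : ∀ x, s x = x - (2 * ⟪a, x⟫) • a)
    (x y : E) : ⟪x, s y⟫ = ⟪s x, y⟫ := by
  rw [inner_map_symm, refl_inv ha hs]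

lemma refl_inner_root {a : E} (ha : a ∈ R.Φ) {s : E ≃ₗᵢ[ℝ] E}
    (hs : ∀ x, s x = x - (2 * ⟪a, x⟫) • a) (x : E) : ⟪a, s x⟫ = -⟪a, x⟫ := by
  rw [refl_inner ha hs, refl_self ha hs, inner_neg_left]

lemma Adj.refl {ξ a η : E} (h : R.Adj ξ a η) {s : E ≃ₗᵢ[ℝ] E} (hsG : s ∈ R.G)
    (hs : ∀ x, s x = x - (2 * ⟪a, x⟫) • a) : R.Adj (s ξ) (-a) η := by
  refine ⟨R.neg _ h.mem, ?_, ?_, ?_⟩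
  · rw [inner_neg_left, refl_inner_root h.mem hs, neg_neg]; exact h.pos
  · rw [inner_neg_left, h.zero, neg_zero]
  · intro b hb hp
    rw [refl_inner h.mem hs] at hp
    rcases h.sep _ (R.map s hsG b hb) hp with h1 | h1
    · left; rw [← refl_refl h.mem hs b, h1, refl_self h.mem hs]
    · right
      rw [← refl_inner h.mem hs, hs η, h.zero] at h1
      simpa using h1

/-- The number of roots separating two regular vectors. -/
def nsep (R : ReflDatum E) (ξ ζ : E) : ℕ := {b | b ∈ R.Φ ∧ 0 < ⟪b, ξ⟫ ∧ ⟪b, ζ⟫ < 0}.ncard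

lemma Adj.nsep_lt {ξ a η ζ : E} (hξ : R.Reg ξ) (h : R.Adj ξ a η) {s : E ≃ₗᵢ[ℝ] E} (hsG : s ∈ R.G)
    (hs : ∀ x, s x = x - (2 * ⟪a, x⟫) • a) (ha : ⟪a, ζ⟫ < 0) : R.nsep (s ξ) ζ < R.nsep ξ ζ := by
  refine Set.ncard_lt_ncard ?_ (R.finΦ.subset fun b hb => hb.1)
  refine ⟨?_, fun hsub => ?_⟩
  · rintro b ⟨hb, hp, hz⟩
    refine ⟨hb, ?_, hz⟩
    rcases (h.refl hsG hs).sep b hb hp with rfl | h1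
    · rw [inner_neg_left] at hz; linarith
    · rcases (hξ b hb).lt_or_gt with h2 | h2
      · exfalso
        rcases h.sep (-b) (R.neg b hb) (by rw [inner_neg_left]; linarith) with h3 | h3
        · have := h.zero
          rw [← h3, inner_neg_left] at this; linarith
        · rw [inner_neg_left] at h3; linarith
      · exact h2
  · have := (hsub ⟨h.mem, h.pos, ha⟩).2.1
    rw [refl_inner_root h.mem hs] at this
    linarith [h.pos]

lemma nsep_le_card (ξ ζ : E) : R.nsep ξ ζ ≤ R.Φ.ncard :=
  Set.ncard_le_ncard (fun _ h => h.1) R.finΦ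

/-- A chamber separated from `ζ` has a panel whose wall separates it from `ζ`. -/
lemma exists_adj {ξ ζ : E} (hξ : R.Reg ξ) (hζ : R.Reg ζ)
    (h : ∃ b ∈ R.Φ, 0 < ⟪b, ξ⟫ ∧ ⟪b, ζ⟫ < 0) :
    ∃ ξ' a η, R.Reg ξ' ∧ (∀ b ∈ R.Φ, 0 < ⟪b, ξ'⟫ ↔ 0 < ⟪b, ξ⟫) ∧ R.Adj ξ' a η ∧ ⟪a, ζ⟫ < 0 := by
  obtain ⟨δ, hδ, hdeep⟩ := hξ.deep
  let S₀ : Set E := (fun p : E × E => ⟪p.2, ζ⟫ • p.1 - ⟪p.1, ζ⟫ • p.2) '' (R.Φ ×ˢ R.Φ)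
  let S : Set E := (R.Φ ∪ S₀) \ {0}
  have hS : S.Finite := (R.finΦ.union ((R.finΦ.prod R.finΦ).image _)).sdiff
  obtain ⟨v, hv, hav⟩ := exists_avoid_near S hS (fun h => h.2 rfl) ξ hδ
  have hreg : R.Reg (ξ + v) := fun a ha =>
    hav a ⟨Or.inl ha, fun h0 => R.zero_notMem (h0 ▸ ha)⟩
  have hsign : ∀ b ∈ R.Φ, 0 < ⟪b, ξ⟫ → 0 < ⟪b, ξ + v⟫ := fun b hb hp => by
    have := hdeep 1 zero_le_one v (by simpa using hv) b hb hp
    rw [one_smul] at this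
    exact lt_of_le_of_ne this (hreg b hb).symm
  have hsign' : ∀ b ∈ R.Φ, 0 < ⟪b, ξ + v⟫ ↔ 0 < ⟪b, ξ⟫ := fun b hb => by
    refine ⟨fun hp => ?_, hsign b hb⟩
    by_contra hcon
    have h1 : 0 < ⟪-b, ξ⟫ := by
      rw [inner_neg_left]
      exact neg_pos.2 (lt_of_le_of_ne (not_lt.1 hcon) (hξ b hb))
    have := hsign _ (R.neg b hb) h1
    rw [inner_neg_left] at this
    linarith
  set ξ' := ξ + v with hξ'
  let T : Set E := {b | b ∈ R.Φ ∧ 0 < ⟪b, ξ'⟫ ∧ ⟪b, ζ⟫ < 0}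
  have hT : T.Finite := R.finΦ.subset fun b hb => hb.1
  have hTne : T.Nonempty := by
    obtain ⟨b, hb, h1, h2⟩ := h
    exact ⟨b, hb, hsign b hb h1, h2⟩
  obtain ⟨a, ⟨ha, hapos, haneg⟩, hmin⟩ :=
    Set.exists_min_image T (fun b => ⟪b, ξ'⟫ / (⟪b, ξ'⟫ - ⟪b, ζ⟫)) hT hTne
  set p := ⟪a, ξ'⟫ with hp
  set q := ⟪a, ζ⟫ with hq
  refine ⟨ξ', a, (-q) • ξ' + p • ζ, hreg, hsign', ⟨ha, hapos, ?_, ?_⟩, haneg⟩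
  · rw [inner_add_right, real_inner_smul_right, real_inner_smul_right]; ring
  · intro b hb hbpos
    rw [inner_add_right, real_inner_smul_right, real_inner_smul_right]
    rcases (hζ b hb).lt_or_gt with h1 | h1
    · have h2 := hmin b ⟨hb, hbpos, h1⟩
      rw [div_le_div_iff₀ (by linarith) (by linarith)] at h2
      by_cases h3 : ⟪b, ζ⟫ • a - q • b = 0
      · left
        have h4 : (-⟪b, ζ⟫) • a = (-q) • b := by
          rw [neg_smul, neg_smul, sub_eq_zero.1 h3]
        have h5 := congrArg norm h4
        rw [norm_smul, norm_smul, R.unit a ha, R.unit b hb, Real.norm_eq_abs, Real.norm_eq_abs,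
          abs_of_pos (by linarith), abs_of_pos (by linarith)] at h5
        have h6 : -⟪b, ζ⟫ = -q := by linarith
        rw [h6] at h4
        exact (smul_right_injective E (by linarith : -q ≠ 0) h4).symm
      · right
        have h4 := hav _ ⟨Or.inr ⟨(a, b), ⟨ha, hb⟩, rfl⟩, h3⟩
        simp only at h4
        rw [inner_sub_left, real_inner_smul_left, real_inner_smul_left] at h4
        have h5 : ⟪b, ζ⟫ * p - q * ⟪b, ξ'⟫ ≠ 0 := h4
        refine lt_of_le_of_ne (by nlinarith) fun h6 => h5 (by linarith)
    · right
      have := mul_pos (neg_pos.2 haneg) hbpos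
      have := mul_pos hapos h1
      linarith

end Adjacency
end ReflDatum

namespace ReflDatum

open Filter Topology
open scoped RealInnerProductSpace

section Charts

variable {E : Type*} [NormedAddCommGroup E] [InnerProductSpace ℝ E] (R : ReflDatum E)
  {Y : Type*} [MetricSpace Y]

/-- Two maps on the model space agree on a deep translate of the chamber of `ζ`. -/
def Agree (ζ : E) (k h : E → Y) : Prop := ∃ u, ∀ c ∈ R.Cone ζ, h (u + c) = k (u + c)

/-- The ranges of `f` and `g` meet in a half-apartment. -/
def Half (f g : E → Y) : Prop := ∃ a ∈ R.Φ, ∃ c : ℝ, ∀ x, f x ∈ range g ↔ c ≤ ⟪a, x⟫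

/-- A compatible family of isometric charts. -/
structure IsCharts (F : Set (E → Y)) : Prop where
  isom : ∀ f ∈ F, Isometry f
  A1 : ∀ f ∈ F, ∀ w ∈ R.G, ∀ v, (fun x => f (w x + v)) ∈ F
  A3 : ∀ p q, ∃ f ∈ F, p ∈ range f ∧ q ∈ range f

/-- The building axioms for a family of charts covering the whole space. -/
structure IsBldg (F : Set (E → Y)) : Prop extends IsCharts R F where
  A2closed : ∀ f ∈ F, ∀ g ∈ F, IsClosed {x | f x ∈ range g}
  A2convex : ∀ f ∈ F, ∀ g ∈ F, Convex ℝ {x | f x ∈ range g}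
  A2mark : ∀ f ∈ F, ∀ g ∈ F, ∃ w ∈ R.G, ∃ v, ∀ x, f x ∈ range g → f x = g (w x + v)
  A4 : ∀ f ∈ F, ∀ g ∈ F, ∀ ξ ζ, R.Reg ξ → R.Reg ζ → ∃ h ∈ F, ∃ u v,
    (∀ c ∈ R.Cone ξ, f (u + c) ∈ range h) ∧ ∀ c ∈ R.Cone ζ, g (v + c) ∈ range h
  A5 : ∀ f₁ ∈ F, ∀ f₂ ∈ F, ∀ f₃ ∈ F, R.Half f₁ f₂ → R.Half f₂ f₃ → R.Half f₁ f₃ →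
    ∃ x, f₁ x ∈ range f₂ ∧ f₁ x ∈ range f₃

/-- Closed intersections of root half-spaces, described by separation. -/
def RootConvex (X : Set E) : Prop :=
  X.Nonempty → ∀ x ∉ X, ∃ b ∈ R.Φ, ∀ y ∈ X, ⟪b, x⟫ < ⟪b, y⟫

/-- Index types for the pieces of the foldings of an apartment. -/
def Idx : ℕ → Type
  | 0 => Unit
  | m + 1 => Idx m ⊕ Idx m

instance finite_idx : ∀ m, Finite (Idx m)
  | 0 => inferInstanceAs (Finite Unit)
  | m + 1 => by
    have := finite_idx m
    exact inferInstanceAs (Finite (Idx m ⊕ Idx m))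

instance nonempty_idx : ∀ m, Nonempty (Idx m)
  | 0 => inferInstanceAs (Nonempty Unit)
  | m + 1 => by
    have := nonempty_idx m
    exact inferInstanceAs (Nonempty (Idx m ⊕ Idx m))

/-- On `X` the chart `g` coincides, up to the Weyl group, with a chart agreeing with `k` deep in
the chamber of `ζ`. -/
def Piece (F : Set (E → Y)) (g k : E → Y) (ζ : E) (X : Set E) : Prop :=
  R.RootConvex X ∧ ∃ h ∈ F, R.Agree ζ k h ∧ ∃ w ∈ R.G, ∃ v, ∀ x ∈ X, g x = h (w x + v)

/-- The apartment of `g` is covered by finitely many pieces. -/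
def Pieces (F : Set (E → Y)) (m : ℕ) (g k : E → Y) (ζ : E) : Prop :=
  ∃ X : Idx m → Set E, (∀ x, ∃ j, x ∈ X j) ∧ ∀ j, R.Piece F g k ζ (X j)

/-- Every apartment and every chamber at infinity admit a finite covering by pieces. -/
def Cov (F : Set (E → Y)) (m : ℕ) : Prop :=
  ∀ g ∈ F, ∀ k ∈ F, ∀ ζ, R.Reg ζ → R.Pieces F m g k ζ

variable {R} {F : Set (E → Y)}

lemma RootConvex.convex {X : Set E} (h : R.RootConvex X) : Convex ℝ X := by
  intro p hp q hq α β hα hβ hab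
  by_contra hn
  obtain ⟨b, _, H⟩ := h ⟨p, hp⟩ _ hn
  have h1 := H p hp
  have h2 := H q hq
  rw [inner_add_right, real_inner_smul_right, real_inner_smul_right] at h1 h2
  obtain rfl : α = 1 - β := by linarith
  rcases le_total ⟪b, p⟫ ⟪b, q⟫ with h3 | h3 <;> nlinarith

lemma RootConvex.inter {X X' : Set E} (h : R.RootConvex X) (h' : R.RootConvex X') :
    R.RootConvex (X ∩ X') := by
  rintro ⟨p, hp, hp'⟩ x hx
  by_cases hxX : x ∈ X
  · obtain ⟨b, hb, H⟩ := h' ⟨p, hp'⟩ x fun hx' => hx ⟨hxX, hx'⟩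
    exact ⟨b, hb, fun y hy => H y hy.2⟩
  · obtain ⟨b, hb, H⟩ := h ⟨p, hp⟩ x hxX
    exact ⟨b, hb, fun y hy => H y hy.1⟩

lemma rootConvex_univ : R.RootConvex (univ : Set E) := fun _ x hx => absurd (mem_univ x) hx

lemma rootConvex_half {a : E} (ha : a ∈ R.Φ) (c : ℝ) : R.RootConvex {x | c ≤ ⟪a, x⟫} :=
  fun _ _ hx => ⟨a, ha, fun _ hy => (not_le.1 hx).trans_le hy⟩

lemma RootConvex.preimage {X : Set E} (h : R.RootConvex X) {w : E ≃ₗᵢ[ℝ] E} (hw : w ∈ R.G) (v : E) :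
    R.RootConvex {x | w x + v ∈ X} := by
  rintro ⟨p, hp⟩ x hx
  obtain ⟨b, hb, H⟩ := h ⟨_, hp⟩ _ hx
  refine ⟨w⁻¹ b, R.map _ (R.G.inv_mem hw) b hb, fun y hy => ?_⟩
  have := H _ hy
  rw [inner_add_right, inner_add_right, inner_map_symm, inner_map_symm] at this
  linarith

omit [MetricSpace Y] in
lemma Agree.symm {ζ : E} {k h : E → Y} (H : R.Agree ζ k h) : R.Agree ζ h k := by
  obtain ⟨u, hu⟩ := H
  exact ⟨u, fun c hc => (hu c hc).symm⟩

omit [MetricSpace Y] in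
lemma agree_refl (ζ : E) (k : E → Y) : R.Agree ζ k k := ⟨0, fun _ _ => rfl⟩

omit [MetricSpace Y] in
lemma Agree.trans {ζ : E} (hζ : R.Reg ζ) {k h l : E → Y} (H : R.Agree ζ k h) (H' : R.Agree ζ h l) :
    R.Agree ζ k l := by
  obtain ⟨u, hu⟩ := H
  obtain ⟨v, hv⟩ := H'
  obtain ⟨x, hx, hx'⟩ := hζ.common u v
  refine ⟨x, fun c hc => ?_⟩
  have h1 := hu _ (add_mem_cone hx hc)
  have h2 := hv _ (add_mem_cone hx' hc)
  rw [show u + (x - u + c) = x + c by abel] at h1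
  rw [show v + (x - v + c) = x + c by abel] at h2
  rw [h2, h1]

lemma cone_eq {ξ y : E} (hξ : R.Reg ξ) (hy : R.Reg y) (h : y ∈ R.Cone ξ) : R.Cone y = R.Cone ξ := by
  have key : ∀ b ∈ R.Φ, 0 < ⟪b, ξ⟫ → 0 < ⟪b, y⟫ := fun b hb hp =>
    lt_of_le_of_ne (h b hb hp) (hy b hb).symm
  ext z
  refine ⟨fun hz b hb hp => hz b hb (key b hb hp), fun hz b hb hp => hz b hb ?_⟩
  by_contra hcon
  have := key (-b) (R.neg b hb) (by
    rw [inner_neg_left]; exact neg_pos.2 (lt_of_le_of_ne (not_lt.1 hcon) (hξ b hb)))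
  rw [inner_neg_left] at this
  linarith

lemma cone_eq_of_sign {ξ ξ' : E} (h : ∀ b ∈ R.Φ, 0 < ⟪b, ξ'⟫ ↔ 0 < ⟪b, ξ⟫) :
    R.Cone ξ' = R.Cone ξ := by
  ext z
  exact ⟨fun hz b hb hp => hz b hb ((h b hb).2 hp), fun hz b hb hp => hz b hb ((h b hb).1 hp)⟩

/-- The asymptotic distance between rays in two apartments. -/
def asym (f : E → Y) (x : E) (g : E → Y) (y : E) : ℝ :=
  limUnder atTop fun t : ℝ => dist (f (t • x)) (g (t • y)) / t

lemma tendsto_div_of_bounded {φ : ℝ → ℝ} {L K : ℝ} (h : ∀ t, 0 ≤ t → |φ t - t * L| ≤ K) :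
    Tendsto (fun t => φ t / t) atTop (𝓝 L) := by
  rw [tendsto_iff_norm_sub_tendsto_zero]
  have h0 : Tendsto (fun t : ℝ => K / t) atTop (𝓝 0) := tendsto_const_nhds.div_atTop tendsto_id
  refine squeeze_zero' (Eventually.of_forall fun t => norm_nonneg _) ?_ h0
  filter_upwards [eventually_gt_atTop 0] with t ht
  have h1 : φ t / t - L = (φ t - t * L) / t := by field_simp
  rw [h1, norm_div, Real.norm_eq_abs, Real.norm_eq_abs, abs_of_pos ht]
  gcongr
  exact h t ht.le

namespace IsBldg

variable (B : IsBldg R F)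
include B

/-- Two chambers at infinity lie in a common apartment. -/
lemma A4' {f g : E → Y} (hf : f ∈ F) (hg : g ∈ F) {ξ ζ : E} (hξ : R.Reg ξ) (hζ : R.Reg ζ) :
    ∃ h ∈ F, ∃ w₁ ∈ R.G, ∃ w₂ ∈ R.G, ∃ u₁ v₁ u₂ v₂,
      (∀ c ∈ R.Cone ξ, f (u₁ + c) = h (w₁ (u₁ + c) + v₁)) ∧
      ∀ c ∈ R.Cone ζ, g (u₂ + c) = h (w₂ (u₂ + c) + v₂) := by
  obtain ⟨h, hh, u, v, h1, h2⟩ := B.A4 f hf g hg ξ ζ hξ hζ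
  obtain ⟨w₁, hw₁, v₁, H₁⟩ := B.A2mark f hf h hh
  obtain ⟨w₂, hw₂, v₂, H₂⟩ := B.A2mark g hg h hh
  exact ⟨h, hh, w₁, hw₁, w₂, hw₂, u, v₁, v, v₂, fun c hc => H₁ _ (h1 c hc),
    fun c hc => H₂ _ (h2 c hc)⟩

omit B in
lemma dist_le_of_mark (hF : IsCharts R F) {f h : E → Y} (hf : f ∈ F) (hh : h ∈ F) {w : E ≃ₗᵢ[ℝ] E}
    {u v x : E} (H : f (u + x) = h (w (u + x) + v)) : dist (f x) (h (w x)) ≤ ‖u‖ + ‖w u + v‖ := by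
  have h1 := dist_triangle (f x) (f (u + x)) (h (w x))
  have h2 : dist (f x) (f (u + x)) = ‖u‖ := by
    rw [(hF.isom f hf).dist_eq, dist_eq_norm, ← norm_neg]; congr 1; abel
  have h3 : dist (f (u + x)) (h (w x)) = ‖w u + v‖ := by
    rw [H, (hF.isom h hh).dist_eq, dist_eq_norm, map_add]; congr 1; abel
  linarith

lemma exists_asym {f g : E → Y} (hf : f ∈ F) (hg : g ∈ F) {ξ ζ : E} (hξ : R.Reg ξ)
    (hζ : R.Reg ζ) : ∃ w ∈ R.G, ∀ x ∈ R.Cone ξ, ∀ y ∈ R.Cone ζ,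
      Tendsto (fun t : ℝ => dist (f (t • x)) (g (t • y)) / t) atTop (𝓝 ‖w x - y‖) := by
  obtain ⟨h, hh, w₁, hw₁, w₂, hw₂, u₁, v₁, u₂, v₂, H₁, H₂⟩ := B.A4' hf hg hξ hζ
  refine ⟨w₂⁻¹ * w₁, R.G.mul_mem (R.G.inv_mem hw₂) hw₁, fun x hx y hy => ?_⟩
  refine tendsto_div_of_bounded (K := (‖u₁‖ + ‖w₁ u₁ + v₁‖) + (‖u₂‖ + ‖w₂ u₂ + v₂‖)) fun t ht => ?_
  have h1 := dist_le_of_mark B.toIsCharts hf hh (H₁ _ (smul_mem_cone ht hx))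
  have h2 := dist_le_of_mark B.toIsCharts hg hh (H₂ _ (smul_mem_cone ht hy))
  have h3 : dist (h (w₁ (t • x))) (h (w₂ (t • y))) = t * ‖(w₂⁻¹ * w₁) x - y‖ := by
    rw [(B.isom h hh).dist_eq, dist_eq_norm, map_smul, map_smul, ← smul_sub, norm_smul,
      Real.norm_eq_abs, abs_of_nonneg ht]
    have : w₂ ((w₂⁻¹ * w₁) x - y) = w₁ x - w₂ y := by
      rw [map_sub]; congr 1; exact map_inv_map w₂ (w₁ x)
    rw [← this, w₂.norm_map]
  rw [← h3]
  have h4 := dist_dist_dist_le (f (t • x)) (g (t • y)) (h (w₁ (t • x))) (h (w₂ (t • y)))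
  rw [Real.dist_eq] at h4
  linarith

lemma tendsto_asym {f g : E → Y} (hf : f ∈ F) (hg : g ∈ F) (x y : E) :
    Tendsto (fun t : ℝ => dist (f (t • x)) (g (t • y)) / t) atTop (𝓝 (asym f x g y)) := by
  obtain ⟨ξ, hξ, hx⟩ := R.exists_reg_cone x
  obtain ⟨ζ, hζ, hy⟩ := R.exists_reg_cone y
  obtain ⟨w, _, H⟩ := B.exists_asym hf hg hξ hζ
  exact tendsto_nhds_limUnder ⟨_, H x hx y hy⟩

lemma asym_eq {f g : E → Y} (hf : f ∈ F) (hg : g ∈ F) {x y : E} {L : ℝ}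
    (h : Tendsto (fun t : ℝ => dist (f (t • x)) (g (t • y)) / t) atTop (𝓝 L)) :
    asym f x g y = L := tendsto_nhds_unique (B.tendsto_asym hf hg x y) h

lemma asym_comm {f g : E → Y} (hf : f ∈ F) (hg : g ∈ F) (x y : E) :
    asym f x g y = asym g y f x := by
  refine B.asym_eq hf hg ?_
  simpa only [dist_comm] using B.tendsto_asym hg hf y x

lemma asym_self {f : E → Y} (hf : f ∈ F) (x y : E) : asym f x f y = ‖x - y‖ := by
  refine B.asym_eq hf hf (tendsto_div_of_bounded (K := 0) fun t ht => ?_)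
  rw [(B.isom f hf).dist_eq, dist_eq_norm, ← smul_sub, norm_smul, Real.norm_eq_abs,
    abs_of_nonneg ht, sub_self, abs_zero]

lemma asym_triangle {f g h : E → Y} (hf : f ∈ F) (hg : g ∈ F) (hh : h ∈ F) (x y z : E) :
    asym f x h z ≤ asym f x g y + asym g y h z := by
  refine le_of_tendsto_of_tendsto (B.tendsto_asym hf hh x z)
    ((B.tendsto_asym hf hg x y).add (B.tendsto_asym hg hh y z)) ?_
  filter_upwards [eventually_ge_atTop 0] with t ht
  rw [← add_div]
  gcongr
  exact dist_triangle _ _ _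

/-- Asymptotic rays are interchangeable in asymptotic distances. -/
lemma asym_congr_left {f g h : E → Y} (hf : f ∈ F) (hg : g ∈ F) (hh : h ∈ F) {x y : E} (z : E)
    (h0 : asym f x g y = 0) : asym f x h z = asym g y h z := by
  have h1 := B.asym_triangle hf hg hh x y z
  have h2 := B.asym_triangle hg hf hh y x z
  rw [B.asym_comm hg hf y x] at h2
  linarith

lemma asym_congr_right {f g h : E → Y} (hf : f ∈ F) (hg : g ∈ F) (hh : h ∈ F) {x y : E} (z : E)
    (h0 : asym f x g y = 0) : asym h z f x = asym h z g y := by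
  rw [B.asym_comm hh hf, B.asym_comm hh hg, B.asym_congr_left hf hg hh z h0]

lemma eq_of_asym {f : E → Y} (hf : f ∈ F) {x y : E} (h : asym f x f y = 0) : x = y := by
  rw [B.asym_self hf, norm_eq_zero, sub_eq_zero] at h; exact h

lemma asym_trans {f g h : E → Y} (hf : f ∈ F) (hg : g ∈ F) (hh : h ∈ F) {x y z : E}
    (h0 : asym f x g y = 0) (h1 : asym g y h z = 0) : asym f x h z = 0 := by
  rw [B.asym_congr_left hf hg hh z h0, h1]

lemma asym_symm {f g : E → Y} (hf : f ∈ F) (hg : g ∈ F) {x y : E}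
    (h0 : asym f x g y = 0) : asym g y f x = 0 := by
  rw [B.asym_comm hg hf, h0]

lemma asym_mark {f h : E → Y} (hf : f ∈ F) (hh : h ∈ F) {w : E ≃ₗᵢ[ℝ] E} {C : Set E}
    (hC : ∀ t : ℝ, 0 ≤ t → ∀ c ∈ C, t • c ∈ C) {u v : E}
    (H : ∀ c ∈ C, f (u + c) = h (w (u + c) + v)) {x : E} (hx : x ∈ C) : asym f x h (w x) = 0 := by
  refine B.asym_eq hf hh (tendsto_div_of_bounded (K := ‖u‖ + ‖w u + v‖) fun t ht => ?_)
  rw [mul_zero, sub_zero, abs_of_nonneg dist_nonneg, ← map_smul]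
  exact dist_le_of_mark B.toIsCharts hf hh (H _ (hC t ht x hx))

lemma asym_cone_mark {f h : E → Y} (hf : f ∈ F) (hh : h ∈ F) {w : E ≃ₗᵢ[ℝ] E} {ξ u v : E}
    (H : ∀ c ∈ R.Cone ξ, f (u + c) = h (w (u + c) + v)) {x : E} (hx : x ∈ R.Cone ξ) :
    asym f x h (w x) = 0 :=
  B.asym_mark hf hh (fun _ ht _ hc => smul_mem_cone ht hc) H hx

lemma asym_comp {f : E → Y} (hf : f ∈ F) {w : E ≃ₗᵢ[ℝ] E} (hw : w ∈ R.G) (v x : E) :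
    asym (fun x => f (w x + v)) x f (w x) = 0 :=
  B.asym_mark (B.A1 f hf w hw v) hf (C := univ) (fun _ _ _ _ => mem_univ _) (u := 0) (v := v)
    (fun c _ => by simp) (mem_univ x)

/-- The normalized form of `A4'`. -/
lemma exists_common {f k : E → Y} (hf : f ∈ F) (hk : k ∈ F) {ξ ζ : E} (hξ : R.Reg ξ)
    (hζ : R.Reg ζ) : ∃ b ∈ F, (∀ x ∈ R.Cone ξ, asym f x b x = 0) ∧
      ∃ w ∈ R.G, ∀ x ∈ R.Cone ζ, asym k x b (w x) = 0 := by
  obtain ⟨h, hh, w₁, hw₁, w₂, hw₂, u₁, v₁, u₂, v₂, H₁, H₂⟩ := B.A4' hf hk hξ hζ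
  have hb := B.A1 h hh w₁ hw₁ v₁
  refine ⟨_, hb, fun x hx => ?_, w₁⁻¹ * w₂, R.G.mul_mem (R.G.inv_mem hw₁) hw₂, fun x hx => ?_⟩
  · exact B.asym_cone_mark hf hb (w := 1) (u := u₁) (v := 0) (fun c hc => by simpa using H₁ c hc) hx
  · refine B.asym_trans hk hh hb (B.asym_cone_mark hk hh H₂ hx) ?_
    have := B.asym_symm hb hh (B.asym_comp hh hw₁ v₁ ((w₁⁻¹ * w₂) x))
    rwa [show w₁ ((w₁⁻¹ * w₂) x) = w₂ x from map_inv_map w₁ (w₂ x)] at this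

/-- Asymptotic regular rays span sectors with a common subsector. -/
lemma exists_mark_of_asym {f g : E → Y} (hf : f ∈ F) (hg : g ∈ F) {x x' : E} (hx : R.Reg x)
    (h0 : asym f x g x' = 0) : ∃ w ∈ R.G, w x = x' ∧ ∃ u v, ∀ c ∈ R.Cone x,
      f (u + c) = g (w (u + c) + v) := by
  obtain ⟨ξ, hξ, hxξ⟩ := R.exists_reg_cone x'
  obtain ⟨h, hh, w₁, hw₁, w₂, hw₂, u₁, v₁, u₂, v₂, H₁, H₂⟩ := B.A4' hf hg hx hξ
  have e1 := B.asym_cone_mark hf hh H₁ (self_mem_cone x)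
  have e2 := B.asym_cone_mark hg hh H₂ hxξ
  have e3 : w₁ x = w₂ x' := B.eq_of_asym hh
    (B.asym_trans hh hf hh (B.asym_symm hf hh e1) (B.asym_trans hf hg hh h0 e2))
  have hw : w₂⁻¹ * w₁ ∈ R.G := R.G.mul_mem (R.G.inv_mem hw₂) hw₁
  have e4 : (w₂⁻¹ * w₁) x = x' := by
    change w₂⁻¹ (w₁ x) = x'
    rw [e3, inv_map_map]
  have hx' : R.Reg x' := e4 ▸ hx.map hw
  have hcone := cone_eq hξ hx' hxξ
  rw [← hcone] at H₂
  -- a common deep point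
  obtain ⟨z, hz1, hz2⟩ := hx.common u₁ ((w₂⁻¹ * w₁)⁻¹ (u₂ - w₂⁻¹ (v₁ - v₂)))
  refine ⟨_, hw, e4, z, w₂⁻¹ (v₁ - v₂), fun c hc => ?_⟩
  have f1 := H₁ _ (add_mem_cone hz1 hc)
  rw [show u₁ + (z - u₁ + c) = z + c by abel] at f1
  have f2 := map_mem_cone hw (add_mem_cone hz2 hc)
  rw [e4, map_add, map_sub, map_inv_map] at f2
  have f3 := H₂ _ f2
  have e5 : u₂ + ((w₂⁻¹ * w₁) z - (u₂ - w₂⁻¹ (v₁ - v₂)) + (w₂⁻¹ * w₁) c)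
      = (w₂⁻¹ * w₁) (z + c) + w₂⁻¹ (v₁ - v₂) := by rw [map_add]; abel
  rw [e5] at f3
  rw [f3, f1]
  congr 1
  rw [map_add w₂, map_inv_map, show w₂ ((w₂⁻¹ * w₁) (z + c)) = w₁ (z + c) from map_inv_map w₂ _]
  abel

/-- The retraction at infinity of an apartment centred at a chamber. -/
lemma exists_retraction {g h : E → Y} (hg : g ∈ F) (hh : h ∈ F) {ζ : E} (hζ : R.Reg ζ) :
    ∃ ρ : E → E, (∀ x y, dist (ρ x) (ρ y) ≤ dist x y) ∧
      ∀ x, ∀ z ∈ R.Cone ζ, asym g x h z = ‖ρ x - z‖ := by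
  have key : ∀ ξ, R.Reg ξ → ∃ w : E ≃ₗᵢ[ℝ] E, ∀ x ∈ R.Cone ξ, ∀ z ∈ R.Cone ζ,
      asym g x h z = ‖w x - z‖ := by
    intro ξ hξ
    obtain ⟨w, _, H⟩ := B.exists_asym hg hh hξ hζ
    exact ⟨w, fun x hx z hz => B.asym_eq hg hh (H x hx z hz)⟩
  have hex : ∀ x, ∃ y, ∀ z ∈ R.Cone ζ, asym g x h z = ‖y - z‖ := fun x => by
    obtain ⟨ξ, hξ, hx⟩ := R.exists_reg_cone x
    obtain ⟨w, H⟩ := key ξ hξ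
    exact ⟨w x, H x hx⟩
  choose ρ hρ using hex
  refine ⟨ρ, ?_, hρ⟩
  refine dist_le_of_finite_closed_cover R.finite_cones ?_ ?_ ?_
  · rintro _ ⟨ξ, _, rfl⟩; exact isClosed_cone ξ
  · intro x
    obtain ⟨ξ, hξ, hx⟩ := R.exists_reg_cone x
    exact ⟨_, ⟨ξ, hξ, rfl⟩, hx⟩
  · rintro _ ⟨ξ, hξ, rfl⟩ x hx y hy
    obtain ⟨w, H⟩ := key ξ hξ
    have : ∀ x ∈ R.Cone ξ, ρ x = w x := fun x hx =>
      hζ.eq_of_dist_cone (u := 0) fun c hc => by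
        rw [zero_add, dist_eq_norm, dist_eq_norm, ← hρ x c hc, ← H x hx c hc]
    rw [this x hx, this y hy, w.dist_map]

end IsBldg

end Charts
end ReflDatum

namespace ReflDatum

open Filter Topology
open scoped RealInnerProductSpace

section Sundial

variable {E : Type*} [NormedAddCommGroup E] [InnerProductSpace ℝ E] {R : ReflDatum E}

lemma inner_le_of_rays {x y c : E} (h : ∀ t : ℝ, 0 ≤ t → ‖y - t • c‖ ≤ ‖x - t • c‖) :
    ⟪x, c⟫ ≤ ⟪y, c⟫ := by
  by_contra! hlt
  have key : ∀ t : ℝ, 0 ≤ t → 2 * t * (⟪x, c⟫ - ⟪y, c⟫) ≤ ‖x‖ ^ 2 - ‖y‖ ^ 2 := by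
    intro t ht
    have h1 := pow_le_pow_left₀ (norm_nonneg _) (h t ht) 2
    rw [norm_sub_sq_real, norm_sub_sq_real, real_inner_smul_right, real_inner_smul_right] at h1
    linarith
  have hd : 0 < ⟪x, c⟫ - ⟪y, c⟫ := by linarith
  have h2 := key ((‖x‖ ^ 2 + 1) / (⟪x, c⟫ - ⟪y, c⟫)) (by positivity)
  have h3 : 2 * ((‖x‖ ^ 2 + 1) / (⟪x, c⟫ - ⟪y, c⟫)) * (⟪x, c⟫ - ⟪y, c⟫) = 2 * (‖x‖ ^ 2 + 1) := by
    field_simp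
  nlinarith [sq_nonneg ‖x‖, sq_nonneg ‖y‖]

lemma eq_of_norm_add {x y : E} (h : ‖x‖ = ‖y‖) (h' : 2 * ‖y‖ ≤ ‖x + y‖) : x = y := by
  have h1 := pow_le_pow_left₀ (by positivity) h' 2
  have h2 := parallelogram_law_with_norm ℝ x y
  rw [← sub_eq_zero, ← norm_eq_zero]
  have : ‖x - y‖ ^ 2 ≤ 0 := by rw [h] at h2; nlinarith
  exact pow_eq_zero_iff two_ne_zero |>.1 (le_antisymm this (sq_nonneg _))

/-- A short map that is isometric on two opposite chambers is isometric. -/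
lemma Reg.lip_eq {ζ : E} (hζ : R.Reg ζ) {ρ : E → E} (hρ : ∀ x y, dist (ρ x) (ρ y) ≤ dist x y)
    (σ : E ≃ₗᵢ[ℝ] E) (h : ∀ x ∈ R.Cone ζ, ρ x = σ x) (h' : ∀ x ∈ R.Cone (-ζ), ρ x = σ x) (x : E) :
    ρ x = σ x := by
  have key : ∀ c, (∀ t : ℝ, 0 ≤ t → ρ (t • c) = σ (t • c)) → ⟪x, c⟫ ≤ ⟪σ⁻¹ (ρ x), c⟫ := by
    intro c hc
    refine inner_le_of_rays fun t ht => ?_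
    have h1 := hρ x (t • c)
    rw [hc t ht, dist_eq_norm, dist_eq_norm] at h1
    rwa [← σ.norm_map, map_sub, map_inv_map]
  have hz : σ⁻¹ (ρ x) - x = 0 := hζ.cone_perp fun c hc => by
    have h1 := key c fun t ht => h _ (smul_mem_cone ht hc)
    have h2 := key (-c) fun t ht => h' _ (smul_mem_cone ht (mem_cone_neg.2 (by simpa using hc)))
    rw [inner_neg_right, inner_neg_right] at h2
    rw [inner_sub_left]; linarith
  rw [← map_inv_map σ (ρ x), sub_eq_zero.1 hz]

lemma Adj.eq_smul {ξ a η : E} (h : R.Adj ξ a η) {y : E}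
    (hy : ∀ c ∈ R.Cone ξ, ⟪a, c⟫ = 0 → ⟪y, c⟫ = 0) : y = ⟪a, y⟫ • a := by
  have haa : ⟪a, a⟫ = 1 := by rw [real_inner_self_eq_norm_sq, R.unit a h.mem, one_pow]
  have hv : ⟪a, y - ⟪a, y⟫ • a⟫ = 0 := by
    rw [inner_sub_right, real_inner_smul_right, haa]; ring
  obtain ⟨t, ht, hm⟩ := h.panel_nhds hv
  have h1 := hy _ h.mem_cone h.zero
  have h2 := hy _ hm (by rw [inner_add_right, real_inner_smul_right, hv, h.zero]; ring)
  rw [inner_add_right, h1, real_inner_smul_right, zero_add] at h2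
  have h3 := (mul_eq_zero.1 h2).resolve_left ht.ne'
  have h4 : ⟪y - ⟪a, y⟫ • a, y - ⟪a, y⟫ • a⟫ = 0 := by
    rw [inner_sub_left, h3, real_inner_smul_left, hv]; ring
  exact sub_eq_zero.1 (inner_self_eq_zero.1 h4)

variable {Y : Type*} [MetricSpace Y] {F : Set (E → Y)}

namespace IsBldg

variable (B : IsBldg R F)
include B

/-- Two adjacent chambers in different apartments lie in an apartment containing a given
half-apartment at infinity. -/
lemma sundial_half {g k : E → Y} (hg : g ∈ F) (hk : k ∈ F) {ξ a η : E} (hξ : R.Reg ξ)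
    (hA : R.Adj ξ a η) {s : E ≃ₗᵢ[ℝ] E} (hsG : s ∈ R.G) (hs : ∀ x, s x = x - (2 * ⟪a, x⟫) • a)
    (h0 : ∀ x ∈ R.Cone ξ, asym k x g x = 0) :
    ∃ b ∈ F, (∀ x, 0 ≤ ⟪a, x⟫ → asym g x b x = 0) ∧ ∀ x ∈ R.Cone (s ξ), asym k x b x = 0 := by
  have hsξ : R.Reg (s ξ) := hξ.map hsG
  have hss := refl_refl hA.mem hs
  have hsa : ∀ x, ⟪a, s x⟫ = -⟪a, x⟫ := refl_inner_root hA.mem hs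
  have hgk : ∀ x ∈ R.Cone ξ, asym g x k x = 0 := fun x hx => B.asym_symm hk hg (h0 x hx)
  have hpan : ∀ c ∈ R.Cone ξ, ⟪a, c⟫ = 0 → c ∈ R.Cone (s ξ) := fun c hc h => by
    have := map_mem_cone hsG hc
    rwa [hs c, h, mul_zero, zero_smul, sub_zero] at this
  obtain ⟨b, hb, hb1, w, hw, hb2⟩ := B.exists_common hg hk hsξ.neg hsξ
  have hfix : ∀ c ∈ R.Cone ξ, ⟪a, c⟫ = 0 → w c = c := by
    intro c hc h
    have h1 : asym g (-c) b (-c) = 0 := hb1 _ (mem_cone_neg.2 (by simpa using hpan c hc h))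
    have h2 : asym g c b (w c) = 0 := B.asym_trans hg hk hb (hgk c hc) (hb2 c (hpan c hc h))
    have h3 : ‖c - -c‖ = ‖w c - -c‖ := by
      rw [← B.asym_self hg, ← B.asym_self hb, B.asym_congr_left hg hb hg _ h2,
        B.asym_congr_right hg hb hb _ h1]
    rw [sub_neg_eq_add, sub_neg_eq_add] at h3
    refine eq_of_norm_add (w.norm_map c) ?_
    rw [← h3, ← two_smul ℝ c, norm_smul]; simp
  rcases hA.fix_panel w hfix with hw1 | hw1
  swap
  · exfalso
    have hb2' : ∀ z ∈ R.Cone ξ, asym k (s z) b z = 0 := fun z hz => by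
      have := hb2 _ (map_mem_cone hsG hz)
      rwa [hw1, ← hs, hss] at this
    obtain ⟨ρ, hρ, hρ'⟩ := B.exists_retraction hg hb hξ
    have e1 : ρ ξ = s ξ := hξ.eq_of_dist_cone (u := 0) fun z hz => by
      rw [zero_add, dist_eq_norm, dist_eq_norm, ← hρ' _ z hz,
        B.asym_congr_left hg hk hb _ (hgk ξ (self_mem_cone ξ)),
        ← B.asym_congr_right hk hb hk _ (hb2' z hz), B.asym_self hk, ← s.norm_map, map_sub, hss]
    have e2 : ρ (-s ξ) = -s ξ := hξ.eq_of_dist_cone (u := 0) fun z hz => by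
      rw [zero_add, dist_eq_norm, dist_eq_norm, ← hρ' _ z hz,
        B.asym_congr_left hg hb hb _ (hb1 _ (self_mem_cone _)), B.asym_self hb]
    have h3 := hρ ξ (-s ξ)
    rw [e1, e2, dist_eq_norm, dist_eq_norm, sub_neg_eq_add, sub_neg_eq_add, ← two_smul ℝ (s ξ),
      norm_smul, Real.norm_ofNat] at h3
    have h4 := congrArg (fun x => ⟪a, x⟫) (eq_of_norm_add (s.norm_map ξ).symm h3)
    simp only [hsa] at h4
    linarith [hA.pos]
  simp only [hw1] at hb2
  have hbk : ∀ x ∈ R.Cone (s ξ), asym b x k x = 0 := fun x hx => B.asym_symm hk hb (hb2 x hx)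
  have h4a : ∀ x, 0 ≤ ⟪a, x⟫ → ∀ z ∈ R.Cone (s ξ), asym g x b z = ‖x - z‖ := by
    obtain ⟨ρ, hρ, hρ'⟩ := B.exists_retraction hg hb hsξ
    have e1 : ∀ x ∈ R.Cone ξ, ρ x = x := fun x hx =>
      hsξ.eq_of_dist_cone (u := 0) fun z hz => by
        rw [zero_add, dist_eq_norm, dist_eq_norm, ← hρ' _ z hz,
          B.asym_congr_left hg hk hb _ (hgk x hx), B.asym_congr_right hb hk hk _ (hbk z hz),
          B.asym_self hk]
    have e2 : ∀ x ∈ R.Cone (-s ξ), ρ x = x := fun x hx =>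
      hsξ.eq_of_dist_cone (u := 0) fun z hz => by
        rw [zero_add, dist_eq_norm, dist_eq_norm, ← hρ' _ z hz,
          B.asym_congr_left hg hb hb _ (hb1 x hx), B.asym_self hb]
    have hray : ∀ x c, (∀ t : ℝ, 0 ≤ t → ρ (t • c) = t • c) → ⟪x, c⟫ ≤ ⟪ρ x, c⟫ := fun x c hc =>
      inner_le_of_rays fun t ht => by
        have := hρ x (t • c); rwa [hc t ht, dist_eq_norm, dist_eq_norm] at this
    intro x hx z hz
    have h1 : ∀ c ∈ R.Cone ξ, ⟪x, c⟫ ≤ ⟪ρ x, c⟫ := fun c hc =>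
      hray x c fun t ht => e1 _ (smul_mem_cone ht hc)
    have h2 : ∀ c ∈ R.Cone (s ξ), ⟪ρ x, c⟫ ≤ ⟪x, c⟫ := fun c hc => by
      have := hray x (-c) fun t ht =>
        e2 _ (smul_mem_cone ht (mem_cone_neg.2 (by simpa using hc)))
      rw [inner_neg_right, inner_neg_right] at this; linarith
    have h3 : ρ x - x = ⟪a, ρ x - x⟫ • a := hA.eq_smul fun c hc h => by
      rw [inner_sub_left]; linarith [h1 c hc, h2 c (hpan c hc h)]
    set γ := ⟪a, ρ x - x⟫
    have h4 : ρ x = x + γ • a := by rw [← h3]; abel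
    have h5 : 0 ≤ γ := by
      have := h1 ξ (self_mem_cone ξ)
      rw [h4, inner_add_left, real_inner_smul_left] at this
      exact nonneg_of_mul_nonneg_left (by linarith) hA.pos
    have h6 : ‖ρ x‖ ≤ ‖x‖ := by
      have := hρ x 0
      rwa [e1 0 (zero_mem_cone ξ), dist_zero_right, dist_zero_right] at this
    have h7 : γ = 0 := by
      have := pow_le_pow_left₀ (norm_nonneg _) h6 2
      rw [h4, norm_add_sq_real, real_inner_smul_right, norm_smul, R.unit a hA.mem,
        Real.norm_eq_abs, mul_one, sq_abs, real_inner_comm] at this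
      nlinarith [mul_nonneg h5 hx]
    rw [hρ' x z hz, h4, h7, zero_smul, add_zero]
  refine ⟨b, hb, fun x hx => ?_, hb2⟩
  obtain ⟨ζ, hζ, hxζ, haζ⟩ := exists_reg_cone_pos hA.mem hx
  obtain ⟨ρ, hρ, hρ'⟩ := B.exists_retraction hb hg hζ
  have e : ρ x = (1 : E ≃ₗᵢ[ℝ] E) x := by
    refine hsξ.lip_eq hρ 1 (fun x hx => ?_) (fun x hx => ?_) x
    · refine hζ.eq_of_dist_cone (u := 0) fun z hz => ?_
      rw [zero_add, dist_eq_norm, dist_eq_norm, ← hρ' _ z hz, B.asym_comm hb hg,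
        h4a z (hz a hA.mem haζ) x hx, norm_sub_rev]; rfl
    · refine hζ.eq_of_dist_cone (u := 0) fun z hz => ?_
      rw [zero_add, dist_eq_norm, dist_eq_norm, ← hρ' _ z hz,
        B.asym_congr_left hb hg hg _ (B.asym_symm hg hb (hb1 x hx)), B.asym_self hg]; rfl
  rw [B.asym_comm hg hb, hρ' x x hxζ, e]; simp

/-- If a half-apartment at infinity is common to two apartments, then their intersection is a
half-apartment. -/
lemma overlap_half {g h : E → Y} (hg : g ∈ F) (hh : h ∈ F) {a : E} (ha : a ∈ R.Φ)
    (H : ∀ x, 0 ≤ ⟪a, x⟫ → asym g x h x = 0) :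
    (∀ x, g x ∈ range h) ∨ ∃ c : ℝ, ∀ x, g x ∈ range h ↔ c ≤ ⟪a, x⟫ := by
  set O := {x | g x ∈ range h} with hO
  have haa : ⟪a, a⟫ = 1 := by rw [real_inner_self_eq_norm_sq, R.unit a ha, one_pow]
  have hrec : ∀ v, 0 ≤ ⟪a, v⟫ → ∃ u, ∀ t : ℝ, 0 ≤ t → u + t • v ∈ O := by
    intro v hv
    obtain ⟨ζ, hζ, hvζ, haζ⟩ := exists_reg_cone_pos ha hv
    obtain ⟨w, _, _, u, v', hu⟩ := B.exists_mark_of_asym hg hh hζ (H ζ haζ.le)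
    exact ⟨u, fun t ht => ⟨_, (hu _ (smul_mem_cone ht hvζ)).symm⟩⟩
  have hcl : IsClosed O := B.A2closed g hg h hh
  have hup : ∀ x ∈ O, ∀ y, ⟪a, x⟫ ≤ ⟪a, y⟫ → y ∈ O := by
    intro x hx y hxy
    obtain ⟨u, hu⟩ := hrec (y - x) (by rw [inner_sub_right]; linarith)
    have := add_mem_of_recession hcl (B.A2convex g hg h hh) hx hu
    rwa [add_sub_cancel] at this
  let T : Set ℝ := {t | t • a ∈ O}
  have hT : ∀ x, x ∈ O ↔ ⟪a, x⟫ ∈ T := fun x => by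
    have e : ⟪a, ⟪a, x⟫ • a⟫ = ⟪a, x⟫ := by rw [real_inner_smul_right, haa, mul_one]
    exact ⟨fun hx => hup x hx _ e.ge, fun hx => hup _ hx _ e.le⟩
  have hTup : ∀ t ∈ T, ∀ t', t ≤ t' → t' ∈ T := fun t ht t' h' =>
    hup _ ht _ (by rw [real_inner_smul_right, real_inner_smul_right, haa]; linarith)
  have hTcl : IsClosed T := hcl.preimage (by fun_prop : Continuous fun t : ℝ => t • a)
  have hTne : T.Nonempty := by
    obtain ⟨u, hu⟩ := hrec 0 (by simp)
    have := hu 0 le_rfl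
    exact ⟨_, (hT _).1 this⟩
  by_cases hbdd : BddBelow T
  · right
    refine ⟨sInf T, fun x => ?_⟩
    change x ∈ O ↔ _
    rw [hT]
    exact ⟨fun hx => csInf_le hbdd hx, fun hx => hTup _ (hTcl.csInf_mem hTne hbdd) _ hx⟩
  · left
    intro x
    change x ∈ O
    rw [hT]
    rw [not_bddBelow_iff] at hbdd
    obtain ⟨t, ht, hlt⟩ := hbdd ⟪a, x⟫
    exact hTup t ht _ hlt.le

/-- Folding an apartment along a chamber adjacent to it. -/
lemma sundial {g k : E → Y} (hg : g ∈ F) (hk : k ∈ F) {ξ a η : E} (hξ : R.Reg ξ)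
    (hA : R.Adj ξ a η) {s : E ≃ₗᵢ[ℝ] E} (hsG : s ∈ R.G) (hs : ∀ x, s x = x - (2 * ⟪a, x⟫) • a)
    (h0 : ∀ x ∈ R.Cone ξ, asym k x g x = 0) (hno : ∀ x', asym k (s ξ) g x' ≠ 0) :
    ∃ b₁ ∈ F, ∃ b₂ ∈ F, ∃ c : ℝ,
      (∀ x ∈ R.Cone (s ξ), asym k x b₁ x = 0) ∧ (∀ x ∈ R.Cone (s ξ), asym k x b₂ x = 0) ∧
      (∀ x, c ≤ ⟪a, x⟫ → g x ∈ range b₁) ∧ ∀ x, ⟪a, x⟫ ≤ c → g x ∈ range b₂ := by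
  have hsξ : R.Reg (s ξ) := hξ.map hsG
  have hss := refl_refl hA.mem hs
  have hsa : ∀ x, ⟪a, s x⟫ = -⟪a, x⟫ := refl_inner_root hA.mem hs
  have hpan : ∀ c ∈ R.Cone ξ, ⟪a, c⟫ = 0 → c ∈ R.Cone (s ξ) := fun c hc h => by
    have := map_mem_cone hsG hc
    rwa [hs c, h, mul_zero, zero_smul, sub_zero] at this
  have hsneg : ∀ x ∈ R.Cone (s ξ), ⟪a, x⟫ ≤ 0 := fun x hx => by
    have := hx (-a) (R.neg a hA.mem) (by rw [inner_neg_left, hsa, neg_neg]; exact hA.pos)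
    rw [inner_neg_left] at this; linarith
  have hspos : ∀ x ∈ R.Cone (-s ξ), 0 ≤ ⟪a, x⟫ := fun x hx => by
    have := hsneg _ (mem_cone_neg.1 hx)
    rw [inner_neg_right] at this; linarith
  obtain ⟨b₁, hb₁, h1g, h1k⟩ := B.sundial_half hg hk hξ hA hsG hs h0
  have hb₂ : ∃ b₂ ∈ F, (∀ x, ⟪a, x⟫ ≤ 0 → asym g x b₂ x = 0) ∧
      ∀ x ∈ R.Cone (s ξ), asym k x b₂ (s x) = 0 := by
    obtain ⟨k', hk', hc1, w, hw, hc2⟩ := B.exists_common hg hk hsξ hsξ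
    have hfix : ∀ c ∈ R.Cone ξ, ⟪a, c⟫ = 0 → w c = c := fun c hc h =>
      (B.eq_of_asym hk' (B.asym_trans hk' hg hk' (B.asym_symm hg hk' (hc1 c (hpan c hc h)))
        (B.asym_trans hg hk hk' (B.asym_symm hk hg (h0 c hc)) (hc2 c (hpan c hc h))))).symm
    rcases hA.fix_panel w hfix with hw1 | hw1
    · exfalso
      have h1 := hc2 _ (self_mem_cone _)
      rw [hw1] at h1
      exact hno (s ξ) (B.asym_trans hk hk' hg h1 (B.asym_symm hg hk' (hc1 _ (self_mem_cone _))))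
    · obtain ⟨b₂, hb₂, h2g, h2k⟩ := B.sundial_half hg hk' hsξ (hA.refl hsG hs) hsG
        (fun x => by rw [hs x, inner_neg_left]; module)
        (fun x hx => B.asym_symm hg hk' (hc1 x hx))
      rw [hss] at h2k
      refine ⟨b₂, hb₂, fun x hx => h2g x (by rw [inner_neg_left]; linarith), fun x hx => ?_⟩
      have h3 := hc2 x hx
      rw [hw1, ← hs] at h3
      have h4 : s x ∈ R.Cone ξ := by
        have := map_mem_cone hsG hx
        rwa [hss] at this
      exact B.asym_trans hk hk' hb₂ h3 (h2k _ h4)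
  obtain ⟨b₂, hb₂, h2g, h2k⟩ := hb₂
  have h12 : ∀ x ∈ R.Cone (s ξ), asym b₁ x b₂ (s x) = 0 := fun x hx =>
    B.asym_trans hb₁ hk hb₂ (B.asym_symm hk hb₁ (h1k x hx)) (h2k x hx)
  have hαβ : ∀ z x, 0 ≤ ⟪a, z⟫ → ⟪a, x⟫ ≤ 0 → asym b₁ z b₂ x = ‖z - x‖ := fun z x hz hx => by
    rw [← B.asym_congr_left hg hb₁ hb₂ _ (h1g z hz), ← B.asym_congr_right hg hb₂ hg _ (h2g x hx),
      B.asym_self hg]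
  have hαα : ∀ x z, 0 ≤ ⟪a, x⟫ → z ∈ R.Cone (-s ξ) → asym b₂ x b₁ z = ‖s x - z‖ := by
    obtain ⟨ρ, hρ, hρ'⟩ := B.exists_retraction hb₂ hb₁ hsξ.neg
    have e1 : ∀ x, ⟪a, x⟫ ≤ 0 → ρ x = x := fun x hx =>
      hsξ.neg.eq_of_dist_cone (u := 0) fun z hz => by
        rw [zero_add, dist_eq_norm, dist_eq_norm, ← hρ' _ z hz, B.asym_comm hb₂ hb₁,
          hαβ z x (hspos z hz) hx, norm_sub_rev]
    have e2 : ∀ x ∈ R.Cone ξ, ρ x = s x := fun x hx =>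
      hsξ.neg.eq_of_dist_cone (u := 0) fun z hz => by
        have h3 := h12 _ (map_mem_cone hsG hx)
        rw [hss] at h3
        rw [zero_add, dist_eq_norm, dist_eq_norm, ← hρ' _ z hz,
          ← B.asym_congr_left hb₁ hb₂ hb₁ _ h3, B.asym_self hb₁]
    intro x z hx hz
    have hray : ∀ c, (∀ t : ℝ, 0 ≤ t → ρ (t • c) = t • c) → ⟪x, c⟫ ≤ ⟪ρ x, c⟫ := fun c hc =>
      inner_le_of_rays fun t ht => by
        have := hρ x (t • c); rwa [hc t ht, dist_eq_norm, dist_eq_norm] at this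
    have h3 : ρ x - x = ⟪a, ρ x - x⟫ • a := hA.eq_smul fun c hc h => by
      have h1 := hray c fun t ht => e1 _ (by rw [real_inner_smul_right, h, mul_zero])
      have h2 := hray (-c) fun t ht => e1 _ (by
        rw [real_inner_smul_right, inner_neg_right, h, neg_zero, mul_zero])
      rw [inner_neg_right, inner_neg_right] at h2
      rw [inner_sub_left]; linarith
    set γ := ⟪a, ρ x - x⟫
    have h4 : ρ x = x + γ • a := by rw [← h3]; abel
    have h6 : ‖ρ x‖ ≤ ‖x‖ := by
      have := hρ x 0
      rwa [e1 0 (by simp), dist_zero_right, dist_zero_right] at this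
    have h5 : γ ≤ -2 * ⟪a, x⟫ := by
      have h7 : ⟪x, ξ⟫ ≤ ⟪s (ρ x), ξ⟫ := inner_le_of_rays fun t ht => by
        have := hρ x (t • ξ)
        rw [e2 _ (smul_mem_cone ht (self_mem_cone ξ)), dist_eq_norm, dist_eq_norm] at this
        rwa [← s.norm_map, map_sub, hss]
      rw [h4, map_add, map_smul, refl_self hA.mem hs, hs x, inner_add_left, inner_sub_left,
        smul_neg, inner_neg_left, real_inner_smul_left, real_inner_smul_left] at h7
      have : 0 ≤ (-2 * ⟪a, x⟫ - γ) * ⟪a, ξ⟫ := by linarith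
      linarith [nonneg_of_mul_nonneg_left this hA.pos]
    have h7 : γ = -2 * ⟪a, x⟫ := by
      have := pow_le_pow_left₀ (norm_nonneg _) h6 2
      rw [h4, norm_add_sq_real, real_inner_smul_right, norm_smul, R.unit a hA.mem,
        Real.norm_eq_abs, mul_one, sq_abs, real_inner_comm] at this
      have h8 : γ * (γ + 2 * ⟪a, x⟫) ≤ 0 := by nlinarith
      rcases hx.eq_or_lt with h9 | h9
      · rw [← h9] at h8 h5 ⊢
        nlinarith
      · nlinarith
    rw [hρ' x z hz, h4, h7, hs x]
    congr 2; module
  have h12β : ∀ x, ⟪a, x⟫ ≤ 0 → asym b₁ x b₂ (s x) = 0 := by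
    intro x hx
    obtain ⟨ζ, hζ, hxζ, haζ⟩ := exists_reg_cone_pos hA.mem (y := s x) (by rw [hsa]; linarith)
    obtain ⟨ρ, hρ, hρ'⟩ := B.exists_retraction hb₁ hb₂ hζ
    have e : ρ x = s x := by
      refine hsξ.lip_eq hρ s (fun x hx => ?_) (fun x hx => ?_) x
      · refine hζ.eq_of_dist_cone (u := 0) fun z hz => ?_
        rw [zero_add, dist_eq_norm, dist_eq_norm, ← hρ' _ z hz,
          B.asym_congr_left hb₁ hb₂ hb₂ _ (h12 x hx), B.asym_self hb₂]
      · refine hζ.eq_of_dist_cone (u := 0) fun z hz => ?_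
        rw [zero_add, dist_eq_norm, dist_eq_norm, ← hρ' _ z hz, B.asym_comm hb₁ hb₂,
          hαα z x (hz a hA.mem haζ) hx, ← s.norm_map, map_sub, hss, norm_sub_rev]
    rw [hρ' x _ hxζ, e, sub_self, norm_zero]
  have hbs : (fun x => b₂ (s x + 0)) ∈ F := B.A1 b₂ hb₂ s hsG 0
  have hbs0 : ∀ x, asym (fun x => b₂ (s x + 0)) x b₂ (s x) = 0 := B.asym_comp hb₂ hsG 0
  have hmark : ∀ f ∈ F, ∀ h ∈ F, (∀ x, f x ∈ range h) → ∃ w ∈ R.G, ∀ x, asym f x h (w x) = 0 := by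
    intro f hf h hh H
    obtain ⟨w, hw, v, hwv⟩ := B.A2mark f hf h hh
    exact ⟨w, hw, fun x => B.asym_mark hf hh (C := univ) (fun _ _ _ _ => mem_univ _) (u := 0)
      (v := v) (fun c _ => hwv _ (H _)) (mem_univ x)⟩
  obtain ⟨c₁, hc₁⟩ := (B.overlap_half hg hb₁ hA.mem h1g).resolve_left fun H => by
    obtain ⟨w, hw, hw'⟩ := hmark g hg b₁ hb₁ H
    have := hw' (w⁻¹ (s ξ))
    rw [map_inv_map] at this
    exact hno _ (B.asym_trans hk hb₁ hg (h1k _ (self_mem_cone _)) (B.asym_symm hg hb₁ this))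
  obtain ⟨c₂, hc₂⟩ := (B.overlap_half hg hb₂ (R.neg a hA.mem) fun x hx => h2g x (by
      rw [inner_neg_left] at hx; linarith)).resolve_left fun H => by
    obtain ⟨w, hw, hw'⟩ := hmark g hg b₂ hb₂ H
    have := hw' (w⁻¹ (s (s ξ)))
    rw [map_inv_map] at this
    exact hno _ (B.asym_trans hk hb₂ hg (h2k _ (self_mem_cone _)) (B.asym_symm hg hb₂ this))
  obtain ⟨c₃, hc₃⟩ := (B.overlap_half hb₁ hbs (R.neg a hA.mem) fun x hx =>
      B.asym_trans hb₁ hb₂ hbs (h12β x (by rw [inner_neg_left] at hx; linarith))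
        (B.asym_symm hbs hb₂ (hbs0 x))).resolve_left fun H => by
    obtain ⟨w, hw, hw'⟩ := hmark b₁ hb₁ _ hbs H
    have hwβ : ∀ x, ⟪a, x⟫ ≤ 0 → w x = x := fun x hx =>
      (B.eq_of_asym hbs (B.asym_trans hbs hb₂ hbs (hbs0 x) (B.asym_trans hb₂ hb₁ hbs
        (B.asym_symm hb₁ hb₂ (h12β x hx)) (hw' x)))).symm
    have hwξ : w ξ = ξ := by
      have := hwβ (-ξ) (by rw [inner_neg_right]; linarith [hA.pos])
      rwa [map_neg, neg_inj] at this
    have e1 := hw' ξ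
    rw [hwξ] at e1
    have e2 := B.asym_trans hg hb₁ hbs (h1g ξ hA.pos.le) e1
    have e3 := B.asym_trans hg hbs hb₂ e2 (hbs0 ξ)
    have e4 := B.eq_of_asym hg (B.asym_trans hg hb₂ hg e3
      (B.asym_symm hg hb₂ (h2g (s ξ) (hsneg _ (self_mem_cone _)))))
    have h4 := congrArg (fun x => ⟪a, x⟫) e4
    simp only [hsa] at h4
    linarith [hA.pos]
  have hr : range (fun x => b₂ (s x + 0)) = range b₂ := by
    ext p
    constructor
    · rintro ⟨x, rfl⟩; exact ⟨_, rfl⟩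
    · rintro ⟨x, rfl⟩; exact ⟨s x, by simp [hss]⟩
  rw [hr] at hc₃
  obtain ⟨x₀, hx1, hx2⟩ := B.A5 g hg b₁ hb₁ b₂ hb₂ ⟨a, hA.mem, c₁, hc₁⟩
    ⟨-a, R.neg a hA.mem, c₃, hc₃⟩ ⟨-a, R.neg a hA.mem, c₂, hc₂⟩
  rw [hc₁] at hx1
  rw [hc₂, inner_neg_left] at hx2
  refine ⟨b₁, hb₁, _, hbs, c₁, h1k, fun x hx => B.asym_trans hk hb₂ hbs (h2k x hx)
    (B.asym_symm hbs hb₂ (hbs0 x)), fun x hx => (hc₁ x).2 hx, fun x hx => ?_⟩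
  rw [hr, hc₂, inner_neg_left]; linarith

end IsBldg

omit [MetricSpace Y] in
lemma Piece.comp {g g' k : E → Y} {ζ : E} {X X' : Set E} (h : R.Piece F g' k ζ X)
    (hX' : R.RootConvex X') {w : E ≃ₗᵢ[ℝ] E} (hw : w ∈ R.G) {v : E}
    (hg : ∀ x ∈ X', g x = g' (w x + v)) : R.Piece F g k ζ (X' ∩ {x | w x + v ∈ X}) := by
  obtain ⟨hX, b, hb, hA, w', hw', v', H⟩ := h
  refine ⟨hX'.inter (hX.preimage hw v), b, hb, hA, w' * w, R.G.mul_mem hw' hw, w' v + v', ?_⟩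
  rintro x ⟨hx, hx'⟩
  rw [hg x hx, H _ hx', map_add, add_assoc]; rfl

omit [MetricSpace Y] in
lemma Pieces.comp {m : ℕ} {g g' k : E → Y} {ζ : E} (h : R.Pieces F m g' k ζ)
    {w : E ≃ₗᵢ[ℝ] E} (hw : w ∈ R.G) {v : E}
    (hg : ∀ x, g x = g' (w x + v)) : R.Pieces F m g k ζ := by
  obtain ⟨X, hX, hP⟩ := h
  refine ⟨fun j => univ ∩ {x | w x + v ∈ X j}, fun x => ?_, fun j =>
    (hP j).comp rootConvex_univ hw fun x _ => hg x⟩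
  obtain ⟨j, hj⟩ := hX (w x + v)
  exact ⟨j, mem_univ _, hj⟩

namespace IsBldg

variable (B : IsBldg R F)
include B

lemma pieces_of_not_sep {g k : E → Y} (hk : k ∈ F) {ζ ξ : E} (hζ : R.Reg ζ) (hg : g ∈ F)
    (hsep : ¬∃ b ∈ R.Φ, 0 < ⟪b, ξ⟫ ∧ ⟪b, ζ⟫ < 0)
    (h0 : ∀ x ∈ R.Cone ξ, asym k x g x = 0) (m : ℕ) : R.Pieces F m g k ζ := by
  have hmem : ζ ∈ R.Cone ξ := fun b hb hp => by
    by_contra hn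
    exact hsep ⟨b, hb, hp, not_le.1 hn⟩
  obtain ⟨w, hw, _, u, v, hu⟩ := B.exists_mark_of_asym hk hg hζ (h0 ζ hmem)
  refine ⟨fun _ => univ, fun x => ⟨Classical.arbitrary _, mem_univ _⟩, fun _ => ⟨rootConvex_univ, _,
    B.A1 g hg w hw v, ⟨u, fun c hc => (hu c hc).symm⟩, w⁻¹, R.G.inv_mem hw, -w⁻¹ v,
    fun x _ => ?_⟩⟩
  rw [map_add, map_neg, map_inv_map, map_inv_map, neg_add_cancel_right]

lemma pieces_of_nsep {k : E → Y} (hk : k ∈ F) {ζ : E} (hζ : R.Reg ζ) (m : ℕ) :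
    ∀ ξ, R.Reg ξ → R.nsep ξ ζ ≤ m → ∀ g ∈ F, (∀ x ∈ R.Cone ξ, asym k x g x = 0) →
      R.Pieces F m g k ζ := by
  induction m with
  | zero =>
    intro ξ hξ hm g hg h0
    refine B.pieces_of_not_sep hk hζ hg ?_ h0 0
    rintro ⟨b, hb⟩
    have : (R.nsep ξ ζ) ≠ 0 := (Set.ncard_pos (R.finΦ.subset fun b hb => hb.1)).2 ⟨b, hb⟩ |>.ne'
    omega
  | succ m ih =>
    intro ξ hξ hm g hg h0
    by_cases hsep : ∃ b ∈ R.Φ, 0 < ⟪b, ξ⟫ ∧ ⟪b, ζ⟫ < 0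
    swap
    · exact B.pieces_of_not_sep hk hζ hg hsep h0 _
    obtain ⟨ξ', a, η, hξ', hsign, hA, haζ⟩ := exists_adj hξ hζ hsep
    obtain ⟨s, hsG, hs⟩ := R.refl a hA.mem
    rw [← cone_eq_of_sign hsign] at h0
    have hlt := hA.nsep_lt hξ' hsG hs haζ
    have hn : R.nsep ξ' ζ = R.nsep ξ ζ := by
      unfold nsep
      congr 1; ext b
      exact ⟨fun h => ⟨h.1, (hsign b h.1).1 h.2.1, h.2.2⟩,
        fun h => ⟨h.1, (hsign b h.1).2 h.2.1, h.2.2⟩⟩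
    have hIH := ih (s ξ') (hξ'.map hsG) (by omega)
    by_cases hno : ∃ x', asym k (s ξ') g x' = 0
    · obtain ⟨x', hx'⟩ := hno
      obtain ⟨w, hw, _, u, v, hu⟩ := B.exists_mark_of_asym hk hg (hξ'.map hsG) hx'
      have hg' := B.A1 g hg w hw 0
      obtain ⟨X, hX, hP⟩ := (hIH _ hg' fun x hx => B.asym_trans hk hg hg'
        (B.asym_cone_mark hk hg hu hx) (B.asym_symm hg' hg (B.asym_comp hg hw 0 x))).comp
        (g := g) (R.G.inv_mem hw) (v := 0) (fun x => by simp)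
      refine ⟨Sum.elim X X, fun x => ?_, ?_⟩
      · obtain ⟨j, hj⟩ := hX x
        exact ⟨Sum.inl j, hj⟩
      · rintro (j | j)
        · exact hP j
        · exact hP j
    · push Not at hno
      obtain ⟨b₁, hb₁, b₂, hb₂, c, h1, h2, H1, H2⟩ := B.sundial hg hk hξ' hA hsG hs h0 hno
      obtain ⟨X₁, hX₁, hP₁⟩ := hIH b₁ hb₁ h1
      obtain ⟨X₂, hX₂, hP₂⟩ := hIH b₂ hb₂ h2
      obtain ⟨w₁, hw₁, v₁, e₁⟩ := B.A2mark g hg b₁ hb₁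
      obtain ⟨w₂, hw₂, v₂, e₂⟩ := B.A2mark g hg b₂ hb₂
      refine ⟨Sum.elim (fun j => {x | c ≤ ⟪a, x⟫} ∩ {x | w₁ x + v₁ ∈ X₁ j})
        (fun j => {x | -c ≤ ⟪-a, x⟫} ∩ {x | w₂ x + v₂ ∈ X₂ j}), fun x => ?_, ?_⟩
      · rcases le_total c ⟪a, x⟫ with h | h
        · obtain ⟨j, hj⟩ := hX₁ (w₁ x + v₁)
          exact ⟨Sum.inl j, h, hj⟩
        · obtain ⟨j, hj⟩ := hX₂ (w₂ x + v₂)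
          refine ⟨Sum.inr j, ?_, hj⟩
          change -c ≤ ⟪-a, x⟫
          rw [inner_neg_left]; linarith
      · rintro (j | j)
        · exact (hP₁ j).comp (rootConvex_half hA.mem c) hw₁ fun x hx => e₁ x (H1 x hx)
        · refine (hP₂ j).comp (rootConvex_half (R.neg a hA.mem) (-c)) hw₂ fun x hx =>
            e₂ x (H2 x ?_)
          change -c ≤ ⟪-a, x⟫ at hx
          rw [inner_neg_left] at hx; linarith

theorem cov : R.Cov F R.Φ.ncard := by
  intro g hg k hk ζ hζ
  obtain ⟨h, hh, w₁, hw₁, w₂, hw₂, u₁, v₁, u₂, v₂, H₁, H₂⟩ := B.A4' hg hk hζ hζ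
  have hh' := B.A1 h hh w₂ hw₂ v₂
  set h' : E → Y := fun x => h (w₂ x + v₂) with hdef
  have hw : w₂⁻¹ * w₁ ∈ R.G := R.G.mul_mem (R.G.inv_mem hw₂) hw₁
  have hw' := R.G.inv_mem hw
  have hg' := B.A1 g hg _ hw' 0
  have key : ∀ x ∈ R.Cone ((w₂⁻¹ * w₁) ζ), asym h' x (fun x => g ((w₂⁻¹ * w₁)⁻¹ x + 0)) x = 0 := by
    intro x hx
    have hy : (w₂⁻¹ * w₁)⁻¹ x ∈ R.Cone ζ := by
      rw [← map_inv_map (w₂⁻¹ * w₁) x] at hx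
      exact (map_mem_cone_iff hw).1 hx
    have e1 := B.asym_cone_mark hg hh H₁ hy
    have e2 := B.asym_comp hh hw₂ v₂ x
    have e3 : w₁ ((w₂⁻¹ * w₁)⁻¹ x) = w₂ x := by
      have : w₂ ((w₂⁻¹ * w₁) ((w₂⁻¹ * w₁)⁻¹ x)) = w₁ ((w₂⁻¹ * w₁)⁻¹ x) := map_inv_map w₂ _
      rw [← this, map_inv_map]
    rw [e3] at e1
    exact B.asym_trans hh' hh hg' e2 (B.asym_symm hg' hh
      (B.asym_trans hg' hg hh (B.asym_comp hg hw' 0 x) e1))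
  obtain ⟨X, hX, hP⟩ := (B.pieces_of_nsep hh' hζ _ _ (hζ.map hw) (nsep_le_card _ _) _ hg' key).comp
    (g := g) hw (v := 0) (fun x => by simp)
  refine ⟨X, hX, fun j => ?_⟩
  obtain ⟨h1, b, hb, hA, h2⟩ := hP j
  exact ⟨h1, b, hb, Agree.trans hζ ⟨u₂, fun c hc => (H₂ c hc).symm⟩ hA, h2⟩

end IsBldg

end Sundial
end ReflDatum

namespace ReflDatum

open Filter Topology
open scoped RealInnerProductSpace

section Folding

variable {E : Type*} [NormedAddCommGroup E] [InnerProductSpace ℝ E] (R : ReflDatum E)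
  {Y : Type*} [MetricSpace Y]

/-- The folding of the apartment of `l` onto the model space, centred at the chamber of `ζ` in
the apartment of `k`. -/
structure IsFolding (F : Set (E → Y)) (m : ℕ) (l k : E → Y) (ζ : E) (φ : E → E) : Prop where
  short : ∀ x y, dist (φ x) (φ y) ≤ dist x y
  pieces : ∃ X : Idx m → Set E, (∀ x, ∃ j, x ∈ X j) ∧ ∀ j, R.RootConvex (X j) ∧
    ∃ h ∈ F, R.Agree ζ k h ∧ (∀ x ∈ X j, l x = h (φ x)) ∧ ∃ w ∈ R.G, ∃ v, ∀ x ∈ X j, φ x = w x + v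

/-- A compatible family of charts with foldings. -/
structure IsFolded (F : Set (E → Y)) (m : ℕ) : Prop extends IsCharts R F where
  A2closed : ∀ f ∈ F, ∀ g ∈ F, IsClosed {x | f x ∈ range g}
  A2convex : ∀ f ∈ F, ∀ g ∈ F, Convex ℝ {x | f x ∈ range g}
  cov : R.Cov F m

variable {R} {F : Set (E → Y)} {m : ℕ}

lemma IsBldg.isFolded (B : IsBldg R F) : IsFolded R F R.Φ.ncard :=
  ⟨B.toIsCharts, B.A2closed, B.A2convex, B.cov⟩

lemma exists_convex_piece {ι : Type*} [Finite ι] {X : ι → Set E} (hX : ∀ j, Convex ℝ (X j))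
    (hc : ∀ x, ∃ j, x ∈ X j) (x e : E) : ∃ j, ∃ ε > 0, ∀ t : ℝ, 0 < t → t ≤ ε →
      x + t • e ∈ X j := by
  have h1 : ∃ j, ∃ᶠ t in 𝓝[>] (0 : ℝ), x + t • e ∈ X j := by
    by_contra! hcon
    have := eventually_all.2 hcon
    obtain ⟨t, ht⟩ := this.exists
    obtain ⟨j, hj⟩ := hc (x + t • e)
    exact ht j hj
  obtain ⟨j, hj⟩ := h1
  obtain ⟨ε, hε, hε0⟩ := (hj.and_eventually self_mem_nhdsWithin).exists
  have hε0 : (0 : ℝ) < ε := hε0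
  refine ⟨j, ε, hε0, fun t ht htε => ?_⟩
  obtain ⟨s, ⟨hs, hs0⟩, hst⟩ := ((hj.and_eventually self_mem_nhdsWithin).and_eventually
    (nhdsWithin_le_nhds (eventually_lt_nhds ht))).exists
  have hs0 : (0 : ℝ) < s := hs0
  have hd : 0 < ε - s := by linarith
  have := hX j hs hε (a := (ε - t) / (ε - s)) (b := (t - s) / (ε - s))
    (div_nonneg (by linarith) hd.le) (div_nonneg (by linarith) hd.le) (by field_simp; ring)
  have e1 : ((ε - t) / (ε - s)) • (x + s • e) + ((t - s) / (ε - s)) • (x + ε • e) = x + t • e := by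
    have h2 : (ε - t) / (ε - s) = 1 - (t - s) / (ε - s) := by field_simp; ring
    have h3 : t = s + (t - s) / (ε - s) * (ε - s) := by field_simp; ring
    rw [h2, show x + t • e = x + (s + (t - s) / (ε - s) * (ε - s)) • e by rw [← h3]]
    module
  rwa [e1] at this

namespace IsCharts

variable (hF : IsCharts R F)
include hF

lemma agree_eq {h h' : E → Y} (hh : h ∈ F) (hh' : h' ∈ F) {ζ : E} (hζ : R.Reg ζ)
    (H : R.Agree ζ h h') {y z : E} (e : h y = h' z) : y = z := by
  obtain ⟨u, hu⟩ := H
  refine hζ.eq_of_dist_cone (u := u) fun c hc => ?_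
  rw [← (hF.isom h hh).dist_eq, ← (hF.isom h' hh').dist_eq, e, hu c hc]

lemma exists_folding (hC : R.Cov F m) {l k : E → Y} (hl : l ∈ F) (hk : k ∈ F) {ζ : E}
    (hζ : R.Reg ζ) : ∃ φ, R.IsFolding F m l k ζ φ := by
  obtain ⟨X, hX, hP⟩ := hC l hl k hk ζ hζ
  choose hRC h hh hA w hw v H using hP
  choose J hJ using hX
  have hφ : ∀ j x, l x = h j (w j x + v j) → w (J x) x + v (J x) = w j x + v j := fun j x hx =>
    hF.agree_eq (hh _) (hh j) hζ (Agree.trans hζ (hA _).symm (hA j)) (by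
      rw [← hx, H _ x (hJ x)])
  refine ⟨fun x => w (J x) x + v (J x), dist_le_of_finite_closed_cover
      (S := range fun j => {x | l x = h j (w j x + v j)}) (finite_range _) ?_ ?_ ?_,
      X, fun x => ⟨_, hJ x⟩, fun j => ⟨hRC j, h j, hh j, hA j,
    fun x hx => by rw [hφ j x (H j x hx), H j x hx], w j, hw j, v j, fun x hx => hφ j x (H j x hx)⟩⟩
  · rintro _ ⟨j, rfl⟩
    exact isClosed_eq (hF.isom l hl).continuous
      ((hF.isom _ (hh j)).continuous.comp (by fun_prop))
  · exact fun x => ⟨_, ⟨J x, rfl⟩, H _ x (hJ x)⟩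
  · rintro _ ⟨j, rfl⟩ x hx y hy
    rw [hφ j x hx, hφ j y hy, dist_add_right, (w j).dist_map]

/-- Retractions onto an apartment from a chamber at infinity are short. -/
lemma dist_le (hC : R.Cov F m) {h h' : E → Y} (hh : h ∈ F) (hh' : h' ∈ F) {ζ : E}
    (hζ : R.Reg ζ) (H : R.Agree ζ h h') (y z : E) : dist y z ≤ dist (h y) (h' z) := by
  obtain ⟨l, hl, ⟨p, hp⟩, q, hq⟩ := hF.A3 (h y) (h' z)
  obtain ⟨φ, hφ, X, hX, hP⟩ := hF.exists_folding hC hl hh hζ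
  have key : ∀ b ∈ F, R.Agree ζ h b → ∀ x y, l x = b y → φ x = y := by
    intro b hb hA x y e
    obtain ⟨j, hj⟩ := hX x
    obtain ⟨_, b', hb', hA', e', _⟩ := hP j
    exact hF.agree_eq hb' hb hζ (Agree.trans hζ hA'.symm hA) (by rw [← e' x hj, e])
  have := hφ p q
  rw [← hp, ← hq, (hF.isom l hl).dist_eq]
  rwa [key h hh (agree_refl ζ h) p y hp, key h' hh' H q z hq] at this

variable {l k : E → Y} {ζ : E} {φ : E → E} (hφ : R.IsFolding F m l k ζ φ)
include hφ

lemma folding_eq (hζ : R.Reg ζ) {h : E → Y} (hh : h ∈ F) (hA : R.Agree ζ k h) {x y : E}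
    (e : l x = h y) : φ x = y := by
  obtain ⟨X, hX, hP⟩ := hφ.pieces
  obtain ⟨j, hj⟩ := hX x
  obtain ⟨_, b', hb', hA', e', _⟩ := hP j
  exact hF.agree_eq hb' hh hζ (Agree.trans hζ hA'.symm hA) (by rw [← e' x hj, e])

lemma folding_dist_le (hC : R.Cov F m) (hζ : R.Reg ζ) {h : E → Y} (hh : h ∈ F)
    (hA : R.Agree ζ k h) (x y : E) : dist y (φ x) ≤ dist (h y) (l x) := by
  obtain ⟨X, hX, hP⟩ := hφ.pieces
  obtain ⟨j, hj⟩ := hX x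
  obtain ⟨_, b', hb', hA', e', _⟩ := hP j
  rw [e' x hj]
  exact hF.dist_le hC hh hb' hζ (Agree.trans hζ hA.symm hA') y (φ x)

omit hF [MetricSpace Y] in
lemma folding_continuous : Continuous φ := (LipschitzWith.mk_one hφ.short).continuous

lemma folding_local (hl : l ∈ F) (x e : E) :
    ∃ ε > 0, ∃ h ∈ F, R.Agree ζ k h ∧ ∃ w ∈ R.G, ∀ t : ℝ, 0 ≤ t → t ≤ ε →
      l (x + t • e) = h (φ x + t • w e) ∧ φ (x + t • e) = φ x + t • w e := by
  obtain ⟨X, hX, hP⟩ := hφ.pieces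
  obtain ⟨j, ε, hε, hj⟩ := exists_convex_piece (fun j => (hP j).1.convex) hX x e
  obtain ⟨_, h, hh, hA, e', w, hw, v, H⟩ := hP j
  have hcont := folding_continuous hφ
  have ev : ∀ᶠ t in 𝓝[>] (0 : ℝ), x + t • e ∈ X j := by
    filter_upwards [self_mem_nhdsWithin, nhdsWithin_le_nhds (eventually_lt_nhds hε)] with t h1 h2
    exact hj t h1 h2.le
  have hlim : Tendsto (fun t : ℝ => x + t • e) (𝓝[>] 0) (𝓝 x) := by
    have : Continuous fun t : ℝ => x + t • e := by fun_prop
    simpa using (this.tendsto 0).mono_left nhdsWithin_le_nhds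
  have h0 : φ x = w x + v := tendsto_nhds_unique ((hcont.tendsto x).comp hlim)
    ((((by fun_prop : Continuous fun x => w x + v).tendsto x).comp hlim).congr' (by
      filter_upwards [ev] with t ht using (H _ ht).symm))
  have h1 : l x = h (φ x) := tendsto_nhds_unique (((hF.isom l hl).continuous.tendsto x).comp hlim)
    (((((hF.isom h hh).continuous.comp hcont).tendsto x).comp hlim).congr' (by
      filter_upwards [ev] with t ht using (e' _ ht).symm))
  refine ⟨ε, hε, h, hh, hA, w, hw, fun t ht htε => ?_⟩
  rcases ht.eq_or_lt with rfl | ht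
  · simp [h1]
  · have h2 : φ (x + t • e) = φ x + t • w e := by
      rw [H _ (hj t ht htε), h0, map_add, map_smul]; abel
    exact ⟨by rw [e' _ (hj t ht htε), h2], h2⟩

end IsCharts

lemma inner_add_nonpos {u v q : E} {r : ℝ} (hu : ‖u‖ = r) (hv : ‖v‖ = r)
    (h : ∀ τ : ℝ, 0 ≤ τ → 2 * r ≤ ‖u - τ • q‖ + ‖v - τ • q‖) : ⟪u + v, q⟫ ≤ 0 := by
  rcases (norm_nonneg u).eq_or_lt with h0 | h0
  · rw [norm_eq_zero.1 h0.symm, norm_eq_zero.1 ((hv.trans hu.symm).trans h0.symm)]; simp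
  rw [hu] at h0
  have key : ∀ τ : ℝ, 0 < τ → ⟪u + v, q⟫ ≤ τ * ‖q‖ ^ 2 := by
    intro τ hτ
    have h1 := h τ hτ.le
    have h2 : ∀ u : E, ‖u‖ = r → 2 * r * ‖u - τ • q‖ ≤
        2 * r ^ 2 - 2 * τ * ⟪u, q⟫ + τ ^ 2 * ‖q‖ ^ 2 := by
      intro u hu
      have := norm_sub_sq_real u (τ • q)
      rw [real_inner_smul_right, norm_smul, Real.norm_eq_abs, mul_pow, sq_abs, hu] at this
      nlinarith [sq_nonneg (‖u - τ • q‖ - r)]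
    have h3 := h2 u hu
    have h4 := h2 v hv
    rw [inner_add_left]
    have h5 : 0 ≤ τ * (τ * ‖q‖ ^ 2 - (⟪u, q⟫ + ⟪v, q⟫)) := by nlinarith
    linarith [nonneg_of_mul_nonneg_right h5 hτ]
  by_contra! hlt
  have hq : 0 < ‖q‖ ^ 2 + 1 := by positivity
  have := key (⟪u + v, q⟫ / (‖q‖ ^ 2 + 1)) (by positivity)
  rw [div_mul_eq_mul_div, le_div_iff₀ hq] at this
  nlinarith

namespace IsFolded

variable (hF : IsFolded R F m)
include hF

lemma eq_on_cone {h h' : E → Y} (hh : h ∈ F) (hh' : h' ∈ F) {ζ : E} (hζ : R.Reg ζ)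
    (H : R.Agree ζ h h') {z : E} (e : h z = h' z) {c : E} (hc : c ∈ R.Cone ζ) :
    h (z + c) = h' (z + c) := by
  obtain ⟨u, hu⟩ := H
  obtain ⟨y, hy⟩ := add_mem_of_recession (hF.A2closed h hh h' hh') (hF.A2convex h hh h' hh')
    (x := z) (u := u) (c := c) ⟨z, e.symm⟩
    fun t ht => ⟨_, hu _ (smul_mem_cone ht hc)⟩
  rw [hF.agree_eq hh hh' hζ ⟨u, hu⟩ hy.symm, hy, hF.agree_eq hh hh' hζ ⟨u, hu⟩ hy.symm]

lemma folding_two_sided {l k : E → Y} {ζ : E} {φ : E → E} (hφ : R.IsFolding F m l k ζ φ)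
    (hl : l ∈ F) (hζ : R.Reg ζ) (x e : E) :
    ∃ ε > 0, ∀ t : ℝ, 0 ≤ t → t ≤ ε → (∀ q ∈ R.Cone ζ, ⟪φ (x + t • e) + φ (x - t • e), q⟫ ≤
      2 * ⟪φ x, q⟫) ∧ ‖φ (x + t • e) - φ x‖ = t * ‖e‖ ∧ ‖φ (x - t • e) - φ x‖ = t * ‖e‖ := by
  obtain ⟨ε₁, hε₁, h₁, hh₁, hA₁, w₁, hw₁, H₁⟩ := hF.folding_local hφ hl x e
  obtain ⟨ε₂, hε₂, h₂, hh₂, hA₂, w₂, hw₂, H₂⟩ := hF.folding_local hφ hl x (-e)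
  refine ⟨min ε₁ ε₂, lt_min hε₁ hε₂, fun t ht htε => ?_⟩
  obtain ⟨e1, f1⟩ := H₁ t ht (htε.trans (min_le_left _ _))
  obtain ⟨e2, f2⟩ := H₂ t ht (htε.trans (min_le_right _ _))
  rw [smul_neg, ← sub_eq_add_neg] at e2 f2
  have n1 : ‖t • w₁ e‖ = t * ‖e‖ := by
    rw [norm_smul, w₁.norm_map, Real.norm_eq_abs, abs_of_nonneg ht]
  have n2 : ‖t • w₂ (-e)‖ = t * ‖e‖ := by
    rw [norm_smul, w₂.norm_map, norm_neg, Real.norm_eq_abs, abs_of_nonneg ht]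
  refine ⟨fun q hq => ?_, by rw [f1, add_sub_cancel_left, n1], by rw [f2, add_sub_cancel_left, n2]⟩
  have hA := Agree.trans hζ hA₁.symm hA₂
  have e0 : h₁ (φ x) = h₂ (φ x) := by
    have h3 := (H₁ 0 le_rfl hε₁.le).1
    have h4 := (H₂ 0 le_rfl hε₂.le).1
    simp only [zero_smul, add_zero] at h3 h4
    rw [← h3, h4]
  have := inner_add_nonpos (q := q) n1 n2 fun τ hτ => by
    have e3 := hF.eq_on_cone hh₁ hh₂ hζ hA e0 (smul_mem_cone hτ hq)
    have h5 := dist_triangle (l (x + t • e)) (h₁ (φ x + τ • q)) (l (x - t • e))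
    rw [(hF.isom l hl).dist_eq, e1, (hF.isom _ hh₁).dist_eq, e2, e3, (hF.isom _ hh₂).dist_eq,
      dist_comm (φ x + τ • q), dist_eq_norm, dist_eq_norm, dist_eq_norm, add_sub_add_left_eq_sub,
      add_sub_add_left_eq_sub] at h5
    have h6 : ‖x + t • e - (x - t • e)‖ = 2 * (t * ‖e‖) := by
      rw [show x + t • e - (x - t • e) = (2 * t) • e by module, norm_smul, Real.norm_eq_abs,
        abs_of_nonneg (by positivity)]; ring
    rwa [h6] at h5
  rw [f1, f2]
  simp only [inner_add_left] at this ⊢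
  linarith

/-- Foldings are concave in the directions of their centre. -/
lemma folding_concave {l k : E → Y} {ζ : E} {φ : E → E} (hφ : R.IsFolding F m l k ζ φ)
    (hl : l ∈ F) (hζ : R.Reg ζ) (x e : E) {q : E} (hq : q ∈ R.Cone ζ) :
    ConvexOn ℝ univ fun t : ℝ => -⟪φ (x + t • e), q⟫ := by
  refine convex_of_local ?_ fun t => ?_
  · have := IsCharts.folding_continuous hφ
    fun_prop
  · obtain ⟨ε, hε, H⟩ := hF.folding_two_sided hφ hl hζ (x + t • e) e
    refine ⟨ε, hε, fun s hs hsε => ?_⟩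
    have := (H s hs.le hsε).1 q hq
    rw [inner_add_left] at this
    rw [show x + (t + s) • e = x + t • e + s • e by module,
      show x + (t - s) • e = x + t • e - s • e by module]
    linarith

/-- The Bruhat-Tits inequality along apartments. -/
lemma cn {g : E → Y} (hg : g ∈ F) (p : Y) (x e : E) :
    dist p (g x) ^ 2 + ‖e‖ ^ 2 ≤ (dist p (g (x + e)) ^ 2 + dist p (g (x - e)) ^ 2) / 2 := by
  have hconv : ConvexOn ℝ univ fun t : ℝ => dist p (g (x + t • e)) ^ 2 - t ^ 2 * ‖e‖ ^ 2 := by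
    have hgc := (hF.isom g hg).continuous
    refine convex_of_local (by fun_prop) fun t => ?_
    obtain ⟨h, hh, ⟨zp, rfl⟩, zm, hzm⟩ := hF.A3 p (g (x + t • e))
    obtain ⟨ζ, hζ, hqζ⟩ := R.exists_reg_cone (zp - zm)
    obtain ⟨φ, hφ⟩ := hF.exists_folding hF.cov hg hh hζ
    have hx : φ (x + t • e) = zm := hF.folding_eq hφ hζ hh (agree_refl ζ h) hzm.symm
    obtain ⟨ε, hε, H⟩ := hF.folding_two_sided hφ hg hζ (x + t • e) e
    refine ⟨ε, hε, fun s hs hsε => ?_⟩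
    obtain ⟨h1, h2, h3⟩ := H s hs.le hsε
    have h1 := h1 _ hqζ
    have d1 := hF.folding_dist_le hφ hF.cov hζ hh (agree_refl ζ h) (x + t • e + s • e) zp
    have d2 := hF.folding_dist_le hφ hF.cov hζ hh (agree_refl ζ h) (x + t • e - s • e) zp
    rw [show x + (t + s) • e = x + t • e + s • e by module,
      show x + (t - s) • e = x + t • e - s • e by module, ← hzm, (hF.isom h hh).dist_eq]
    rw [hx] at h1 h2 h3
    set A := φ (x + t • e + s • e)
    set B := φ (x + t • e - s • e)
    have d1' := pow_le_pow_left₀ dist_nonneg d1 2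
    have d2' := pow_le_pow_left₀ dist_nonneg d2 2
    have a1 : dist zp A ^ 2 = ‖zp - zm‖ ^ 2 - 2 * ⟪zp - zm, A - zm⟫ + (s * ‖e‖) ^ 2 := by
      rw [dist_eq_norm, show zp - A = (zp - zm) - (A - zm) by abel, norm_sub_sq_real, h2]
    have a2 : dist zp B ^ 2 = ‖zp - zm‖ ^ 2 - 2 * ⟪zp - zm, B - zm⟫ + (s * ‖e‖) ^ 2 := by
      rw [dist_eq_norm, show zp - B = (zp - zm) - (B - zm) by abel, norm_sub_sq_real, h3]
    rw [a1] at d1'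
    rw [a2] at d2'
    rw [dist_eq_norm]
    have h4 : ⟪zp - zm, A - zm⟫ + ⟪zp - zm, B - zm⟫ ≤ 0 := by
      rw [inner_sub_right, inner_sub_right, real_inner_comm, real_inner_comm B,
        real_inner_comm zm]
      rw [inner_add_left] at h1
      rw [real_inner_comm (zp - zm) zm] at *
      linarith
    nlinarith
  have := hconv.2 (mem_univ 1) (mem_univ (-1)) (by norm_num : (0 : ℝ) ≤ 1 / 2)
    (by norm_num : (0 : ℝ) ≤ 1 / 2) (by norm_num)
  simp only [smul_eq_mul] at this
  norm_num [← sub_eq_add_neg] at this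
  linarith

end IsFolded

end Folding
end ReflDatum

namespace ReflDatum

open Filter Topology
open scoped RealInnerProductSpace

section Depth

variable {E : Type*} [NormedAddCommGroup E] [InnerProductSpace ℝ E] {R : ReflDatum E}
  {Y : Type*} [MetricSpace Y] {F : Set (E → Y)} {m : ℕ}

open Classical in
lemma exists_gap (R : ReflDatum E) (ζ : E) :
    ∃ κ > 0, ∀ w ∈ R.G, w ζ ≠ ζ → κ ≤ ‖w ζ - ζ‖ := by
  have := R.finG
  let f : R.G → ℝ := fun w => if (w : E ≃ₗᵢ[ℝ] E) ζ = ζ then 1 else ‖(w : E ≃ₗᵢ[ℝ] E) ζ - ζ‖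
  obtain ⟨w₀, h₀⟩ := Finite.exists_min f
  refine ⟨f w₀, ?_, fun w hw hne => (h₀ ⟨w, hw⟩).trans (by simp [f, hne])⟩
  dsimp only [f]
  split_ifs with h
  · exact one_pos
  · exact norm_pos_iff.2 (sub_ne_zero.2 h)

/-- The Bruhat-Tits inequality along apartments. -/
def CN (F : Set (E → Y)) : Prop := ∀ g ∈ F, ∀ p x e,
  dist p (g x) ^ 2 + ‖e‖ ^ 2 ≤ (dist p (g (x + e)) ^ 2 + dist p (g (x - e)) ^ 2) / 2

namespace IsCharts

variable (hF : IsCharts R F) (hcn : CN F)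
include hF hcn

lemma dist_mid_le {h f : E → Y} (hh : h ∈ F) (hf : f ∈ F) {x y e e' : E}
    (H : h (x - e) = f (y - e')) :
    dist (h x) (f y) ≤ dist (h (x + e)) (f (y + e')) / 2 := by
  have h1 := hcn f hf (h x) y e'
  have h2 := hcn h hh (f (y + e')) x e
  have h3 : dist (h x) (f (y - e')) = ‖e‖ := by
    rw [← H, (hF.isom h hh).dist_eq, dist_eq_norm, sub_sub_cancel]
  have h4 : dist (f (y + e')) (h (x - e)) = 2 * ‖e'‖ := by
    rw [H, (hF.isom f hf).dist_eq, dist_eq_norm, show y + e' - (y - e') = (2 : ℝ) • e' by module,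
      norm_smul, Real.norm_ofNat]
  rw [h3, dist_comm (h x) (f (y + e'))] at h1
  rw [h4, dist_comm _ (h (x + e))] at h2
  refine abs_le_of_sq_le_sq' ?_ (by positivity) |>.2
  nlinarith

/-- Convexity of the distance between apartments. -/
lemma busemann {h f : E → Y} (hh : h ∈ F) (hf : f ∈ F) (x y e e' : E) :
    2 * dist (h x) (f y) ≤ dist (h (x + e)) (f (y + e')) + dist (h (x - e)) (f (y - e')) := by
  obtain ⟨l, hl, ⟨p, hp⟩, q, hq⟩ := hF.A3 (h (x - e)) (f (y + e'))
  have ep : (2⁻¹ : ℝ) • (p + q) - (2⁻¹ : ℝ) • (q - p) = p := by module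
  have eq : (2⁻¹ : ℝ) • (p + q) + (2⁻¹ : ℝ) • (q - p) = q := by module
  have h1 := hF.dist_mid_le hcn hh hl (x := x) (e := e) (y := (2⁻¹ : ℝ) • (p + q))
    (e' := (2⁻¹ : ℝ) • (q - p)) (by rw [ep, hp])
  have h2 := hF.dist_mid_le hcn hl hf (x := (2⁻¹ : ℝ) • (p + q)) (e := -(2⁻¹ : ℝ) • (q - p))
    (y := y)
    (e' := -e') (by rw [neg_smul, sub_neg_eq_add, sub_neg_eq_add, eq, hq])
  rw [eq, hq] at h1
  rw [neg_smul, ← sub_eq_add_neg, ← sub_eq_add_neg, ep, hp] at h2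
  have := dist_triangle (h x) (l ((2⁻¹ : ℝ) • (p + q))) (f y)
  linarith

lemma segment {f g : E → Y} (hf : f ∈ F) (hg : g ∈ F) {x y x' y' : E} (hx : f x = g x')
    (hy : f y = g y') {t : ℝ} (h0 : 0 ≤ t) (h1 : t ≤ 1) :
    f (x + t • (y - x)) = g (x' + t • (y' - x')) := by
  let D : ℝ → ℝ := fun s => dist (f (x + s • (y - x))) (g (x' + s • (y' - x')))
  have hfc := (hF.isom f hf).continuous
  have hgc := (hF.isom g hg).continuous
  have hD : Continuous D := by fun_prop
  have hconv : ConvexOn ℝ univ D := convex_of_local hD fun t => ⟨1, one_pos, fun s _ _ => by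
    have := hF.busemann hcn hf hg (x + t • (y - x)) (x' + t • (y' - x')) (s • (y - x))
      (s • (y' - x'))
    simp only [D]
    convert this using 4 <;> module⟩
  have := hconv.2 (mem_univ 0) (mem_univ 1) (sub_nonneg.2 h1) h0 (by ring)
  have e0 : D 0 = 0 := by simp [D, hx]
  have e1 : D 1 = 0 := by simp [D, hy]
  rw [e0, e1] at this
  simp only [smul_eq_mul, mul_zero, add_zero, mul_one, zero_add] at this
  exact dist_le_zero.1 this

end IsCharts

namespace IsFolded

variable (hF : IsFolded R F m)
include hF

lemma isCN : CN F := fun _ hg p x e => hF.cn hg p x e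

/-- Apartments sharing a chamber at infinity merge at a depth controlled by their distance. -/
lemma depth {h f : E → Y} (hh : h ∈ F) (hf : f ∈ F) {ζ : E} (hζ : R.Reg ζ) (hA : R.Agree ζ h f)
    {κ : ℝ} (hκ : 0 < κ) (hgap : ∀ w ∈ R.G, w ζ ≠ ζ → κ ≤ ‖w ζ - ζ‖) {y : E} {t : ℝ}
    (hd : dist (h y) (f y) ≤ κ * t) {c : E} (hc : c ∈ R.Cone ζ) :
    h (y + t • ζ + c) = f (y + t • ζ + c) := by
  let D : ℝ → ℝ := fun s => dist (h (y + s • ζ)) (f (y + s • ζ))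
  have hhc := (hF.isom h hh).continuous
  have hfc := (hF.isom f hf).continuous
  have hD : Continuous D := by fun_prop
  have hconv : ConvexOn ℝ univ D := convex_of_local hD fun t => ⟨1, one_pos, fun s _ _ => by
    have := hF.busemann hF.isCN hh hf (y + t • ζ) (y + t • ζ) (s • ζ) (s • ζ)
    rwa [show y + t • ζ + s • ζ = y + (t + s) • ζ by module,
      show y + t • ζ - s • ζ = y + (t - s) • ζ by module] at this⟩
  let Z : Set ℝ := {s | 0 ≤ s ∧ D s = 0}
  have hZcl : IsClosed Z := isClosed_Ici.inter (isClosed_eq hD continuous_const)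
  have hZbdd : BddBelow Z := ⟨0, fun s hs => hs.1⟩
  have hZne : Z.Nonempty := by
    obtain ⟨u, hu⟩ := hA
    obtain ⟨T, hT, H⟩ := hζ.exists_deep (u - y)
    refine ⟨T, hT, ?_⟩
    have := hu _ (H T le_rfl)
    rw [show u + (T • ζ - (u - y)) = y + T • ζ by abel] at this
    simp [D, this]
  obtain ⟨ht0, ht1⟩ := hZcl.csInf_mem hZne hZbdd
  set t₁ := sInf Z with ht₁
  have e1 : h (y + t₁ • ζ) = f (y + t₁ • ζ) := dist_eq_zero.1 ht1
  have key : κ * t₁ ≤ D 0 := by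
    rcases ht0.eq_or_lt with h0 | h0
    · rw [← h0, mul_zero]; exact dist_nonneg
    obtain ⟨φ, hφ⟩ := hF.exists_folding hF.cov hh hf hζ.neg
    obtain ⟨ε, hε, f', hf', hA', w, hw, H⟩ := hF.folding_local hφ hh (y + t₁ • ζ) (-ζ)
    have hx := hF.folding_eq hφ hζ.neg hf (agree_refl _ f) e1
    simp only [hx, map_neg, smul_neg] at H
    have e0 := (H 0 le_rfl hε.le).1
    simp only [zero_smul, neg_zero, add_zero] at e0
    set s := min ε t₁ with hs
    have hs0 : 0 < s := lt_min hε h0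
    have e2 := (H s hs0.le (min_le_left _ _)).1
    have hDs : D (t₁ - s) = dist (f' (y + t₁ • ζ + -(s • w ζ))) (f (y + t₁ • ζ + -(s • ζ))) := by
      rw [← e2]
      simp only [D]
      rw [show y + (t₁ - s) • ζ = y + t₁ • ζ + -(s • ζ) by module]
    have hne : w ζ ≠ ζ := by
      intro hw1
      have e3 := hF.eq_on_cone hf hf' hζ.neg hA' (e1.symm.trans e0) (c := s • -ζ)
        (smul_mem_cone hs0.le (self_mem_cone _))
      rw [smul_neg] at e3
      rw [hw1, e3, dist_self] at hDs
      have : t₁ ≤ t₁ - s := csInf_le hZbdd ⟨by linarith [min_le_right ε t₁], hDs⟩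
      linarith
    have h3 := hF.dist_le hF.cov hf' hf hζ.neg hA'.symm (y + t₁ • ζ + -(s • w ζ))
      (y + t₁ • ζ + -(s • ζ))
    rw [← hDs, dist_add_left, dist_neg_neg, dist_eq_norm, ← smul_sub, norm_smul, Real.norm_eq_abs,
      abs_of_pos hs0] at h3
    have h4 := hconv.2 (mem_univ 0) (mem_univ t₁) (div_nonneg hs0.le h0.le)
      (sub_nonneg.2 (div_le_one_of_le₀ (min_le_right ε t₁) h0.le)) (by ring)
    have h5 : (s / t₁) • (0 : ℝ) + (1 - s / t₁) • t₁ = t₁ - s := by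
      simp only [smul_eq_mul]; field_simp; ring
    rw [h5, ht1, smul_zero, add_zero, smul_eq_mul] at h4
    have h6 : s * κ ≤ s * (D 0 / t₁) := by
      calc s * κ ≤ s * ‖w ζ - ζ‖ := by gcongr; exact hgap w hw hne
        _ ≤ s / t₁ * D 0 := h3.trans h4
        _ = _ := by ring
    have := le_of_mul_le_mul_left h6 hs0
    rwa [le_div_iff₀ h0] at this
  have hD0 : D 0 = dist (h y) (f y) := by simp [D]
  have hle : t₁ ≤ t := le_of_mul_le_mul_left (by linarith) hκ
  have := hF.eq_on_cone hh hf hζ hA e1 (add_mem_cone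
    (smul_mem_cone (sub_nonneg.2 hle) (self_mem_cone ζ)) hc)
  rwa [show y + t₁ • ζ + ((t - t₁) • ζ + c) = y + t • ζ + c by module] at this

end IsFolded

end Depth
end ReflDatum

namespace ReflDatum

open Filter Topology
open scoped RealInnerProductSpace

section Axioms

variable {E : Type*} [NormedAddCommGroup E] [InnerProductSpace ℝ E] {R : ReflDatum E}
  {Y : Type*} [MetricSpace Y] {F : Set (E → Y)} {m : ℕ}

namespace IsCharts

variable (hF : IsCharts R F)
include hF

lemma convex_overlap (hcn : CN F) {f g : E → Y} (hf : f ∈ F) (hg : g ∈ F) :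
    Convex ℝ {x | f x ∈ range g} := by
  rintro x ⟨x', hx⟩ y ⟨y', hy⟩ α β hα hβ hαβ
  obtain rfl : α = 1 - β := by linarith
  have := hF.segment hcn hf hg hx.symm hy.symm hβ (by linarith)
  rw [show x + β • (y - x) = (1 - β) • x + β • y by module] at this
  exact ⟨_, this.symm⟩

lemma isClosed_overlap [CompleteSpace E] {f g : E → Y} (hf : f ∈ F) (hg : g ∈ F) :
    IsClosed {x | f x ∈ range g} :=
  (hF.isom g hg).isClosedEmbedding.isClosed_range.preimage (hF.isom f hf).continuous

lemma exists_mark (hcn : CN F) (hC : R.Cov F m) {f g : E → Y} (hf : f ∈ F) (hg : g ∈ F) :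
    ∃ w ∈ R.G, ∃ v, ∀ x, f x ∈ range g → f x = g (w x + v) := by
  rcases {x | f x ∈ range g}.eq_empty_or_nonempty with h0 | ⟨x₀, hx₀⟩
  · exact ⟨1, R.G.one_mem, 0, fun x hx => absurd hx (eq_empty_iff_forall_notMem.1 h0 x)⟩
  obtain ⟨ζ, hζ⟩ := R.exists_reg
  obtain ⟨φ, hφ⟩ := hF.exists_folding hC hf hg hζ
  have hφ1 : ∀ x y, f x = g y → φ x = y := fun x y e =>
    hF.folding_eq hφ hζ hg (agree_refl ζ g) e
  have hφ2 : ∀ x, f x ∈ range g → f x = g (φ x) := by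
    rintro x ⟨y, hy⟩
    rw [hφ1 x y hy.symm, hy]
  have hseg : ∀ x y, f x ∈ range g → f y ∈ range g → ∀ t : ℝ, 0 ≤ t → t ≤ 1 →
      f (x + t • (y - x)) = g (φ x + t • (φ y - φ x)) := fun x y hx hy t h0 h1 =>
    hF.segment hcn hf hg (hφ2 x hx) (hφ2 y hy) h0 h1
  let Z : Set (E × E) := (fun y => (y - x₀, φ y - φ x₀)) '' {x | f x ∈ range g}
  have hZ : Convex ℝ Z := by
    rintro _ ⟨x, hx, rfl⟩ _ ⟨y, hy, rfl⟩ α β hα hβ hαβ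
    obtain rfl : α = 1 - β := by linarith
    have h1 := hseg x y hx hy β hβ (by linarith)
    refine ⟨x + β • (y - x), ⟨_, h1.symm⟩, ?_⟩
    dsimp only
    rw [hφ1 _ _ h1, Prod.smul_mk, Prod.smul_mk, Prod.mk_add_mk]
    congr 1 <;> module
  have := R.finG
  obtain ⟨_, ⟨w, rfl⟩, hw⟩ := exists_submodule_of_convex_cover hZ ⟨_, x₀, hx₀, rfl⟩
    (S := range fun w : R.G => LinearMap.graph (w : E ≃ₗᵢ[ℝ] E).toLinearEquiv.toLinearMap)
    (finite_range _) (by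
      rintro _ ⟨y, hy, rfl⟩
      obtain ⟨ε, hε, h, -, -, w, hw, H⟩ := hF.folding_local hφ hf x₀ (y - x₀)
      have hs : 0 < min ε 1 := lt_min hε one_pos
      have h1 := (H _ hs.le (min_le_left _ _)).2
      rw [hφ1 _ _ (hseg x₀ y hx₀ hy _ hs.le (min_le_right _ _))] at h1
      refine ⟨_, ⟨⟨w, hw⟩, rfl⟩, ?_⟩
      rw [LinearMap.mem_graph_iff]
      exact smul_right_injective E hs.ne' (add_left_cancel h1))
  refine ⟨w, w.2, φ x₀ - (w : E ≃ₗᵢ[ℝ] E) x₀, fun x hx => ?_⟩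
  have h1 : φ x - φ x₀ = (w : E ≃ₗᵢ[ℝ] E) (x - x₀) := hw ⟨x, hx, rfl⟩
  rw [hφ2 x hx, ← sub_add_cancel (φ x) (φ x₀), h1, map_sub]
  congr 1
  abel

omit hF [MetricSpace Y] in
lemma exists_common_chart (hC : R.Cov F m) {f g : E → Y} (hf : f ∈ F) (hg : g ∈ F) {ξ ζ : E}
    (hξ : R.Reg ξ) (hζ : R.Reg ζ) : ∃ h ∈ F, ∃ u v,
      (∀ c ∈ R.Cone ξ, f (u + c) ∈ range h) ∧ ∀ c ∈ R.Cone ζ, g (v + c) ∈ range h := by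
  obtain ⟨X, hX, hP⟩ := hC f hf g hg ζ hζ
  obtain ⟨j, hj⟩ : ∃ j, ∃ᶠ t : ℝ in atTop, t • ξ ∈ X j := by
    by_contra! hcon
    obtain ⟨t, ht⟩ := (eventually_all.2 hcon).exists
    obtain ⟨j, hj⟩ := hX (t • ξ)
    exact ht j hj
  obtain ⟨hRC, h, hh, ⟨v, hv⟩, w, -, v', H⟩ := hP j
  obtain ⟨t₀, ht₀⟩ := hj.exists
  refine ⟨h, hh, t₀ • ξ, v, fun c hc => ?_, fun c hc => ⟨_, hv c hc⟩⟩
  have : t₀ • ξ + c ∈ X j := by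
    by_contra hn
    obtain ⟨b, hb, hlt⟩ := hRC ⟨_, ht₀⟩ _ hn
    have h1 := hlt _ ht₀
    rw [inner_add_right] at h1
    have h2 : ⟪b, ξ⟫ < 0 := by
      refine lt_of_le_of_ne (not_lt.1 fun h => ?_) (hξ b hb)
      linarith [hc b hb h]
    obtain ⟨t, ht, htX⟩ := (hj.and_eventually
      (eventually_ge_atTop (⟪b, t₀ • ξ + c⟫ / ⟪b, ξ⟫))).exists
    have h3 := hlt _ ht
    rw [real_inner_smul_right] at h3
    rw [div_le_iff_of_neg h2] at htX
    linarith
  exact ⟨_, (H _ this).symm⟩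

lemma isFolded [CompleteSpace E] (hcn : CN F) (hC : R.Cov F m) : IsFolded R F m :=
  ⟨hF, fun _ hf _ hg => hF.isClosed_overlap hf hg, fun _ hf _ hg => hF.convex_overlap hcn hf hg, hC⟩

end IsCharts

lemma eq_neg_of_disjoint_half {a b : E} (ha : ‖a‖ = 1) (hb : ‖b‖ = 1) {c c' : ℝ}
    (h : ∀ x, c ≤ ⟪a, x⟫ → ¬ c' ≤ ⟪b, x⟫) : b = -a ∧ -c < c' := by
  have hab : b = -a := by
    by_contra hne
    have h0 : 0 < ‖a + b‖ ^ 2 := by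
      have : a + b ≠ 0 := fun h => hne (eq_neg_of_add_eq_zero_right h)
      positivity
    rw [norm_add_sq_real, ha, hb] at h0
    have h1 : (0 : ℝ) < 1 + ⟪a, b⟫ := by linarith
    refine h ((max c c' / (1 + ⟪a, b⟫)) • (a + b)) ?_ ?_
    · rw [real_inner_smul_right, inner_add_right, real_inner_self_eq_norm_sq, ha, one_pow,
        div_mul_cancel₀ _ h1.ne']
      exact le_max_left _ _
    · rw [real_inner_smul_right, inner_add_right, real_inner_self_eq_norm_sq, hb, one_pow,
        real_inner_comm a b, add_comm ⟪a, b⟫, div_mul_cancel₀ _ h1.ne']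
      exact le_max_right _ _
  refine ⟨hab, ?_⟩
  have := h (c • a) (by rw [real_inner_smul_right, real_inner_self_eq_norm_sq, ha]; simp)
  rw [hab, inner_neg_left, real_inner_smul_right, real_inner_self_eq_norm_sq, ha] at this
  linarith

namespace IsFolded

variable (hF : IsFolded R F m)
include hF

lemma lt_of_half {f₁ f₂ f₃ : E → Y} (hf₁ : f₁ ∈ F) (hf₂ : f₂ ∈ F) (hf₃ : f₃ ∈ F) {a : E}
    (ha : a ∈ R.Φ) {c c' c'' : ℝ} (e : ∀ x, ⟪a, x⟫ ≤ c → f₁ x = f₂ x)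
    (h12 : ∀ x, f₁ x ∈ range f₂ → ⟪a, x⟫ ≤ c) (h13 : ∀ x, f₁ x ∈ range f₃ ↔ c' ≤ ⟪a, x⟫)
    (h23 : ∀ x, f₂ x ∈ range f₃ ↔ c'' ≤ ⟪a, x⟫) (hc : c < c') : c' < c'' := by
  have ha1 : ⟪a, a⟫ = 1 := by rw [real_inner_self_eq_norm_sq, R.unit a ha, one_pow]
  obtain ⟨g, hg, hgr, hg1⟩ : ∃ g ∈ F, range g = range f₃ ∧ ∀ x, c' ≤ ⟪a, x⟫ → f₁ x = g x := by
    obtain ⟨w, hw, v, H⟩ := hF.exists_mark hF.isCN hF.cov hf₁ hf₃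
    refine ⟨_, hF.A1 f₃ hf₃ w hw v, subset_antisymm (by rintro _ ⟨x, rfl⟩; exact ⟨_, rfl⟩) ?_,
      fun x hx => H x ((h13 x).2 hx)⟩
    rintro _ ⟨x, rfl⟩
    exact ⟨w⁻¹ (x - v), by simp only [map_inv_map, sub_add_cancel]⟩
  obtain ⟨ζ, hζ, haζ, hpos⟩ := R.exists_reg_cone_pos (R.neg a ha) (y := -a) (by
    rw [real_inner_self_eq_norm_sq]; positivity)
  have hA : R.Agree ζ f₁ f₂ := by
    refine ⟨c • a, fun d hd => (e _ ?_).symm⟩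
    have := hd _ (R.neg a ha) hpos
    rw [inner_neg_left] at this
    rw [inner_add_right, real_inner_smul_right, ha1]
    linarith
  obtain ⟨φ, hφ⟩ := hF.exists_folding hF.cov hg hf₁ hζ
  obtain ⟨x, hx⟩ := hgr.ge ((h23 (c'' • a)).2 (by rw [real_inner_smul_right, ha1, mul_one]))
  have hxc : ⟪a, x⟫ < c' := by
    by_contra! hn
    have := h12 x ⟨c'' • a, by rw [hg1 x hn, hx]⟩
    linarith
  have hφx : φ x = c'' • a := hF.folding_eq hφ hζ hf₂ hA hx
  have hφw : ∀ y, ⟪a, y⟫ = c' → φ y = y := fun y hy =>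
    hF.folding_eq hφ hζ hf₁ (agree_refl _ _) (hg1 y hy.ge).symm
  set t := c' - ⟪a, x⟫ with ht
  set x₀ := x + t • a with hx₀
  have hx₀a : ⟪a, x₀⟫ = c' := by
    rw [hx₀, inner_add_right, real_inner_smul_right, ha1]; linarith
  obtain ⟨ε, hε, h, hh, hAh, w, hw, H⟩ := hF.folding_local hφ hg x₀ (-a)
  rw [hφw x₀ hx₀a] at H
  have hperp : ∀ v, ⟪a, v⟫ = 0 → 0 ≤ ⟪w (-a), v⟫ := by
    intro v hv
    have h1 := inner_le_of_rays (x := ε • -a) (y := ε • w (-a)) (c := v) fun τ _ => by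
      have h2 := hφ.short (x₀ + ε • -a) (x₀ + τ • v)
      rw [(H ε hε.le le_rfl).2, hφw (x₀ + τ • v) (by
        rw [inner_add_right, real_inner_smul_right, hv, hx₀a]; ring), dist_add_left, dist_add_left,
        dist_eq_norm, dist_eq_norm] at h2
      exact h2
    rw [real_inner_smul_left, real_inner_smul_left, inner_neg_left, hv] at h1
    nlinarith
  have hperp' : ∀ v, ⟪a, v⟫ = 0 → ⟪w (-a), v⟫ = 0 := fun v hv => by
    have h1 := hperp v hv
    have h2 := hperp (-v) (by rw [inner_neg_right, hv, neg_zero])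
    rw [inner_neg_right] at h2
    linarith
  obtain ⟨r, hr⟩ : ∃ r : ℝ, w (-a) = r • a := by
    refine ⟨⟪a, w (-a)⟫, ?_⟩
    have h0 : ⟪a, w (-a) - ⟪a, w (-a)⟫ • a⟫ = 0 := by
      rw [inner_sub_right, real_inner_smul_right, ha1]; ring
    have h1 := hperp' _ h0
    rw [← sub_eq_zero, ← inner_self_eq_zero (𝕜 := ℝ)]
    nth_rw 1 [inner_sub_left]
    rw [real_inner_smul_left, h0, h1]; ring
  have hr1 : |r| = 1 := by
    have := congrArg norm hr
    rw [w.norm_map, norm_neg, norm_smul, R.unit a ha, mul_one, Real.norm_eq_abs] at this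
    exact this.symm
  have hr2 : r = 1 := by
    rcases eq_or_eq_neg_of_abs_eq hr1 with h1 | h1
    · exact h1
    exfalso
    rw [hr, h1, neg_smul, one_smul] at H
    have h0 := (H 0 le_rfl hε.le).1
    simp only [zero_smul, add_zero] at h0
    have h2 := hF.eq_on_cone hf₁ hh hζ hAh (z := x₀) (by rw [← h0, hg1 x₀ hx₀a.ge])
      (smul_mem_cone hε.le haζ)
    rw [← (H ε hε.le le_rfl).1] at h2
    have h3 := (h13 _).1 (hgr.le ⟨_, h2.symm⟩)
    rw [inner_add_right, hx₀a, real_inner_smul_right, inner_neg_right, ha1] at h3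
    linarith
  rw [hr, hr2, one_smul] at H
  have hconv := hF.folding_concave hφ hg hζ x₀ (-a) haζ
  have ht0 : 0 < t := by linarith
  have hs0 : 0 < min ε t := lt_min hε ht0
  have h4 := hconv.2 (mem_univ 0) (mem_univ t) (sub_nonneg.2
    (div_le_one_of_le₀ (min_le_right ε t) ht0.le)) (div_nonneg hs0.le ht0.le) (by ring)
  have e5 : (1 - min ε t / t) • (0 : ℝ) + (min ε t / t) • t = min ε t := by
    simp only [smul_eq_mul]; field_simp; ring
  rw [e5] at h4
  dsimp only at h4
  rw [(H _ hs0.le (min_le_left _ _)).2, show x₀ + t • -a = x by rw [hx₀]; module, hφx, zero_smul,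
    add_zero, hφw x₀ hx₀a] at h4
  simp only [inner_neg_right, inner_add_left, real_inner_smul_left, ha1, real_inner_comm a x₀, hx₀a,
    smul_eq_mul, mul_one, neg_neg] at h4
  have h5 : min ε t / t * t ≤ min ε t / t * (c'' - c') := by
    rw [div_mul_cancel₀ _ ht0.ne']; nlinarith
  have := le_of_mul_le_mul_left h5 (div_pos hs0 ht0)
  linarith

lemma A5 {f₁ f₂ f₃ : E → Y} (hf₁ : f₁ ∈ F) (hf₂ : f₂ ∈ F) (hf₃ : f₃ ∈ F) (h12 : R.Half f₁ f₂)
    (h23 : R.Half f₂ f₃) (h13 : R.Half f₁ f₃) : ∃ x, f₁ x ∈ range f₂ ∧ f₁ x ∈ range f₃ := by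
  by_contra! hcon
  obtain ⟨a₁, ha₁, c₁, h12⟩ := h12
  obtain ⟨a₂, ha₂, c₂, h23⟩ := h23
  obtain ⟨a₃, ha₃, c₃, h13⟩ := h13
  obtain ⟨w, hw, v, H⟩ := hF.exists_mark hF.isCN hF.cov hf₁ hf₂
  let g : E → Y := fun x => f₂ (w x + v)
  have hg : g ∈ F := hF.A1 f₂ hf₂ w hw v
  have hgi := hF.isom g hg
  have e : ∀ x, c₁ ≤ ⟪a₁, x⟫ → f₁ x = g x := fun x hx => H x ((h12 x).2 hx)
  have h12' : ∀ x, f₁ x ∈ range g → c₁ ≤ ⟪a₁, x⟫ := by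
    rintro x ⟨y, hy⟩
    exact (h12 x).1 ⟨_, hy⟩
  have hwa : w⁻¹ a₂ ∈ R.Φ := R.map _ (R.G.inv_mem hw) _ ha₂
  have h23' : ∀ x, g x ∈ range f₃ ↔ c₂ - ⟪a₂, v⟫ ≤ ⟪w⁻¹ a₂, x⟫ := fun x => by
    rw [h23, inner_add_right, inner_map_symm, sub_le_iff_le_add]
  obtain ⟨e3, hlt3⟩ := eq_neg_of_disjoint_half (R.unit _ ha₁) (R.unit _ ha₃) (c := c₁) (c' := c₃)
    fun x hx hx' => hcon x ((h12 x).2 hx) ((h13 x).2 hx')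
  obtain ⟨e2, hlt2⟩ := eq_neg_of_disjoint_half (R.unit _ ha₁) (R.unit _ hwa) (c := c₁)
    (c' := c₂ - ⟪a₂, v⟫) fun x hx hx' => hcon x ((h12 x).2 hx) (by
      rw [e x hx]; exact (h23' x).2 hx')
  rw [e2] at h23'
  rw [e3] at h13
  have hneg : ∀ x, c₁ ≤ ⟪a₁, x⟫ ↔ ⟪-a₁, x⟫ ≤ -c₁ := fun x => by rw [inner_neg_left, neg_le_neg_iff]
  simp only [hneg] at e h12'
  have l1 := hF.lt_of_half hf₁ hg hf₃ (R.neg _ ha₁) e h12' h13 h23' hlt3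
  have l2 := hF.lt_of_half hg hf₁ hf₃ (R.neg _ ha₁) (fun x hx => (e x hx).symm) (by
    rintro x ⟨y, hy⟩
    have hy' := h12' y ⟨x, hy.symm⟩
    rw [e y hy'] at hy
    rwa [← hgi.injective hy]) h23' h13 hlt2
  exact lt_asymm l1 l2

lemma isBldg : IsBldg R F :=
  ⟨hF.toIsCharts, hF.A2closed, hF.A2convex, fun _ hf _ hg => hF.exists_mark hF.isCN hF.cov hf hg,
    fun _ hf _ hg _ _ hξ hζ => IsCharts.exists_common_chart hF.cov hf hg hξ hζ,
    fun _ hf₁ _ hf₂ _ hf₃ => hF.A5 hf₁ hf₂ hf₃⟩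

end IsFolded

end Axioms
end ReflDatum

namespace ReflDatum

open Filter Topology
open scoped RealInnerProductSpace

section UltraPower

lemma exists_eventually_of_finite {α ι : Type*} (ω : Ultrafilter α) {S : Set ι} (hS : S.Finite)
    {P : ι → α → Prop} (h : ∀ᶠ i in ω, ∃ s ∈ S, P s i) : ∃ s ∈ S, ∀ᶠ i in ω, P s i := by
  have : (⋃ s ∈ S, {i | P s i}) ∈ ω := by
    filter_upwards [h] with i ⟨s, hs, hi⟩ using mem_biUnion hs hi
  exact (Ultrafilter.finite_biUnion_mem_iff hS).1 this

lemma exists_tendsto_of_isBounded {α X : Type*} [PseudoMetricSpace X] [ProperSpace X]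
    (ω : Ultrafilter α) {c : α → X} (hc : Bornology.IsBounded (range c)) :
    ∃ x, Tendsto c ω (𝓝 x) := by
  obtain ⟨x, -, hx⟩ := hc.isCompact_closure.ultrafilter_le_nhds' (ω.map c)
    (mem_map.2 (univ_mem' fun i => subset_closure (mem_range_self i)))
  exact ⟨x, hx⟩

variable (Y : Type*) [MetricSpace Y]

/-- Bounded sequences. -/
structure BddSeq where
  /-- The terms. -/
  val : ℕ → Y
  bdd : Bornology.IsBounded (range val)

variable {Y}

lemma exists_dist_bound {p q : ℕ → Y} (hp : Bornology.IsBounded (range p))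
    (hq : Bornology.IsBounded (range q)) : ∃ C, ∀ i, dist (p i) (q i) ≤ C := by
  obtain ⟨C, hC⟩ := Metric.isBounded_iff.1 (hp.union hq)
  exact ⟨C, fun i => hC (.inl (mem_range_self i)) (.inr (mem_range_self i))⟩

lemma isBounded_of_dist_le {p q : ℕ → Y} (hp : Bornology.IsBounded (range p)) {C : ℝ}
    (h : ∀ i, dist (p i) (q i) ≤ C) : Bornology.IsBounded (range q) := by
  obtain ⟨D, hD⟩ := Metric.isBounded_iff.1 hp
  refine Metric.isBounded_iff.2 ⟨C + D + C, ?_⟩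
  rintro _ ⟨i, rfl⟩ _ ⟨j, rfl⟩
  have h1 := dist_triangle4 (q i) (p i) (p j) (q j)
  rw [dist_comm (q i) (p i)] at h1
  linarith [h i, h j, hD (mem_range_self i) (mem_range_self j)]

namespace BddSeq

lemma exists_lim (p q : BddSeq Y) :
    ∃ x, Tendsto (fun i => dist (p.1 i) (q.1 i)) (hyperfilter ℕ : Filter ℕ) (𝓝 x) := by
  obtain ⟨C, hC⟩ := exists_dist_bound p.2 q.2
  refine exists_tendsto_of_isBounded _ ((Metric.isBounded_Icc 0 C).subset ?_)
  rintro _ ⟨i, rfl⟩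
  exact ⟨dist_nonneg, hC i⟩

instance : Dist (BddSeq Y) := ⟨fun p q => (exists_lim p q).choose⟩

lemma tendsto_dist (p q : BddSeq Y) :
    Tendsto (fun i => dist (p.1 i) (q.1 i)) (hyperfilter ℕ : Filter ℕ) (𝓝 (dist p q)) :=
  (exists_lim p q).choose_spec

instance : PseudoMetricSpace (BddSeq Y) where
  dist_self p := tendsto_nhds_unique (tendsto_dist p p) (by simp)
  dist_comm p q := tendsto_nhds_unique (tendsto_dist p q) (by
    simpa only [dist_comm] using tendsto_dist q p)
  dist_triangle p q r := le_of_tendsto_of_tendsto' (tendsto_dist p r)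
    ((tendsto_dist p q).add (tendsto_dist q r)) fun _ => dist_triangle _ _ _

open Classical in
instance : CompleteSpace (BddSeq Y) := by
  let B : ℕ → ℝ := fun n => (1 / 2) ^ n
  refine Metric.complete_of_convergent_controlled_sequences B (fun n => by positivity)
    fun u hu => ?_
  let A : ℕ → Set ℕ := fun n => {i | ∀ a ≤ n, ∀ b ≤ n, dist ((u a).1 i) ((u b).1 i) < B (min a b)}
  have hA : ∀ n, A n ∈ hyperfilter ℕ := fun n => by
    have : ∀ᶠ i in (hyperfilter ℕ : Filter ℕ), ∀ a ∈ Iic n, ∀ b ∈ Iic n,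
        dist ((u a).1 i) ((u b).1 i) < B (min a b) := by
      refine (eventually_all_finite (finite_Iic n)).2 fun a _ =>
        (eventually_all_finite (finite_Iic n)).2 fun b _ => ?_
      exact (tendsto_dist (u a) (u b)).eventually_lt_const
        (hu (min a b) a b (min_le_left _ _) (min_le_right _ _))
    exact this
  let N : ℕ → ℕ := fun i => Nat.findGreatest (fun n => i ∈ A n) i
  have hN : ∀ i, i ∈ A (N i) := fun i => Nat.findGreatest_spec (P := fun n => i ∈ A n)
    (Nat.zero_le i) (by
      intro a ha b hb
      obtain rfl : a = 0 := by omega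
      obtain rfl : b = 0 := by omega
      simp [B])
  let q : BddSeq Y := ⟨fun i => (u (N i)).1 i, isBounded_of_dist_le (u 0).2 (C := B 0) fun i => by
    simpa using (hN i 0 (Nat.zero_le _) (N i) le_rfl).le⟩
  refine ⟨q, tendsto_iff_dist_tendsto_zero.2 (squeeze_zero (fun _ => dist_nonneg) (fun n => ?_)
    (tendsto_pow_atTop_nhds_zero_of_lt_one (r := (1 / 2 : ℝ)) (by norm_num) (by norm_num)))⟩
  refine le_of_tendsto (tendsto_dist (u n) q) ?_
  filter_upwards [hA n, Nat.hyperfilter_le_atTop (eventually_ge_atTop n)] with i hi hin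
  have h1 : n ≤ N i := Nat.le_findGreatest hin hi
  have h2 := (hN i n h1 (N i) le_rfl).le
  rwa [min_eq_left h1] at h2

end BddSeq

variable (Y) in
/-- The ultrapower of a metric space, made of the bounded sequences. -/
abbrev UltraPower := SeparationQuotient (BddSeq Y)

/-- The sequence `p` represents the point `P` of the ultrapower. -/
def Rep (p : ℕ → Y) (P : UltraPower Y) : Prop :=
  ∃ hb : Bornology.IsBounded (range p), SeparationQuotient.mk (⟨p, hb⟩ : BddSeq Y) = P

lemma exists_rep (P : UltraPower Y) : ∃ p, Rep p P := by
  obtain ⟨p, rfl⟩ := SeparationQuotient.surjective_mk P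
  exact ⟨p.1, p.2, rfl⟩

lemma exists_rep_of_isBounded {p : ℕ → Y} (hp : Bornology.IsBounded (range p)) :
    ∃ P : UltraPower Y, Rep p P := ⟨_, hp, rfl⟩

namespace Rep

variable {p q : ℕ → Y} {P Q : UltraPower Y}

lemma tendsto_dist (hp : Rep p P) (hq : Rep q Q) :
    Tendsto (fun i => dist (p i) (q i)) (hyperfilter ℕ : Filter ℕ) (𝓝 (dist P Q)) := by
  obtain ⟨hb, rfl⟩ := hp
  obtain ⟨hb', rfl⟩ := hq
  rw [SeparationQuotient.dist_mk]
  exact BddSeq.tendsto_dist _ _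

lemma dist_eq (hp : Rep p P) (hq : Rep q Q) {r : ℝ} (h : ∀ i, dist (p i) (q i) = r) :
    dist P Q = r :=
  tendsto_nhds_unique (hp.tendsto_dist hq) (by simp [h])

lemma eq_of_tendsto (hp : Rep p P) (hq : Rep q Q)
    (h : Tendsto (fun i => dist (p i) (q i)) (hyperfilter ℕ : Filter ℕ) (𝓝 0)) : P = Q :=
  dist_eq_zero.1 (tendsto_nhds_unique (hp.tendsto_dist hq) h)

lemma eq_of_eq (hp : Rep p P) (hq : Rep q Q) (h : ∀ i, p i = q i) : P = Q :=
  dist_eq_zero.1 (hp.dist_eq hq fun i => by rw [h, dist_self])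

lemma bound (hp : Rep p P) (hq : Rep q Q) : ∃ C, ∀ i, dist (p i) (q i) ≤ C :=
  exists_dist_bound hp.1 hq.1

end Rep

lemma rep_const (y : Y) : Rep (fun _ => y) (SeparationQuotient.mk
    (⟨fun _ => y, (finite_range_const (c := y)).isBounded⟩ : BddSeq Y)) := ⟨_, rfl⟩

/-- The diagonal embedding. -/
def diag (y : Y) : UltraPower Y := SeparationQuotient.mk
  (⟨fun _ => y, (finite_range_const (c := y)).isBounded⟩ : BddSeq Y)

lemma isometry_diag : Isometry (diag : Y → UltraPower Y) :=
  Isometry.of_dist_eq fun x y => (rep_const x).dist_eq (rep_const y) fun _ => rfl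

/-- The map of ultrapowers induced by an isometry. -/
def ultraMap (g : Y → Y) (hg : Isometry g) : UltraPower Y → UltraPower Y :=
  SeparationQuotient.lift (fun p => SeparationQuotient.mk
    (⟨fun i => g (p.1 i), by
      have := hg.lipschitz.isBounded_image p.2
      rwa [← range_comp] at this⟩ : BddSeq Y)) (by
    intro p q h
    rw [Metric.inseparable_iff] at h
    refine Rep.eq_of_tendsto ⟨_, rfl⟩ ⟨_, rfl⟩ ?_
    simp only [hg.dist_eq]
    exact h ▸ BddSeq.tendsto_dist p q)

lemma Rep.map {p : ℕ → Y} {P : UltraPower Y} (hp : Rep p P) {g : Y → Y} (hg : Isometry g) :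
    Rep (fun i => g (p i)) (ultraMap g hg P) := by
  obtain ⟨hb, rfl⟩ := hp
  exact ⟨_, rfl⟩

lemma isometry_ultraMap {g : Y → Y} (hg : Isometry g) : Isometry (ultraMap g hg) :=
  Isometry.of_dist_eq fun P Q => by
    obtain ⟨p, hp⟩ := exists_rep P
    obtain ⟨q, hq⟩ := exists_rep Q
    refine tendsto_nhds_unique ((hp.map hg).tendsto_dist (hq.map hg)) ?_
    simp only [hg.dist_eq]
    exact hp.tendsto_dist hq

/-- The isometry of ultrapowers induced by an isometry. -/
def ultraEquiv (g : Y ≃ᵢ Y) : UltraPower Y ≃ᵢ UltraPower Y :=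
  IsometryEquiv.mk' (ultraMap g g.isometry) (ultraMap g.symm g.symm.isometry) (fun P => by
    obtain ⟨p, hp⟩ := exists_rep P
    exact ((hp.map g.symm.isometry).map g.isometry).eq_of_eq hp fun i => g.apply_symm_apply _)
    (isometry_ultraMap _)

lemma Rep.equiv {p : ℕ → Y} {P : UltraPower Y} (hp : Rep p P) (g : Y ≃ᵢ Y) :
    Rep (fun i => g (p i)) (ultraEquiv g P) := hp.map g.isometry

lemma ultraEquiv_mul (g h : Y ≃ᵢ Y) : ultraEquiv (g * h) = ultraEquiv g * ultraEquiv h := by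
  ext P
  obtain ⟨p, hp⟩ := exists_rep P
  exact (hp.equiv (g * h)).eq_of_eq ((hp.equiv h).equiv g) fun _ => rfl

lemma ultraEquiv_diag (g : Y ≃ᵢ Y) (y : Y) : ultraEquiv g (diag y) = diag (g y) :=
  ((rep_const y).equiv g).eq_of_eq (rep_const (g y)) fun _ => rfl

variable {E : Type*}

/-- Charts of the ultrapower. -/
def ultraCharts (F : Set (E → Y)) : Set (E → UltraPower Y) :=
  {φ | ∃ f : ℕ → E → Y, (∀ i, f i ∈ F) ∧ ∀ x, Rep (fun i => f i x) (φ x)}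

lemma diag_mem_ultraCharts {F : Set (E → Y)} {f : E → Y} (hf : f ∈ F) :
    (fun x => diag (f x)) ∈ ultraCharts F :=
  ⟨fun _ => f, fun _ => hf, fun x => rep_const (f x)⟩

lemma ultraEquiv_mem_ultraCharts {F : Set (E → Y)} {g : Y ≃ᵢ Y}
    (hg : ∀ f ∈ F, (fun x => g (f x)) ∈ F) {φ : E → UltraPower Y} (hφ : φ ∈ ultraCharts F) :
    (fun x => ultraEquiv g (φ x)) ∈ ultraCharts F := by
  obtain ⟨f, hf, H⟩ := hφ
  exact ⟨fun i x => g (f i x), fun i => hg _ (hf i), fun x => (H x).equiv g⟩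

variable [NormedAddCommGroup E] [InnerProductSpace ℝ E] {R : ReflDatum E} {F : Set (E → Y)} {m : ℕ}

lemma exists_ultraChart (hF : IsCharts R F) {f : ℕ → E → Y} (hf : ∀ i, f i ∈ F) {x₀ : E}
    (h : Bornology.IsBounded (range fun i => f i x₀)) :
    ∃ φ ∈ ultraCharts F, ∀ x, Rep (fun i => f i x) (φ x) := by
  have (x : E) : ∃ P : UltraPower Y, Rep (fun i => f i x) P :=
    exists_rep_of_isBounded (isBounded_of_dist_le h fun i => ((hF.isom _ (hf i)).dist_eq x₀ x).le)
  choose φ hφ using this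
  exact ⟨φ, ⟨f, hf, hφ⟩, hφ⟩

lemma IsCharts.ultra [ProperSpace E] (hF : IsCharts R F) : IsCharts R (ultraCharts F) where
  isom := by
    rintro φ ⟨f, hf, H⟩
    exact Isometry.of_dist_eq fun x y => (H x).dist_eq (H y) fun i => (hF.isom _ (hf i)).dist_eq x y
  A1 := by
    rintro φ ⟨f, hf, H⟩ w hw v
    exact ⟨fun i x => f i (w x + v), fun i => hF.A1 _ (hf i) w hw v, fun x => H _⟩
  A3 := by
    intro P Q
    obtain ⟨p, hp⟩ := exists_rep P
    obtain ⟨q, hq⟩ := exists_rep Q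
    have (i : ℕ) : ∃ f ∈ F, ∃ a b, f a = p i ∧ f b = q i := by
      obtain ⟨f, hf, ⟨a, ha⟩, b, hb⟩ := hF.A3 (p i) (q i)
      exact ⟨f, hf, a, b, ha, hb⟩
    choose f hf a b ha hb using this
    have hf' : ∀ i, (fun x => f i (x + a i)) ∈ F := fun i => hF.A1 _ (hf i) 1 R.G.one_mem (a i)
    have h0 : ∀ i, f i (0 + a i) = p i := fun i => by rw [zero_add, ha]
    obtain ⟨φ, hφ, H⟩ := exists_ultraChart hF hf' (x₀ := 0) (by simpa only [h0] using hp.1)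
    obtain ⟨C, hC⟩ := hp.bound hq
    have hbd : Bornology.IsBounded (range fun i => b i - a i) := by
      refine (Metric.isBounded_closedBall (x := (0 : E)) (r := C)).subset ?_
      rintro _ ⟨i, rfl⟩
      have := hC i
      rwa [← ha, ← hb, (hF.isom _ (hf i)).dist_eq, dist_comm, dist_eq_norm,
        ← mem_closedBall_zero_iff] at this
    obtain ⟨c, hc⟩ := exists_tendsto_of_isBounded (hyperfilter ℕ) hbd
    refine ⟨φ, hφ, ⟨0, (H 0).eq_of_eq hp h0⟩, c, (H c).eq_of_tendsto hq ?_⟩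
    have e : ∀ i, dist (f i (c + a i)) (q i) = dist (b i - a i) c := fun i => by
      rw [← hb, (hF.isom _ (hf i)).dist_eq, dist_comm, dist_eq_norm, dist_eq_norm]
      congr 1; abel
    simp only [e]
    exact tendsto_iff_dist_tendsto_zero.1 hc

omit [InnerProductSpace ℝ E] in
lemma CN.ultra (h : CN F) : CN (ultraCharts F) := by
  rintro φ ⟨f, hf, H⟩ P x e
  obtain ⟨p, hp⟩ := exists_rep P
  exact le_of_tendsto_of_tendsto' (((hp.tendsto_dist (H x)).pow 2).add_const _)
    ((((hp.tendsto_dist (H (x + e))).pow 2).add ((hp.tendsto_dist (H (x - e))).pow 2)).div_const 2)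
    fun i => h (f i) (hf i) (p i) x e

lemma rootConvex_ultra {X : ℕ → Set E} (hX : ∀ i, R.RootConvex (X i)) :
    R.RootConvex {x | ∀ᶠ i in (hyperfilter ℕ : Filter ℕ), x ∈ X i} := by
  rintro ⟨y, hy⟩ x hx
  obtain ⟨b, hb, H⟩ := exists_eventually_of_finite (hyperfilter ℕ) R.finΦ
    (P := fun b i => ∀ y ∈ X i, ⟪b, x⟫ < ⟪b, y⟫) (by
      filter_upwards [hy, Ultrafilter.eventually_not.2 hx] with i h1 h2 using hX i ⟨y, h1⟩ x h2)
  refine ⟨b, hb, fun z hz => ?_⟩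
  obtain ⟨i, h1, h2⟩ := (H.and hz).exists
  exact h1 z h2

open Classical in
lemma IsFolded.piece_ultra [ProperSpace E] (hF : IsFolded R F m) {g k : ℕ → E → Y}
    (hk : ∀ i, k i ∈ F) {γ κ : E → UltraPower Y}
    (hγ : ∀ x, Rep (fun i => g i x) (γ x)) (hκ : ∀ x, Rep (fun i => k i x) (κ x)) {ζ : E}
    (hζ : R.Reg ζ) {X : ℕ → Set E} (hP : ∀ i, R.Piece F (g i) (k i) ζ (X i)) :
    R.Piece (ultraCharts F) γ κ ζ {x | ∀ᶠ i in (hyperfilter ℕ : Filter ℕ), x ∈ X i} := by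
  refine ⟨rootConvex_ultra fun i => (hP i).1, ?_⟩
  rcases eq_empty_or_nonempty {x | ∀ᶠ i in (hyperfilter ℕ : Filter ℕ), x ∈ X i} with h0 | ⟨x₀, hx₀⟩
  · exact ⟨κ, ⟨k, hk, hκ⟩, agree_refl ζ κ, 1, R.G.one_mem, 0, fun x hx => by
      rw [h0] at hx; exact absurd hx (notMem_empty x)⟩
  choose _ h hh hA w hw v H using hP
  let h' : ℕ → E → Y := fun i => if x₀ ∈ X i then h i else k i
  let v' : ℕ → E := fun i => if x₀ ∈ X i then v i else 0
  have hh' : ∀ i, h' i ∈ F := fun i => by dsimp only [h']; split_ifs; exacts [hh i, hk i]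
  have hA' : ∀ i, R.Agree ζ (k i) (h' i) := fun i => by
    dsimp only [h']; split_ifs; exacts [hA i, agree_refl _ _]
  obtain ⟨C, hC⟩ := (hκ 0).bound (hγ x₀)
  have hC0 : 0 ≤ C := dist_nonneg.trans (hC 0)
  have hz : ∀ i, x₀ ∈ X i → ‖w i x₀ + v i‖ ≤ C := fun i hi => by
    have := hF.dist_le hF.cov (hk i) (hh i) hζ (hA i) 0 (w i x₀ + v i)
    rw [← H i x₀ hi, dist_zero_left] at this
    exact this.trans (hC i)
  have hv : Bornology.IsBounded (range v') := by
    refine (Metric.isBounded_closedBall (x := (0 : E)) (r := C + ‖x₀‖)).subset ?_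
    rintro _ ⟨i, rfl⟩
    rw [mem_closedBall_zero_iff]
    dsimp only [v']
    split_ifs with hi
    · have := norm_sub_le (w i x₀ + v i) (w i x₀)
      rw [add_sub_cancel_left, (w i).norm_map] at this
      linarith [hz i hi]
    · rw [norm_zero]; positivity
  have hd : ∀ i, dist (k i 0) (h' i 0) ≤ 2 * C := fun i => by
    dsimp only [h']
    split_ifs with hi
    · have h1 := dist_triangle (k i 0) (g i x₀) (h i 0)
      have h2 := hz i hi
      rw [← dist_zero_right, ← (hF.isom _ (hh i)).dist_eq, ← H i x₀ hi] at h2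
      linarith [hC i]
    · rw [dist_self]; positivity
  obtain ⟨η, hη, Hη⟩ := exists_ultraChart hF.toIsCharts hh' (isBounded_of_dist_le (hκ 0).1 hd)
  obtain ⟨v₀, hv₀⟩ := exists_tendsto_of_isBounded (hyperfilter ℕ) hv
  have := R.finG
  obtain ⟨w₀, -, hw₀⟩ := exists_eventually_of_finite (hyperfilter ℕ) (finite_univ (α := R.G))
    (P := fun u i => w i = u) (Eventually.of_forall fun i => ⟨⟨w i, hw i⟩, mem_univ _, rfl⟩)
  refine ⟨η, hη, ?_, w₀, w₀.2, v₀, fun x hx => ?_⟩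
  · obtain ⟨ε, hε, hgap⟩ := R.exists_gap ζ
    refine ⟨0 + (2 * C / ε) • ζ, fun c hc => (Hη _).eq_of_eq (hκ _) fun i => ?_⟩
    exact (hF.depth (hk i) (hh' i) hζ (hA' i) hε hgap (by
      rw [mul_div_cancel₀ _ hε.ne']; exact hd i) hc).symm
  · refine (hγ x).eq_of_tendsto (Hη _) ((tendsto_iff_dist_tendsto_zero.1 hv₀).congr' ?_)
    filter_upwards [hx, hx₀, hw₀] with i h1 h2 h3
    have h2 : x₀ ∈ X i := h2
    simp only [v', h', h2, if_true]
    rw [H i x h1, (hF.isom _ (hh i)).dist_eq, h3, dist_add_left]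

lemma IsFolded.ultra [ProperSpace E] (hF : IsFolded R F m) : IsFolded R (ultraCharts F) m := by
  refine IsCharts.isFolded hF.toIsCharts.ultra hF.isCN.ultra ?_
  rintro γ ⟨g, hg, hγ⟩ κ ⟨k, hk, hκ⟩ ζ hζ
  choose X hX hP using fun i => hF.cov (g i) (hg i) (k i) (hk i) ζ hζ
  refine ⟨fun j => {x | ∀ᶠ i in (hyperfilter ℕ : Filter ℕ), x ∈ X i j}, fun x => ?_, fun j =>
    hF.piece_ultra hk hγ hκ hζ fun i => hP i j⟩
  obtain ⟨j, -, hj⟩ := exists_eventually_of_finite (hyperfilter ℕ) (finite_univ (α := Idx m))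
    (P := fun j i => x ∈ X i j) (Eventually.of_forall fun i => by
      obtain ⟨j, hj⟩ := hX i x
      exact ⟨j, mem_univ _, hj⟩)
  exact ⟨j, hj⟩

lemma IsBldg.ultra [ProperSpace E] (B : IsBldg R F) : IsBldg R (ultraCharts F) :=
  B.isFolded.ultra.isBldg

end UltraPower
end ReflDatum

namespace SphericalCoxeterSystem

open scoped RealInnerProductSpace

section Datum

variable {n : ℕ} (cs : SphericalCoxeterSystem n)

lemma map_zero_of_mem_Wbar {w : ModelSpace n ≃ᵢ ModelSpace n} (hw : w ∈ cs.Wbar) : w 0 = 0 := by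
  refine Subgroup.closure_induction (p := fun w _ => w 0 = 0) ?_ rfl ?_ ?_ hw
  · intro s hs
    obtain ⟨-, -, p, -, hp⟩ := cs.refl s hs
    exact (Set.ext_iff.1 hp 0).2 (map_zero p)
  · intro x y _ _ hx hy
    rw [IsometryEquiv.mul_apply, hy, hx]
  · intro x _ hx
    exact x.injective (by rw [IsometryEquiv.apply_inv_self, hx])

/-- The linear isometries underlying the finite reflection group. -/
def linearGroup : Subgroup (ModelSpace n ≃ₗᵢ[ℝ] ModelSpace n) where
  carrier := {e | e.toIsometryEquiv ∈ cs.Wbar}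
  one_mem' := cs.Wbar.one_mem
  mul_mem' := fun ha hb => cs.Wbar.mul_mem ha hb
  inv_mem' := fun ha => cs.Wbar.inv_mem ha

lemma exists_linear {w : ModelSpace n ≃ᵢ ModelSpace n} (hw : w ∈ cs.Wbar) :
    ∃ e ∈ cs.linearGroup, ∀ x, e x = w x := by
  refine ⟨w.toRealLinearIsometryEquivOfMapZero (cs.map_zero_of_mem_Wbar hw), ?_, fun x => rfl⟩
  have : (w.toRealLinearIsometryEquivOfMapZero (cs.map_zero_of_mem_Wbar hw)).toIsometryEquiv = w :=
    IsometryEquiv.ext fun x => rfl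
  change (w.toRealLinearIsometryEquivOfMapZero (cs.map_zero_of_mem_Wbar hw)).toIsometryEquiv ∈
    cs.Wbar
  rwa [this]

lemma exists_root {s : ModelSpace n ≃ᵢ ModelSpace n} (hs : s ∈ cs.S) :
    ∃ a : ModelSpace n, ‖a‖ = 1 ∧ ∀ x, s x = x - (2 * ⟪a, x⟫) • a := by
  obtain ⟨e, -, he⟩ := cs.exists_linear (Subgroup.subset_closure hs)
  obtain ⟨hss, -, p, hp, hfix⟩ := cs.refl s hs
  set b := (InnerProductSpace.toDual ℝ (ModelSpace n)).symm p.toContinuousLinearMap with hb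
  have hpb : ∀ x, p x = ⟪b, x⟫ := fun x => by
    rw [hb, InnerProductSpace.toDual_symm_apply]; rfl
  have hb0 : b ≠ 0 := fun h => hp (LinearMap.ext fun x => by rw [hpb, h, inner_zero_left]; rfl)
  have hbn : ‖b‖ ≠ 0 := norm_ne_zero_iff.2 hb0
  have hfix' : ∀ x, s x = x ↔ ⟪b, x⟫ = 0 := fun x => by
    rw [← hpb]; exact Set.ext_iff.1 hfix x
  set a := ‖b‖⁻¹ • b with ha
  have ha1 : ‖a‖ = 1 := by rw [ha, norm_smul, norm_inv, norm_norm, inv_mul_cancel₀ hbn]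
  have hfixa : ∀ x, s x = x ↔ ⟪a, x⟫ = 0 := fun x => by
    rw [hfix', ha, real_inner_smul_left, mul_eq_zero]; simp [hbn]
  have haa : ⟪a, a⟫ = 1 := by rw [real_inner_self_eq_norm_sq, ha1, one_pow]
  clear_value a
  refine ⟨a, ha1, fun x => ?_⟩
  have h2 : ∀ x, s (s x) = x := fun x => DFunLike.congr_fun hss x
  have h1 : ⟪a, x + s x⟫ = 0 := by
    rw [← hfixa, ← he, map_add, he, he, h2, add_comm]
  rw [inner_add_right] at h1
  have h3 : ∀ v, ⟪a, v⟫ = 0 → ⟪x - s x, v⟫ = 0 := fun v hv => by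
    have : ⟪e x, e v⟫ = ⟪x, v⟫ := e.inner_map_map x v
    rw [he, he, (hfixa v).2 hv] at this
    rw [inner_sub_left, this, sub_self]
  have h4 : ⟪a, x - s x - (2 * ⟪a, x⟫) • a⟫ = 0 := by
    rw [inner_sub_right, inner_sub_right, real_inner_smul_right, haa]; linarith
  have h5 := h3 _ h4
  have h6 : x - s x - (2 * ⟪a, x⟫) • a = 0 := by
    rw [← inner_self_eq_zero (𝕜 := ℝ)]
    nth_rw 1 [inner_sub_left]
    rw [real_inner_smul_left, h4, h5]; ring
  rw [sub_sub, sub_eq_zero, add_comm] at h6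
  exact eq_sub_of_add_eq' h6.symm

open Classical in
/-- The unit normal of a generator. -/
def root (s : ModelSpace n ≃ᵢ ModelSpace n) : ModelSpace n :=
  if h : s ∈ cs.S then (cs.exists_root h).choose else 0

lemma norm_root {s : ModelSpace n ≃ᵢ ModelSpace n} (hs : s ∈ cs.S) : ‖cs.root s‖ = 1 := by
  rw [root, dif_pos hs]
  exact (cs.exists_root hs).choose_spec.1

lemma apply_eq_root {s : ModelSpace n ≃ᵢ ModelSpace n} (hs : s ∈ cs.S) (x : ModelSpace n) :
    s x = x - (2 * ⟪cs.root s, x⟫) • cs.root s := by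
  rw [root, dif_pos hs]
  exact (cs.exists_root hs).choose_spec.2 x

lemma conj_root {s : ModelSpace n ≃ᵢ ModelSpace n} (hs : s ∈ cs.S)
    (e : ModelSpace n ≃ₗᵢ[ℝ] ModelSpace n) (x : ModelSpace n) :
    e (s (e⁻¹ x)) = x - (2 * ⟪e (cs.root s), x⟫) • e (cs.root s) := by
  rw [cs.apply_eq_root hs, map_sub, map_smul, ReflDatum.map_inv_map, real_inner_comm,
    real_inner_comm x, ReflDatum.inner_map_symm]

/-- The root datum of a spherical Coxeter system. -/
def datum : ReflDatum (ModelSpace n) where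
  Φ := {a | ∃ e ∈ cs.linearGroup, ∃ s ∈ cs.S, a = e (cs.root s) ∨ a = -e (cs.root s)}
  G := cs.linearGroup
  finG := by
    have := cs.finiteW
    exact Finite.of_injective (β := Subgroup.closure cs.S)
      (fun e : cs.linearGroup => ⟨e.1.toIsometryEquiv, e.2⟩) fun e e' h => by
        ext1
        exact LinearIsometryEquiv.toIsometryEquiv_injective (congrArg Subtype.val h)
  finΦ := by
    have hfin : Set.Finite (cs.linearGroup : Set (ModelSpace n ≃ₗᵢ[ℝ] ModelSpace n)) := by
      have := cs.finiteW
      refine Set.Finite.of_injOn (f := LinearIsometryEquiv.toIsometryEquiv)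
        (t := (Subgroup.closure cs.S : Set (ModelSpace n ≃ᵢ ModelSpace n))) (fun e he => he)
        LinearIsometryEquiv.toIsometryEquiv_injective.injOn (Set.toFinite _)
    refine ((Set.Finite.image2 (fun e s => e (cs.root s)) hfin cs.finiteS).union
      (Set.Finite.image2 (fun e s => -e (cs.root s)) hfin cs.finiteS)).subset ?_
    rintro a ⟨e, he, s, hs, rfl | rfl⟩
    · exact .inl ⟨e, he, s, hs, rfl⟩
    · exact .inr ⟨e, he, s, hs, rfl⟩
  unit := by
    rintro a ⟨e, he, s, hs, rfl | rfl⟩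
    · rw [e.norm_map, cs.norm_root hs]
    · rw [norm_neg, e.norm_map, cs.norm_root hs]
  neg := by
    rintro a ⟨e, he, s, hs, rfl | rfl⟩
    · exact ⟨e, he, s, hs, .inr rfl⟩
    · exact ⟨e, he, s, hs, .inl (neg_neg _)⟩
  map := by
    rintro w hw a ⟨e, he, s, hs, rfl | rfl⟩
    · exact ⟨w * e, mul_mem hw he, s, hs, .inl rfl⟩
    · exact ⟨w * e, mul_mem hw he, s, hs, .inr (map_neg w _)⟩
  refl := by
    rintro a ⟨e, he, s, hs, ha⟩
    obtain ⟨e', he', H⟩ := cs.exists_linear (Subgroup.subset_closure hs)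
    refine ⟨e * e' * e⁻¹, mul_mem (mul_mem he he') (inv_mem he), fun x => ?_⟩
    have : (e * e' * e⁻¹) x = e (s (e⁻¹ x)) := by rw [← H]; rfl
    rw [this, cs.conj_root hs]
    rcases ha with rfl | rfl
    · rfl
    · rw [inner_neg_left]; module

/-- The affine isometry with the given linear part and translation part. -/
def affine (e : ModelSpace n ≃ₗᵢ[ℝ] ModelSpace n) (v : ModelSpace n) :
    ModelSpace n ≃ᵢ ModelSpace n := e.toIsometryEquiv.trans (IsometryEquiv.addRight v)

lemma affine_apply (e : ModelSpace n ≃ₗᵢ[ℝ] ModelSpace n) (v x : ModelSpace n) :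
    affine e v x = e x + v := rfl

lemma affine_mem_W {e : ModelSpace n ≃ₗᵢ[ℝ] ModelSpace n} (he : e ∈ cs.datum.G)
    (v : ModelSpace n) : affine e v ∈ cs.W := by
  have h1 : (IsometryEquiv.addRight v : ModelSpace n ≃ᵢ ModelSpace n) ∈ cs.W :=
    Subgroup.subset_closure (.inr ⟨v, fun x => rfl⟩)
  have h2 : e.toIsometryEquiv ∈ cs.W := Subgroup.closure_mono subset_union_left he
  exact cs.W.mul_mem h1 h2

lemma exists_affine {w : ModelSpace n ≃ᵢ ModelSpace n} (hw : w ∈ cs.W) :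
    ∃ e ∈ cs.datum.G, ∃ v, ∀ x, w x = e x + v := by
  refine Subgroup.closure_induction
    (p := fun w _ => ∃ e ∈ cs.datum.G, ∃ v, ∀ x, w x = e x + v) ?_ ?_ ?_ ?_ hw
  · rintro w (hw | ⟨v, hv⟩)
    · obtain ⟨e, he, H⟩ := cs.exists_linear (Subgroup.subset_closure hw)
      exact ⟨e, he, 0, fun x => by rw [H, add_zero]⟩
    · exact ⟨1, one_mem _, v, hv⟩
  · exact ⟨1, one_mem _, 0, fun x => (add_zero x).symm⟩
  · rintro w w' _ _ ⟨e, he, v, H⟩ ⟨e', he', v', H'⟩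
    exact ⟨e * e', mul_mem he he', e v' + v, fun x => by
      rw [IsometryEquiv.mul_apply, H, H', map_add, add_assoc]; rfl⟩
  · rintro w _ ⟨e, he, v, H⟩
    refine ⟨e⁻¹, inv_mem he, -e⁻¹ v, fun x => w.injective ?_⟩
    rw [IsometryEquiv.apply_inv_self, H, map_add, map_neg, ReflDatum.map_inv_map,
      ReflDatum.map_inv_map, neg_add_cancel_right]

lemma IsAffineReflection.exists_root {r : ModelSpace n ≃ᵢ ModelSpace n}
    (hr : cs.IsAffineReflection r) :
    ∃ a ∈ cs.datum.Φ, ∃ c : ℝ, ∀ x, r x = x - (2 * (⟪a, x⟫ - c)) • a := by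
  obtain ⟨s, hs, w, hw, rfl⟩ := hr
  obtain ⟨e, he, v, H⟩ := cs.exists_affine hw
  refine ⟨e (cs.root s), ⟨e, he, s, hs, .inl rfl⟩, ⟪e (cs.root s), v⟫, fun x => ?_⟩
  have h1 : w⁻¹ x = e⁻¹ (x - v) := w.injective (by
    rw [IsometryEquiv.apply_inv_self, H, ReflDatum.map_inv_map, sub_add_cancel])
  rw [IsometryEquiv.mul_apply, IsometryEquiv.mul_apply, h1, H, cs.conj_root hs, inner_sub_right]
  abel

lemma exists_affineReflection {a : ModelSpace n} (ha : a ∈ cs.datum.Φ) (c : ℝ) :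
    ∃ r, cs.IsAffineReflection r ∧ ∀ x, r x = x - (2 * (⟪a, x⟫ - c)) • a := by
  have ha1 : ⟪a, a⟫ = 1 := by rw [real_inner_self_eq_norm_sq, cs.datum.unit a ha, one_pow]
  obtain ⟨e, he, s, hs, hae⟩ := ha
  refine ⟨affine e (c • a) * s * (affine e (c • a))⁻¹,
    ⟨s, hs, _, cs.affine_mem_W he _, rfl⟩, fun x => ?_⟩
  have h1 : (affine e (c • a))⁻¹ x = e⁻¹ (x - c • a) := (affine e (c • a)).injective (by
    rw [IsometryEquiv.apply_inv_self, affine_apply, ReflDatum.map_inv_map, sub_add_cancel])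
  have h2 : e (s (e⁻¹ (x - c • a))) = x - c • a - (2 * ⟪a, x - c • a⟫) • a := by
    rw [cs.conj_root hs]
    rcases hae with rfl | rfl
    · rfl
    · rw [inner_neg_left]; module
  rw [IsometryEquiv.mul_apply, IsometryEquiv.mul_apply, h1, affine_apply, h2, inner_sub_right,
    real_inner_smul_right, ha1, mul_one]
  abel

variable {cs} in
lemma fixed_iff {r : ModelSpace n ≃ᵢ ModelSpace n} {a : ModelSpace n} (ha : a ∈ cs.datum.Φ) {c : ℝ}
    (h : ∀ x, r x = x - (2 * (⟪a, x⟫ - c)) • a) (x : ModelSpace n) : r x = x ↔ ⟪a, x⟫ = c := by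
  have ha0 : a ≠ 0 := fun h0 => by
    have := cs.datum.unit a ha
    rw [h0, norm_zero] at this
    exact zero_ne_one this
  rw [h, sub_eq_self, smul_eq_zero, or_iff_left ha0, mul_eq_zero, or_iff_right two_ne_zero,
    sub_eq_zero]

variable {cs} in
lemma inner_reflection {r : ModelSpace n ≃ᵢ ModelSpace n} {a : ModelSpace n}
    (ha : a ∈ cs.datum.Φ) {c : ℝ} (h : ∀ x, r x = x - (2 * (⟪a, x⟫ - c)) • a) (x : ModelSpace n) :
    ⟪a, r x⟫ = 2 * c - ⟪a, x⟫ := by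
  rw [h, inner_sub_right, real_inner_smul_right, real_inner_self_eq_norm_sq, cs.datum.unit a ha]
  ring

variable {cs} in
lemma reflection_reflection {r : ModelSpace n ≃ᵢ ModelSpace n} {a : ModelSpace n}
    (ha : a ∈ cs.datum.Φ) {c : ℝ} (h : ∀ x, r x = x - (2 * (⟪a, x⟫ - c)) • a) (x : ModelSpace n) :
    r (r x) = x := by
  rw [h (r x), inner_reflection ha h, h x]
  module

lemma isModelWall_iff {M : Set (ModelSpace n)} :
    cs.IsModelWall M ↔ ∃ a ∈ cs.datum.Φ, ∃ c : ℝ, M = {x | ⟪a, x⟫ = c} := by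
  constructor
  · rintro ⟨r, hr, rfl⟩
    obtain ⟨a, ha, c, H⟩ := hr.exists_root
    exact ⟨a, ha, c, Set.ext fun x => fixed_iff ha H x⟩
  · rintro ⟨a, ha, c, rfl⟩
    obtain ⟨r, hr, H⟩ := cs.exists_affineReflection ha c
    exact ⟨r, hr, (Set.ext fun x => fixed_iff ha H x).symm⟩

lemma isModelHalf_iff {M H : Set (ModelSpace n)} : cs.IsModelHalf M H ↔
    ∃ a ∈ cs.datum.Φ, ∃ c : ℝ, M = {x | ⟪a, x⟫ = c} ∧ H = {x | c ≤ ⟪a, x⟫} := by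
  constructor
  · rintro ⟨r, hr, rfl, -, hconv, hun, hinter⟩
    obtain ⟨a, ha, c, hra⟩ := hr.exists_root
    have ha1 : ⟪a, a⟫ = 1 := by rw [real_inner_self_eq_norm_sq, cs.datum.unit a ha, one_pow]
    have hM : {x | r x = x} = {x | ⟪a, x⟫ = c} := Set.ext fun x => fixed_iff ha hra x
    rw [hM] at hinter ⊢
    have hMH : ∀ x, ⟪a, x⟫ = c → x ∈ H := fun x hx => (hinter.ge hx).1
    have hcase : ∀ x, x ∈ H ∨ r x ∈ H := fun x => by
      rcases hun.ge (mem_univ x) with h | ⟨y, hy, rfl⟩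
      · exact .inl h
      · exact .inr (by rwa [reflection_reflection ha hra])
    have hboth : ∀ x, x ∈ H → r x ∈ H → ⟪a, x⟫ = c := fun x h1 h2 =>
      hinter.le ⟨h1, r x, h2, reflection_reflection ha hra x⟩
    have hside : ∀ p ∈ H, ∀ x, (∃ t : ℝ, 0 ≤ t ∧ t < 1 ∧ ⟪a, x⟫ - c = t * (⟪a, p⟫ - c)) →
        x ∈ H := by
      rintro p hp x ⟨t, h0, h1, hx⟩
      have hs : 0 < 1 - t := by linarith
      have hm : (1 - t)⁻¹ • (x - t • p) ∈ H := hMH _ (by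
        rw [real_inner_smul_right, inner_sub_right, real_inner_smul_right, inv_mul_eq_div,
          div_eq_iff hs.ne']
        linarith)
      have := hconv hm hp hs.le h0 (by ring)
      rwa [smul_inv_smul₀ hs.ne', sub_add_cancel] at this
    have hone : ∀ p ∈ H, ∀ q ∈ H, c < ⟪a, p⟫ → c ≤ ⟪a, q⟫ := by
      intro p hp q hq hcp
      by_contra! hcq
      set δ := min (⟪a, p⟫ - c) (c - ⟪a, q⟫) / 2 with hδ
      have hmin : 0 < min (⟪a, p⟫ - c) (c - ⟪a, q⟫) := lt_min (by linarith) (by linarith)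
      have hδ0 : 0 < δ := by positivity
      have h1 : δ < ⟪a, p⟫ - c := by
        have := min_le_left (⟪a, p⟫ - c) (c - ⟪a, q⟫); linarith
      have h2 : δ < c - ⟪a, q⟫ := by
        have := min_le_right (⟪a, p⟫ - c) (c - ⟪a, q⟫); linarith
      have hx : ⟪a, (c + δ) • a⟫ = c + δ := by rw [real_inner_smul_right, ha1, mul_one]
      have := hboth ((c + δ) • a)
        (hside p hp _ ⟨δ / (⟪a, p⟫ - c), by positivity, (div_lt_one (by linarith)).2 h1, by
          rw [hx, div_mul_cancel₀ _ (by linarith)]; ring⟩)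
        (hside q hq _ ⟨δ / (c - ⟪a, q⟫), by positivity, (div_lt_one (by linarith)).2 h2, by
          rw [inner_reflection ha hra, hx, ← neg_sub c ⟪a, q⟫, mul_neg,
            div_mul_cancel₀ _ (by linarith)]; ring⟩)
      linarith
    by_cases hp : ∃ p ∈ H, c < ⟪a, p⟫
    · obtain ⟨p, hp, hcp⟩ := hp
      refine ⟨a, ha, c, rfl, subset_antisymm (fun q hq => hone p hp q hq hcp) fun x hx => ?_⟩
      rcases (show c ≤ ⟪a, x⟫ from hx).eq_or_lt with h | h
      · exact hMH x h.symm
      · refine (hcase x).resolve_right fun h' => ?_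
        have := hone p hp _ h' hcp
        rw [inner_reflection ha hra] at this
        linarith
    · push Not at hp
      refine ⟨-a, cs.datum.neg a ha, -c, by ext; simp [inner_neg_left],
        subset_antisymm (fun q hq => ?_) fun x hx => ?_⟩
      · have := hp q hq
        rw [mem_ofPred_eq, inner_neg_left]; linarith
      · have hx : -c ≤ ⟪-a, x⟫ := hx
        rw [inner_neg_left, neg_le_neg_iff] at hx
        rcases hx.eq_or_lt with h | h
        · exact hMH x h
        · refine (hcase x).resolve_right fun h' => ?_
          have := hp _ h'
          rw [inner_reflection ha hra] at this
          linarith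
  · rintro ⟨a, ha, c, rfl, rfl⟩
    obtain ⟨r, hr, hra⟩ := cs.exists_affineReflection ha c
    have him : r '' {x | c ≤ ⟪a, x⟫} = {x | ⟪a, x⟫ ≤ c} := by
      ext x
      constructor
      · rintro ⟨y, hy, rfl⟩
        have hy : c ≤ ⟪a, y⟫ := hy
        rw [mem_ofPred_eq, inner_reflection ha hra]; linarith
      · intro hx
        have hx : ⟪a, x⟫ ≤ c := hx
        refine ⟨r x, ?_, reflection_reflection ha hra x⟩
        rw [mem_ofPred_eq, inner_reflection ha hra]; linarith
    refine ⟨r, hr, (Set.ext fun x => fixed_iff ha hra x).symm,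
      isClosed_le continuous_const (by fun_prop),
      (ReflDatum.rootConvex_half ha c).convex, ?_, ?_⟩
    · rw [him]; ext x; simpa using le_total c ⟪a, x⟫
    · rw [him]; ext x
      exact ⟨fun h => le_antisymm h.2 h.1, fun h =>
        ⟨(show ⟪a, x⟫ = c from h).ge, (show ⟪a, x⟫ = c from h).le⟩⟩

end Datum

end SphericalCoxeterSystem

namespace SphericalCoxeterSystem

open scoped RealInnerProductSpace

section Sectors

variable {n : ℕ} {cs : SphericalCoxeterSystem n}

lemma exists_inner_eq_mul {a b x : ModelSpace n} (ha : a ∈ cs.datum.Φ) (hb : b ∈ cs.datum.Φ)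
    {c : ℝ} (h : {y | ⟪a, y⟫ = ⟪a, x⟫} = {y | ⟪b, y⟫ = c}) :
    ∃ t : ℝ, t ≠ 0 ∧ ∀ y, ⟪b, y⟫ - c = t * ⟪a, y - x⟫ := by
  have haa : ⟪a, a⟫ = 1 := by rw [real_inner_self_eq_norm_sq, cs.datum.unit a ha, one_pow]
  have hbb : ⟪b, b⟫ = 1 := by rw [real_inner_self_eq_norm_sq, cs.datum.unit b hb, one_pow]
  have key : ∀ y, ⟪b, y⟫ - c = ⟪b, a⟫ * ⟪a, y - x⟫ := fun y => by
    have h1 : y - ⟪a, y - x⟫ • a ∈ {y | ⟪a, y⟫ = ⟪a, x⟫} := by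
      rw [mem_ofPred_eq, inner_sub_right, real_inner_smul_right, haa, inner_sub_right]; ring
    have h2 : ⟪b, y - ⟪a, y - x⟫ • a⟫ = c := h.le h1
    rw [inner_sub_right, real_inner_smul_right] at h2
    linarith
  refine ⟨_, fun h0 => ?_, key⟩
  have h1 := key ((c + 1) • b)
  rw [h0, real_inner_smul_right, hbb] at h1
  linarith

lemma IsModelSectorFace.convex {x : ModelSpace n} {F : Set (ModelSpace n)}
    (h : cs.IsModelSectorFace x F) : Convex ℝ F := by
  obtain ⟨-, σ, hσ, rfl⟩ := h
  refine convex_iInter₂ fun M hM => ?_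
  rcases hσ M hM.1 hM.2 with h | ⟨r, -, -, -, h, -⟩
  · obtain ⟨a, -, c, hMa⟩ := cs.isModelWall_iff.1 hM.1
    rw [h, hMa]
    exact convex_hyperplane (innerSL ℝ a).isLinear c
  · exact h

lemma IsModelSectorFace.nonneg_or_nonpos {x : ModelSpace n} {F : Set (ModelSpace n)}
    (h : cs.IsModelSectorFace x F) {a : ModelSpace n} (ha : a ∈ cs.datum.Φ) :
    (∀ y ∈ F, 0 ≤ ⟪a, y - x⟫) ∨ ∀ y ∈ F, ⟪a, y - x⟫ ≤ 0 := by
  obtain ⟨-, σ, hσ, rfl⟩ := h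
  have hM : cs.IsModelWall {y | ⟪a, y⟫ = ⟪a, x⟫} := cs.isModelWall_iff.2 ⟨a, ha, _, rfl⟩
  have hmem : ∀ y ∈ ⋂ M ∈ {M | cs.IsModelWall M ∧ x ∈ M}, σ M, y ∈ σ {y | ⟪a, y⟫ = ⟪a, x⟫} :=
    fun y hy => mem_iInter₂.1 hy _ ⟨hM, rfl⟩
  rcases hσ _ hM rfl with h | h
  · refine .inl fun y hy => ?_
    have h1 : ⟪a, y⟫ = ⟪a, x⟫ := h.le (hmem y hy)
    rw [inner_sub_right, h1, sub_self]
  · obtain ⟨b, hb, c, h1, h2⟩ := cs.isModelHalf_iff.1 h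
    obtain ⟨t, ht0, ht⟩ := exists_inner_eq_mul ha hb h1
    have h3 : ∀ y ∈ ⋂ M ∈ {M | cs.IsModelWall M ∧ x ∈ M}, σ M, 0 ≤ t * ⟪a, y - x⟫ := fun y hy => by
      have : c ≤ ⟪b, y⟫ := h2.le (hmem y hy)
      rw [← ht]; linarith
    rcases ht0.lt_or_gt with h | h
    · exact .inr fun y hy => nonpos_of_mul_nonneg_right (h3 y hy) h
    · exact .inl fun y hy => nonneg_of_mul_nonneg_right (h3 y hy) h

lemma isModelSectorFace_cone {ξ : ModelSpace n} (hξ : cs.datum.Reg ξ) (x : ModelSpace n) :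
    cs.IsModelSectorFace x {y | y - x ∈ cs.datum.Cone ξ} := by
  refine ⟨⟨x, by simpa using ReflDatum.zero_mem_cone ξ⟩, fun M => {y | ∀ a ∈ cs.datum.Φ,
    0 < ⟪a, ξ⟫ → M = {z | ⟪a, z⟫ = ⟪a, x⟫} → ⟪a, x⟫ ≤ ⟪a, y⟫}, fun M hM hx => .inr ?_, ?_⟩
  · have : ∃ a ∈ cs.datum.Φ, 0 < ⟪a, ξ⟫ ∧ M = {z | ⟪a, z⟫ = ⟪a, x⟫} := by
      obtain ⟨a, ha, c, rfl⟩ := cs.isModelWall_iff.1 hM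
      have hx : ⟪a, x⟫ = c := hx
      subst hx
      rcases (hξ a ha).lt_or_gt with h | h
      · exact ⟨-a, cs.datum.neg a ha, by rw [inner_neg_left]; linarith, by
          ext; simp [inner_neg_left]⟩
      · exact ⟨a, ha, h, rfl⟩
    obtain ⟨a, ha, haξ, rfl⟩ := this
    refine cs.isModelHalf_iff.2 ⟨a, ha, ⟪a, x⟫, rfl, subset_antisymm
      (fun y hy => hy a ha haξ rfl) fun y hy b hb hbξ hab => ?_⟩
    obtain ⟨t, ht0, ht⟩ := exists_inner_eq_mul ha hb hab
    have h1 := ht (x + ξ)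
    rw [inner_add_right, add_sub_cancel_left, add_sub_cancel_left] at h1
    have h2 : 0 < t := pos_of_mul_pos_left (h1 ▸ hbξ) haξ.le
    have h3 : 0 ≤ ⟪a, y - x⟫ := by rw [inner_sub_right]; exact sub_nonneg.2 hy
    have := ht y
    nlinarith
  · ext y
    simp only [mem_iInter₂]
    constructor
    · intro hy M hM a ha haξ _
      have := hy a ha haξ
      rw [inner_sub_right] at this
      linarith
    · intro hy a ha haξ
      have := hy {z | ⟪a, z⟫ = ⟪a, x⟫} ⟨cs.isModelWall_iff.2 ⟨a, ha, _, rfl⟩, rfl⟩ a ha haξ rfl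
      rw [inner_sub_right]
      linarith

lemma isModelSector_iff {x : ModelSpace n} {F : Set (ModelSpace n)} :
    cs.IsModelSector x F ↔ ∃ ξ, cs.datum.Reg ξ ∧ F = {y | y - x ∈ cs.datum.Cone ξ} := by
  constructor
  · rintro ⟨hF, hmax⟩
    let Z : ModelSpace n → Set (ModelSpace n) := fun p => {a ∈ cs.datum.Φ | ⟪a, p - x⟫ ≠ 0}
    have hfin : (Z '' F).Finite := (cs.datum.finΦ.finite_subsets).subset (by
      rintro _ ⟨p, -, rfl⟩; exact fun a ha => ha.1)
    obtain ⟨_, ⟨⟨p, hp, rfl⟩, hpm⟩⟩ := hfin.exists_maximal (hF.1.image Z)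
    obtain ⟨ξ, hξ, hpξ⟩ := cs.datum.exists_reg_cone (p - x)
    refine ⟨ξ, hξ, (hmax _ (isModelSectorFace_cone hξ x) fun q hq a ha haξ => ?_).symm⟩
    by_contra! hlt
    have hpa := hpξ a ha haξ
    have hp0 : ⟪a, p - x⟫ = 0 := by
      rcases hF.nonneg_or_nonpos ha with h | h
      · exact absurd (h q hq) (not_le.2 hlt)
      · exact le_antisymm (h p hp) hpa
    set m := (2⁻¹ : ℝ) • p + (2⁻¹ : ℝ) • q with hm
    have hmF : m ∈ F := hF.convex hp hq (by norm_num) (by norm_num) (by norm_num)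
    have hin : ∀ b, ⟪b, m - x⟫ = 2⁻¹ * ⟪b, p - x⟫ + 2⁻¹ * ⟪b, q - x⟫ := fun b => by
      simp only [hm, inner_sub_right, inner_add_right, real_inner_smul_right]; ring
    have hle : Z p ≤ Z m := fun b ⟨hb, hbp⟩ => ⟨hb, fun h0 => hbp (by
      rw [hin] at h0
      rcases hF.nonneg_or_nonpos hb with h | h
      · linarith [h p hp, h q hq]
      · linarith [h p hp, h q hq])⟩
    have := hpm ⟨m, hmF, rfl⟩ hle (show a ∈ Z m from ⟨ha, by rw [hin, hp0]; linarith⟩)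
    exact this.2 hp0
  · rintro ⟨ξ, hξ, rfl⟩
    refine ⟨isModelSectorFace_cone hξ x, fun F' hF' hsub => subset_antisymm
      (fun y hy a ha haξ => ?_) hsub⟩
    have h1 : x + ξ ∈ F' := hsub (by simpa using ReflDatum.self_mem_cone ξ)
    rcases hF'.nonneg_or_nonpos ha with h | h
    · exact h y hy
    · have := h _ h1
      rw [add_sub_cancel_left] at this
      linarith

variable {X : Type*} [MetricSpace X] {C : Set (ModelSpace n → X)}

omit [MetricSpace X] in
lemma isSector_iff {S : Set X} : IsSector cs C S ↔
    ∃ f ∈ C, ∃ x ξ, cs.datum.Reg ξ ∧ S = (fun c => f (x + c)) '' cs.datum.Cone ξ := by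
  have key : ∀ (f : ModelSpace n → X) (x ξ : ModelSpace n),
      f '' {y | y - x ∈ cs.datum.Cone ξ} = (fun c => f (x + c)) '' cs.datum.Cone ξ := by
    intro f x ξ
    ext z
    constructor
    · rintro ⟨y, hy, rfl⟩
      exact ⟨y - x, hy, by simp⟩
    · rintro ⟨c, hc, rfl⟩
      exact ⟨x + c, by simpa using hc, rfl⟩
  constructor
  · rintro ⟨_, f, hf, x, s, hs, -, rfl⟩
    obtain ⟨ξ, hξ, rfl⟩ := isModelSector_iff.1 hs
    exact ⟨f, hf, x, ξ, hξ, key f x ξ⟩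
  · rintro ⟨f, hf, x, ξ, hξ, rfl⟩
    exact ⟨f x, f, hf, x, _, isModelSector_iff.2 ⟨ξ, hξ, rfl⟩, rfl, (key f x ξ).symm⟩

/-- A sector contained in another sector is the image of a translate of the same chamber. -/
lemma exists_subsector (hA2 : ∀ f ∈ C, ∀ g ∈ C,
      ∃ e ∈ cs.datum.G, ∃ v, ∀ x, f x ∈ range g → f x = g (e x + v))
    (hC : ∀ f ∈ C, Isometry f) {f : ModelSpace n → X} (hf : f ∈ C) {ξ : ModelSpace n}
    (hξ : cs.datum.Reg ξ) {T : Set X} (hT : IsSector cs C T)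
    (hTS : T ⊆ f '' cs.datum.Cone ξ) : ∃ u, ∀ c ∈ cs.datum.Cone ξ, f (u + c) ∈ T := by
  obtain ⟨g, hg, x, ζ, hζ, rfl⟩ := isSector_iff.1 hT
  obtain ⟨e, he, v, H⟩ := hA2 g hg f hf
  have h1 : ∀ c ∈ cs.datum.Cone ζ, g (x + c) = f (e (x + c) + v) ∧
      e (x + c) + v ∈ cs.datum.Cone ξ := fun c hc => by
    obtain ⟨y, hy, hyc⟩ := hTS ⟨c, hc, rfl⟩
    have h2 := H (x + c) ⟨y, hyc⟩
    exact ⟨h2, (hC f hf).injective (hyc.trans h2) ▸ hy⟩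
  have h3 : e ζ ∈ cs.datum.Cone ξ := fun a ha haξ => by
    by_contra! hlt
    obtain ⟨k, hk⟩ := exists_nat_gt (⟪a, e x + v⟫ / -⟪a, e ζ⟫)
    have h4 := (h1 _ (ReflDatum.smul_mem_cone k.cast_nonneg
      (ReflDatum.self_mem_cone ζ))).2 a ha haξ
    rw [div_lt_iff₀ (by linarith)] at hk
    rw [map_add, map_smul, add_right_comm, inner_add_right, real_inner_smul_right] at h4
    linarith
  have h5 := ReflDatum.cone_eq hξ (hζ.map he) h3
  refine ⟨e x + v, fun c hc => ⟨e⁻¹ c, ?_, ?_⟩⟩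
  · rw [← ReflDatum.map_mem_cone_iff he, ReflDatum.map_inv_map]
    rw [h5]; exact hc
  · have hc' : e⁻¹ c ∈ cs.datum.Cone ζ := by
      rw [← ReflDatum.map_mem_cone_iff he, ReflDatum.map_inv_map, h5]; exact hc
    change g (x + e⁻¹ c) = _
    rw [(h1 _ hc').1, map_add, ReflDatum.map_inv_map, add_right_comm]

lemma isHalfApartment_iff (hA2 : ∀ f ∈ C, ∀ g ∈ C,
      ∃ e ∈ cs.datum.G, ∃ v, ∀ x, f x ∈ range g → f x = g (e x + v))
    (hC : ∀ f ∈ C, Isometry f) {f g : ModelSpace n → X} (hf : f ∈ C) :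
    IsHalfApartment cs C (range f ∩ range g) ↔ cs.datum.Half f g := by
  constructor
  · rintro ⟨h, hh, m, H, hmH, heq⟩
    obtain ⟨a, ha, c, -, rfl⟩ := cs.isModelHalf_iff.1 hmH
    obtain ⟨e, he, v, hev⟩ := hA2 h hh f hf
    have h1 : ∀ y, c ≤ ⟪a, y⟫ → h y = f (e y + v) ∧ h y ∈ range g := fun y hy =>
      have := heq.ge ⟨y, hy, rfl⟩
      ⟨hev y this.1, this.2⟩
    refine ⟨e a, cs.datum.map e he a ha, c + ⟪e a, v⟫, fun x => ?_⟩
    constructor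
    · intro hx
      obtain ⟨y, hy, hyx⟩ := heq.le ⟨mem_range_self x, hx⟩
      have hy : c ≤ ⟪a, y⟫ := hy
      have := (hC f hf).injective (hyx.symm.trans (h1 y hy).1)
      rw [this, inner_add_right, e.inner_map_map]
      linarith
    · intro hx
      have hy : c ≤ ⟪a, e⁻¹ (x - v)⟫ := by
        rw [ReflDatum.inner_map_symm, inv_inv, inner_sub_right]; linarith
      have := h1 _ hy
      rw [ReflDatum.map_inv_map, sub_add_cancel] at this
      exact this.1 ▸ this.2
  · rintro ⟨a, ha, c, H⟩
    refine ⟨f, hf, _, _, cs.isModelHalf_iff.2 ⟨a, ha, c, rfl, rfl⟩, ?_⟩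
    ext z
    constructor
    · rintro ⟨⟨x, rfl⟩, hx⟩
      exact ⟨x, (H x).1 hx, rfl⟩
    · rintro ⟨x, hx, rfl⟩
      exact ⟨mem_range_self x, (H x).2 hx⟩

end Sectors

end SphericalCoxeterSystem

namespace SphericalCoxeterSystem

open ReflDatum

variable {n : ℕ} {cs : SphericalCoxeterSystem n}

section Corestrict

variable {X : Type*} [MetricSpace X] {Λ : Set X} (B : RBuilding cs X Λ)

/-- The charts of a building, with values in its set of points. -/
def corestrict : Set (ModelSpace n → ↥Λ) := {f | (fun x => (f x : X)) ∈ B.charts}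

lemma exists_corestrict {f : ModelSpace n → X} (hf : f ∈ B.charts) :
    ∃ k ∈ corestrict B, ∀ x, (k x : X) = f x :=
  ⟨fun x => ⟨f x, B.into f hf (mem_range_self x)⟩, hf, fun _ => rfl⟩

omit [MetricSpace X] in
lemma mem_range_coe {f g : ModelSpace n → ↥Λ} {x : ModelSpace n} :
    (f x : X) ∈ range (fun y => (g y : X)) ↔ f x ∈ range g :=
  exists_congr fun _ => Subtype.ext_iff.symm

lemma exists_mark_linear {f g : ModelSpace n → X} (hf : f ∈ B.charts) (hg : g ∈ B.charts) :
    ∃ e ∈ cs.datum.G, ∃ v, ∀ x, f x ∈ range g → f x = g (e x + v) := by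
  obtain ⟨-, -, w, hw, H⟩ := B.A2 f hf g hg
  obtain ⟨e, he, v, h⟩ := cs.exists_affine hw
  exact ⟨e, he, v, fun x hx => by rw [H x hx, h]⟩

omit [MetricSpace X] in
lemma half_coe_iff {f g : ModelSpace n → ↥Λ} :
    cs.datum.Half (fun x => (f x : X)) (fun x => (g x : X)) ↔ cs.datum.Half f g := by
  simp only [Half, mem_range_coe]

lemma isHalfApartment_coe {f g : ModelSpace n → ↥Λ} (hf : f ∈ corestrict B)
    (h : cs.datum.Half f g) :
    IsHalfApartment cs B.charts (range (fun x => (f x : X)) ∩ range (fun x => (g x : X))) :=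
  (isHalfApartment_iff (fun _ h _ h' => exists_mark_linear B h h') B.isom hf).2
    (half_coe_iff.2 h)

lemma isBldg_corestrict : IsBldg cs.datum (corestrict B) where
  isom := fun f hf => Isometry.of_dist_eq fun x y => (B.isom _ hf).dist_eq x y
  A1 := fun f hf w hw v => B.A1 _ hf _ (cs.affine_mem_W hw v)
  A3 := fun p q => by
    obtain ⟨f, hf, ⟨x, hx⟩, ⟨y, hy⟩⟩ := B.A3 p p.2 q q.2
    obtain ⟨k, hk, hkf⟩ := exists_corestrict B hf
    exact ⟨k, hk, ⟨x, Subtype.ext ((hkf x).trans hx)⟩, ⟨y, Subtype.ext ((hkf y).trans hy)⟩⟩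
  A2closed := fun f hf g hg => by simpa only [mem_range_coe] using (B.A2 _ hf _ hg).1
  A2convex := fun f hf g hg => by simpa only [mem_range_coe] using (B.A2 _ hf _ hg).2.1
  A2mark := fun f hf g hg => by
    obtain ⟨e, he, v, H⟩ := exists_mark_linear B hf hg
    exact ⟨e, he, v, fun x hx => Subtype.ext (H x (mem_range_coe.2 hx))⟩
  A4 := fun f hf g hg ξ ζ hξ hζ => by
    have hsec : ∀ k ∈ B.charts, ∀ η, cs.datum.Reg η →
        IsSector cs B.charts (k '' cs.datum.Cone η) := fun k hk η hη =>
      isSector_iff.2 ⟨k, hk, 0, η, hη, by simp only [zero_add]⟩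
    obtain ⟨T₁, T₂, h, hh, hT₁, hT₂, h₁, h₂, hr₁, hr₂⟩ := B.A4 _ _ (hsec _ hf ξ hξ) (hsec _ hg ζ hζ)
    obtain ⟨k, hk, hkh⟩ := exists_corestrict B hh
    obtain rfl : (fun x => (k x : X)) = h := funext hkh
    have hmark := fun f hf g hg => exists_mark_linear B (f := f) (g := g) hf hg
    obtain ⟨u, hu⟩ := exists_subsector hmark B.isom hf hξ hT₁ h₁
    obtain ⟨v, hv⟩ := exists_subsector hmark B.isom hg hζ hT₂ h₂
    exact ⟨k, hk, u, v, fun c hc => mem_range_coe.1 (hr₁ (hu c hc)),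
      fun c hc => mem_range_coe.1 (hr₂ (hv c hc))⟩
  A5 := fun f₁ h₁ f₂ h₂ f₃ h₃ h12 h23 h13 => by
    obtain ⟨_, ⟨⟨x, rfl⟩, hx₂⟩, hx₃⟩ := B.A5 _ h₁ _ h₂ _ h₃ (isHalfApartment_coe B h₁ h12)
      (isHalfApartment_coe B h₂ h23) (isHalfApartment_coe B h₁ h13)
    exact ⟨x, mem_range_coe.1 hx₂, mem_range_coe.1 hx₃⟩

end Corestrict

/-- A building in the sense of root data is a building. -/
def toRBuilding {Y : Type*} [MetricSpace Y] {F : Set (ModelSpace n → Y)}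
    (B : IsBldg cs.datum F) : RBuilding cs Y univ where
  charts := F
  isom := B.isom
  into := fun _ _ => subset_univ _
  A1 := fun f hf w hw => by
    obtain ⟨e, he, v, H⟩ := cs.exists_affine hw
    rw [show f ∘ w = fun x => f (e x + v) from funext fun x => congrArg f (H x)]
    exact B.A1 f hf e he v
  A2 := fun f hf g hg => by
    obtain ⟨e, he, v, H⟩ := B.A2mark f hf g hg
    exact ⟨B.A2closed f hf g hg, B.A2convex f hf g hg, affine e v, cs.affine_mem_W he v, H⟩
  A3 := fun p _ q _ => B.A3 p q
  A4 := fun S₁ S₂ hS₁ hS₂ => by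
    obtain ⟨f, hf, x, ξ, hξ, rfl⟩ := isSector_iff.1 hS₁
    obtain ⟨g, hg, y, ζ, hζ, rfl⟩ := isSector_iff.1 hS₂
    obtain ⟨h, hh, u, v, hu, hv⟩ := B.A4 f hf g hg ξ ζ hξ hζ
    have sub : ∀ (k : ModelSpace n → Y) (z s η : ModelSpace n), k ∈ F → cs.datum.Reg η →
        (∀ c ∈ cs.datum.Cone η, k (s + c) ∈ range h) → ∃ T, IsSector cs F T ∧
          T ⊆ (fun c => k (z + c)) '' cs.datum.Cone η ∧ T ⊆ range h := by
      intro k z s η hk hη hs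
      obtain ⟨p, hpz, hps⟩ := hη.common z s
      refine ⟨_, isSector_iff.2 ⟨k, hk, p, η, hη, rfl⟩, ?_, ?_⟩
      · rintro _ ⟨c, hc, rfl⟩
        exact ⟨p - z + c, add_mem_cone hpz hc, congrArg k (by abel)⟩
      · rintro _ ⟨c, hc, rfl⟩
        have := hs _ (add_mem_cone hps hc)
        rwa [← add_assoc, add_sub_cancel] at this
    obtain ⟨T₁, h₁, h₂, h₃⟩ := sub f x u ξ hf hξ hu
    obtain ⟨T₂, h₄, h₅, h₆⟩ := sub g y v ζ hg hζ hv
    exact ⟨T₁, T₂, h, hh, h₁, h₄, h₂, h₅, h₃, h₆⟩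
  A5 := fun f₁ h₁ f₂ h₂ f₃ h₃ h12 h23 h13 => by
    have key : ∀ f ∈ F, ∀ g, IsHalfApartment cs F (range f ∩ range g) → cs.datum.Half f g :=
      fun f hf g h => (isHalfApartment_iff B.A2mark B.isom hf).1 h
    obtain ⟨x, hx₂, hx₃⟩ := B.A5 f₁ h₁ f₂ h₂ f₃ h₃ (key _ h₁ _ h12)
      (key _ h₂ _ h23) (key _ h₁ _ h13)
    exact ⟨f₁ x, ⟨mem_range_self x, hx₂⟩, hx₃⟩

/-- Isometries of a space, acting on its universal subset. -/
def univConj {Z : Type*} [MetricSpace Z] (g : Z ≃ᵢ Z) : ↥(univ : Set Z) ≃ᵢ ↥(univ : Set Z) where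
  toFun := fun z => ⟨g z, mem_univ _⟩
  invFun := fun z => ⟨g.symm z, mem_univ _⟩
  left_inv := fun z => Subtype.ext (g.symm_apply_apply z)
  right_inv := fun z => Subtype.ext (g.apply_symm_apply z)
  isometry_toFun := fun x y => g.isometry x y

end SphericalCoxeterSystem

/-- **Lemma 8.** Every ℝ-building embeds isometrically into a metrically
complete ℝ-building of the same type, compatibly with charts, and automorphisms extend
via a group homomorphism. -/
theorem embeds_in_complete
    {n : ℕ} (cs : SphericalCoxeterSystem n) {X : Type u} [MetricSpace X]
    {Λ : Set X} (B : RBuilding cs X Λ) :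
    ∃ (X' : Type u) (instX' : MetricSpace X') (Λ' : Set X')
      (B' : RBuilding cs X' Λ') (ι : X → X'),
      IsComplete Λ' ∧
      (∀ x ∈ Λ, ∀ y ∈ Λ, dist (ι x) (ι y) = dist x y) ∧
      ∃ hmaps : ∀ x ∈ Λ, ι x ∈ Λ',
        (∀ f ∈ B.charts, (ι ∘ f) ∈ B'.charts) ∧
        ∃ Φ : (↥Λ ≃ᵢ ↥Λ) → (↥Λ' ≃ᵢ ↥Λ'),
          (∀ g, RBuilding.IsAuto cs B g → RBuilding.IsAuto cs B' (Φ g)) ∧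
          (∀ g h, RBuilding.IsAuto cs B g → RBuilding.IsAuto cs B h → Φ (g * h) = Φ g * Φ h) ∧
          (∀ g, RBuilding.IsAuto cs B g → ∀ x : ↥Λ,
            ((Φ g ⟨ι ↑x, hmaps ↑x x.2⟩ : ↥Λ') : X') = ι ↑(g x)) := by
  classical
  rcases Λ.eq_empty_or_nonempty with rfl | ⟨p, hp⟩
  · exact ⟨X, inferInstance, ∅, B, id, fun f hf h => absurd (by simpa using h) hf.1.ne,
      fun _ _ _ _ => rfl, fun _ h => h, fun _ h => h, id, fun _ h => h, fun _ _ _ _ => rfl, fun _ _ _ => rfl⟩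
  let ι : X → ReflDatum.UltraPower ↥Λ := fun x =>
    ReflDatum.diag (if h : x ∈ Λ then ⟨x, h⟩ else ⟨p, hp⟩)
  have hι : ∀ x : ↥Λ, ι x = ReflDatum.diag x := fun x => congrArg ReflDatum.diag (dif_pos x.2)
  refine ⟨ReflDatum.UltraPower ↥Λ, inferInstance, univ,
    SphericalCoxeterSystem.toRBuilding (SphericalCoxeterSystem.isBldg_corestrict B).ultra, ι,
    isComplete_univ, fun x hx y hy => ?_, fun _ _ => mem_univ _, fun f hf => ?_,
    fun g => SphericalCoxeterSystem.univConj (ReflDatum.ultraEquiv g), fun g hg φ hφ => ?_,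
    fun g h _ _ => ?_, fun g _ x => ?_⟩
  · rw [hι ⟨x, hx⟩, hι ⟨y, hy⟩, ReflDatum.isometry_diag.dist_eq]; rfl
  · obtain ⟨k, hk, hkf⟩ := SphericalCoxeterSystem.exists_corestrict B hf
    rw [show ι ∘ f = fun x => ReflDatum.diag (k x) from funext fun x => by
      rw [← hι, Function.comp_apply, hkf]]
    exact ReflDatum.diag_mem_ultraCharts hk
  · exact ReflDatum.ultraEquiv_mem_ultraCharts (F := SphericalCoxeterSystem.corestrict B)
      (fun f hf => hg _ hf) hφ
  · exact congrArg SphericalCoxeterSystem.univConj (ReflDatum.ultraEquiv_mul g h)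
  · change ReflDatum.ultraEquiv g (ι x) = _
    rw [hι, hι, ReflDatum.ultraEquiv_diag]
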